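/- For every ε ∈ (0, 1/100) there exists a constant K = K(ε) > 0 such that the following holds. Let x ≥ 1, let q be a prime with x^{1/3 + 30ε} ≤ q ≤ x^{1 − ε}, and let z satisfy (x/q)^{1+ε} ≤ z ≤ x^{−ε}·√(qx). Then | (1/φ(q)) ∑_{a mod q, gcd(a,q)=1} | ∑_{(n,d): d²n ≤ x, d² < z, d²n ≡ a mod q} μ(d) − (1/φ(q)) ∑_{(n,d): d²n ≤ x, d² < z, gcd(d²n, q)=1} μ(d) |² − C·√(x/q) | ≤ K · (x/q)^{1/2 − ε/16}. -/

import Mathlib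

open MeasureTheory

/-- The constant `C = ζ(3/2)/π · ∏_p (1 - 3/p² + 2/p³)`. -/
noncomputable def sqfConst : ℝ :=
  ((riemannZeta (3 / 2)).re / Real.pi) *
    ∏' p : Nat.Primes, (1 - 3 / ((p : ℕ) : ℝ) ^ 2 + 2 / ((p : ℕ) : ℝ) ^ 3)

/-- `∑_{(n,d) : d²n ≤ x, d² < z, d²n ≡ a (mod q)} μ(d)`, over positive integers `n, d`. -/
noncomputable def apPairSmallA (x z : ℝ) (q a : ℕ) : ℝ :=
  ∑ d ∈ (Finset.Icc 1 ⌊Real.sqrt x⌋₊).filter (fun d : ℕ => (d : ℝ) ^ 2 < z),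
    ∑ n ∈ Finset.Icc 1 ⌊x / (d : ℝ) ^ 2⌋₊,
      if (d ^ 2 * n) % q = a then (ArithmeticFunction.moebius d : ℝ) else 0

/-- `∑_{(n,d) : d²n ≤ x, d² < z, gcd(d²n, q) = 1} μ(d)`, over positive integers `n, d`. -/
noncomputable def apPairSmallB (x z : ℝ) (q : ℕ) : ℝ :=
  ∑ d ∈ (Finset.Icc 1 ⌊Real.sqrt x⌋₊).filter (fun d : ℕ => (d : ℝ) ^ 2 < z),
    ∑ n ∈ Finset.Icc 1 ⌊x / (d : ℝ) ^ 2⌋₊,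
      if Nat.Coprime (d ^ 2 * n) q then (ArithmeticFunction.moebius d : ℝ) else 0

/-- The divisor bound: `τ(n) ≪ n^η`. -/
theorem exists_card_divisors_le_rpow (η : ℝ) (hη : 0 < η) :
    ∃ C : ℝ, 0 < C ∧ ∀ n : ℕ, n ≠ 0 → (n.divisors.card : ℝ) ≤ C * (n : ℝ) ^ η := by
  set M : ℝ := max 1 (1 / (η * Real.log 2)) with hM
  set B : ℕ := ⌈(2 : ℝ) ^ (1 / η)⌉₊ with hB
  have hlog2 : 0 < Real.log 2 := Real.log_pos (by norm_num)
  have hM1 : 1 ≤ M := le_max_left _ _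
  refine ⟨M ^ B, by positivity, fun n hn => ?_⟩
  have key : ∀ p : ℕ, p.Prime → ∀ a : ℕ,
      ((a + 1 : ℕ) : ℝ) ≤ (if p < B then M else 1) * (((p ^ a : ℕ) : ℝ)) ^ η := by
    intro p hp a
    have hp2 : (2 : ℝ) ≤ p := by exact_mod_cast hp.two_le
    have e1 : (((p ^ a : ℕ) : ℝ)) ^ η = ((p : ℝ) ^ η) ^ a := by
      push_cast
      rw [← Real.rpow_natCast, ← Real.rpow_mul (by positivity), mul_comm,
        Real.rpow_mul (by positivity),
        Real.rpow_natCast]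
    rw [e1]
    split_ifs with h
    · have h2 : (2 : ℝ) ^ η ≤ (p : ℝ) ^ η := Real.rpow_le_rpow (by norm_num) hp2 hη.le
      have h3 : 1 + η * Real.log 2 ≤ (2 : ℝ) ^ η := by
        rw [Real.rpow_def_of_pos (by norm_num)]
        have := Real.add_one_le_exp (Real.log 2 * η)
        linarith
      have h4 : 1 + (a : ℝ) * (η * Real.log 2) ≤ ((p : ℝ) ^ η) ^ a := by
        calc 1 + (a : ℝ) * (η * Real.log 2) ≤ (1 + η * Real.log 2) ^ a :=
              one_add_mul_le_pow (by nlinarith [mul_pos hη hlog2]) a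
          _ ≤ _ := by
              apply pow_le_pow_left₀ (by positivity)
              linarith
      have h5 : 1 ≤ M * (η * Real.log 2) := by
        have : 1 / (η * Real.log 2) ≤ M := le_max_right _ _
        rwa [div_le_iff₀ (by positivity)] at this
      calc ((a + 1 : ℕ) : ℝ) ≤ M * (1 + (a : ℝ) * (η * Real.log 2)) := by
            push_cast
            nlinarith [Nat.cast_nonneg (α := ℝ) a]
        _ ≤ _ := by gcongr
    · rw [one_mul]
      have h1 : (2 : ℝ) ^ (1 / η) ≤ p := by
        push Not at h
        exact (Nat.le_ceil _).trans (by exact_mod_cast h)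
      have h2 : (2 : ℝ) ≤ (p : ℝ) ^ η := by
        calc (2 : ℝ) = ((2 : ℝ) ^ (1 / η)) ^ η := by
              rw [← Real.rpow_mul (by norm_num), one_div, inv_mul_cancel₀ hη.ne', Real.rpow_one]
          _ ≤ _ := Real.rpow_le_rpow (by positivity) h1 hη.le
      calc ((a + 1 : ℕ) : ℝ) ≤ (2 : ℝ) ^ a := by exact_mod_cast a.lt_two_pow_self
        _ ≤ _ := by gcongr
  rw [Nat.card_divisors hn]
  have hprod : (n : ℝ) ^ η = ∏ p ∈ n.primeFactors, (((p ^ n.factorization p : ℕ) : ℝ)) ^ η := by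
    rw [Real.finsetProd_rpow _ _ (fun _ _ => by positivity)]
    congr 1
    conv_lhs => rw [← Nat.prod_factorization_pow_eq_self hn]
    rw [Finsupp.prod, Nat.support_factorization]
    push_cast
    rfl
  rw [hprod]
  push_cast
  calc (∏ p ∈ n.primeFactors, ((n.factorization p : ℝ) + 1))
      ≤ ∏ p ∈ n.primeFactors, ((if p < B then M else 1) *
          (((p ^ n.factorization p : ℕ) : ℝ)) ^ η) := by
        apply Finset.prod_le_prod
        · intros; positivity
        · intro p hp
          have := key p (Nat.prime_of_mem_primeFactors hp) (n.factorization p)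
          push_cast at this ⊢
          exact this
    _ = (∏ p ∈ n.primeFactors, (if p < B then M else 1)) * _ := Finset.prod_mul_distrib
    _ ≤ M ^ B * _ := by
        gcongr
        · rw [← Finset.prod_filter, Finset.prod_const]
          apply pow_le_pow_right₀ hM1
          calc _ ≤ (Finset.range B).card := Finset.card_le_card (by
                  intro p hp
                  simp only [Finset.mem_filter] at hp
                  simpa using hp.2)
            _ = B := by simp
        · simp

/-- The nonzero residues modulo `q` whose least absolute representative is at most `L`. -/
def shortResidues (q : ℕ) [NeZero q] (L : ℕ) : Finset (ZMod q) :=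
  Finset.univ.filter fun n => n ≠ 0 ∧ n.valMinAbs.natAbs ≤ L

theorem mem_shortResidues {q : ℕ} [NeZero q] {L : ℕ} {n : ZMod q} :
    n ∈ shortResidues q L ↔ n ≠ 0 ∧ n.valMinAbs.natAbs ≤ L := by
  simp [shortResidues]

theorem card_shortResidues_le (q : ℕ) [NeZero q] (L : ℕ) : (shortResidues q L).card ≤ 2 * L := by
  have h : ((Finset.Icc (-(L : ℤ)) L).erase 0).card = 2 * L := by
    rw [Finset.card_erase_of_mem (by simp), Int.card_Icc]
    omega
  rw [← h]
  apply Finset.card_le_card_of_injOn ZMod.valMinAbs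
  · intro n hn
    have := mem_shortResidues.1 hn
    have h0 : n.valMinAbs ≠ 0 := by simpa using this.1
    simp only [Finset.coe_erase, Finset.coe_Icc, Set.mem_sdiff, Set.mem_Icc, Set.mem_singleton_iff]
    refine ⟨⟨?_, ?_⟩, h0⟩ <;> omega
  · intro a _ b _ hab
    exact (ZMod.valMinAbs_inj).1 hab

theorem card_filter_valMinAbs_dvd_le {q : ℕ} [NeZero q] (B : Finset (ZMod q)) (N : ℤ) (hN : N ≠ 0) :
    (B.filter fun l => l.valMinAbs ∣ N).card ≤ 2 * N.natAbs.divisors.card := by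
  have h : (B.filter fun l => l.valMinAbs ∣ N).card ≤
      (N.natAbs.divisors.image (fun k : ℕ => (k : ℤ)) ∪
        N.natAbs.divisors.image (fun k : ℕ => -(k : ℤ))).card := by
    apply Finset.card_le_card_of_injOn ZMod.valMinAbs
    · intro n hn
      have hn' : n.valMinAbs ∣ N := (Finset.mem_filter.1 hn).2
      have h1 : n.valMinAbs.natAbs ∈ N.natAbs.divisors := by
        rw [Nat.mem_divisors]
        exact ⟨Int.natAbs_dvd_natAbs.2 hn', by simpa using hN⟩
      simp only [Finset.coe_union, Finset.coe_image, Set.mem_union, Set.mem_image, Finset.mem_coe]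
      rcases Int.natAbs_eq n.valMinAbs with h2 | h2
      · exact Or.inl ⟨_, h1, h2.symm⟩
      · exact Or.inr ⟨_, h1, h2.symm⟩
    · intro a _ b _ hab
      exact (ZMod.valMinAbs_inj).1 hab
  refine h.trans ((Finset.card_union_le _ _).trans ?_)
  have := Finset.card_image_le (s := N.natAbs.divisors) (f := fun k : ℕ => (k : ℤ))
  have := Finset.card_image_le (s := N.natAbs.divisors) (f := fun k : ℕ => -(k : ℤ))
  omega

theorem valMinAbs_mul_eq_of_mul_eq {q L : ℕ} [NeZero q] (hL : 2 * L ^ 2 < q) {a b c d : ZMod q}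
    (ha : a.valMinAbs.natAbs ≤ L) (hb : b.valMinAbs.natAbs ≤ L) (hc : c.valMinAbs.natAbs ≤ L)
    (hd : d.valMinAbs.natAbs ≤ L) (h : a * b = c * d) :
    a.valMinAbs * b.valMinAbs = c.valMinAbs * d.valMinAbs := by
  have h1 : ((a.valMinAbs * b.valMinAbs : ℤ) : ZMod q) =
      ((c.valMinAbs * d.valMinAbs : ℤ) : ZMod q) := by
    push_cast
    simpa [ZMod.coe_valMinAbs] using h
  have h2 := (ZMod.intCast_eq_intCast_iff_dvd_sub _ _ q).1 h1
  have h3 : (c.valMinAbs * d.valMinAbs - a.valMinAbs * b.valMinAbs).natAbs < q := by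
    calc _ ≤ (c.valMinAbs * d.valMinAbs).natAbs + (a.valMinAbs * b.valMinAbs).natAbs :=
          Int.natAbs_sub_le _ _
      _ ≤ L * L + L * L := by
          rw [Int.natAbs_mul, Int.natAbs_mul]
          gcongr
      _ < q := by nlinarith
  have h4 := Int.eq_zero_of_dvd_of_natAbs_lt_natAbs h2 (by simpa using h3)
  linarith

/-- Multiplicative energy of a short interval modulo a prime. -/
theorem exists_sum_sq_card_ratio_le (η : ℝ) (hη : 0 < η) :
    ∃ C : ℝ, 0 < C ∧ ∀ (q : ℕ) [Fact q.Prime] (L : ℕ), 2 * L ^ 2 < q →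
      ∑ t : (ZMod q)ˣ,
        (((shortResidues q L).filter fun l => (t : ZMod q) * l ∈ shortResidues q L).card : ℝ) ^ 2
        ≤ C * (q : ℝ) ^ η * (L : ℝ) ^ 2 := by
  obtain ⟨C, hC, hdiv⟩ := exists_card_divisors_le_rpow η hη
  refine ⟨8 * C, by positivity, fun q _ L hL => ?_⟩
  set B := shortResidues q L with hB
  have e1 : ∑ t : (ZMod q)ˣ, ((B.filter fun l => (t : ZMod q) * l ∈ B).card : ℝ) ^ 2 =
      (((Finset.univ : Finset (ZMod q)ˣ) ×ˢ (B ×ˢ B)).filter fun x =>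
        (x.1 : ZMod q) * x.2.1 ∈ B ∧ (x.1 : ZMod q) * x.2.2 ∈ B).card := by
    rw [Finset.card_filter, Finset.sum_product]
    push_cast
    refine Finset.sum_congr rfl fun t _ => ?_
    rw [Finset.sum_product, sq, Finset.card_filter]
    push_cast
    rw [Finset.sum_mul_sum]
    refine Finset.sum_congr rfl fun a _ => Finset.sum_congr rfl fun b _ => ?_
    by_cases h1 : (t : ZMod q) * a ∈ B <;> by_cases h2 : (t : ZMod q) * b ∈ B <;> simp [h1, h2]
  have e2 : (((Finset.univ : Finset (ZMod q)ˣ) ×ˢ (B ×ˢ B)).filter fun x =>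
        (x.1 : ZMod q) * x.2.1 ∈ B ∧ (x.1 : ZMod q) * x.2.2 ∈ B).card ≤
      ((B ×ˢ B).sigma fun y => B.filter fun l => l.valMinAbs ∣
          y.1.valMinAbs * y.2.valMinAbs).card := by
    apply Finset.card_le_card_of_injOn
      (fun x => (⟨(x.2.2, (x.1 : ZMod q) * x.2.1), x.2.1⟩ : Σ _ : ZMod q × ZMod q, ZMod q))
    · rintro ⟨t, l, l'⟩ hx
      simp only [Finset.coe_filter, Finset.mem_product, Finset.mem_univ, true_and,
        Set.mem_ofPred_eq] at hx
      obtain ⟨⟨hl, hl'⟩, h1, h2⟩ := hx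
      simp only [Finset.coe_sigma, Set.mem_sigma_iff, Finset.mem_coe, Finset.mem_product,
        Finset.mem_filter]
      refine ⟨⟨hl', h1⟩, hl, ?_⟩
      have := valMinAbs_mul_eq_of_mul_eq hL (mem_shortResidues.1 hl').2 (mem_shortResidues.1 h1).2
        (mem_shortResidues.1 hl).2 (mem_shortResidues.1 h2).2 (by ring)
      rw [this]
      exact dvd_mul_right _ _
    · rintro ⟨t, l, l'⟩ hx ⟨s, k, k'⟩ hy hxy
      simp only [Finset.coe_filter, Finset.mem_product, Finset.mem_univ, true_and,
        Set.mem_ofPred_eq] at hx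
      simp only [Sigma.mk.injEq, Prod.mk.injEq, heq_eq_eq] at hxy
      obtain ⟨⟨h1, h2⟩, h3⟩ := hxy
      subst h1 h3
      have hl0 := (mem_shortResidues.1 hx.1.1).1
      have : t = s := Units.ext (mul_right_cancel₀ hl0 h2)
      simp [this]
  have e3 : (((B ×ˢ B).sigma fun y => B.filter fun l => l.valMinAbs ∣
      y.1.valMinAbs * y.2.valMinAbs).card : ℝ)
      ≤ ∑ _y ∈ B ×ˢ B, (2 * (C * (q : ℝ) ^ η)) := by
    rw [Finset.card_sigma]
    push_cast
    apply Finset.sum_le_sum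
    rintro ⟨a, b⟩ hy
    simp only [Finset.mem_product] at hy
    have ha := mem_shortResidues.1 hy.1
    have hb := mem_shortResidues.1 hy.2
    have hN : a.valMinAbs * b.valMinAbs ≠ 0 := by simpa using ⟨ha.1, hb.1⟩
    calc _ ≤ ((2 * (a.valMinAbs * b.valMinAbs).natAbs.divisors.card : ℕ) : ℝ) := by
          exact_mod_cast card_filter_valMinAbs_dvd_le B _ hN
      _ ≤ 2 * (C * (((a.valMinAbs * b.valMinAbs).natAbs : ℕ) : ℝ) ^ η) := by
          push_cast
          have := hdiv (a.valMinAbs * b.valMinAbs).natAbs (by simpa using hN)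
          linarith
      _ ≤ _ := by
          have h5 : (a.valMinAbs * b.valMinAbs).natAbs ≤ q := by
            rw [Int.natAbs_mul]
            calc _ ≤ L * L := Nat.mul_le_mul ha.2 hb.2
              _ ≤ q := by nlinarith
          gcongr
  rw [e1]
  refine (Nat.cast_le.2 e2).trans (e3.trans ?_)
  rw [Finset.sum_const, Finset.card_product, nsmul_eq_mul]
  push_cast
  have h6 : (B.card : ℝ) ≤ 2 * L := by exact_mod_cast card_shortResidues_le q L
  calc (B.card : ℝ) * B.card * (2 * (C * (q : ℝ) ^ η)) ≤
        (2 * L) * (2 * L) * (2 * (C * (q : ℝ) ^ η)) := by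
        gcongr
    _ = _ := by ring

theorem sum_mul_sum_comp_sq_eq {G : Type*} [CommGroup G] [Fintype G] (α β : G → ℝ) :
    ∑ m, (∑ d, α d * β (m * d ^ 2)) ^ 2 =
      ∑ s, (∑ d, α d * α (s * d)) * (∑ n, β n * β (s ^ 2 * n)) := by
  have h1 : ∀ m, (∑ d, α d * β (m * d ^ 2)) ^ 2 =
      ∑ d, ∑ s, α d * α (s * d) * (β (m * d ^ 2) * β (s ^ 2 * (m * d ^ 2))) := by
    intro m
    rw [sq, Finset.sum_mul_sum]
    refine Finset.sum_congr rfl fun d _ => ?_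
    rw [← Equiv.sum_comp (Equiv.mulRight d)]
    refine Finset.sum_congr rfl fun s _ => ?_
    have : s ^ 2 * (m * d ^ 2) = m * (s * d) ^ 2 := by rw [mul_pow]; exact mul_left_comm _ _ _
    rw [this]
    simp only [Equiv.coe_mulRight]
    ring
  simp_rw [h1]
  rw [Finset.sum_comm]
  simp_rw [Finset.sum_comm (s := Finset.univ (α := G)) (t := Finset.univ (α := G))
    (f := fun m s => _ * (β (m * _ ^ 2) * _))]
  rw [Finset.sum_comm]
  refine Finset.sum_congr rfl fun s _ => ?_
  rw [Finset.sum_mul]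
  refine Finset.sum_congr rfl fun d _ => ?_
  rw [← Finset.mul_sum]
  congr 1
  exact Equiv.sum_comp (Equiv.mulRight (d ^ 2)) (fun n => β n * β (s ^ 2 * n))

theorem sum_sum_ratio_eq {G : Type*} [CommGroup G] [Fintype G] (α : G → ℝ) :
    ∑ s, ∑ d, α d * α (s * d) = (∑ d, α d) ^ 2 := by
  rw [Finset.sum_comm, sq, Finset.sum_mul_sum]
  refine Finset.sum_congr rfl fun d _ => ?_
  exact Equiv.sum_comp (Equiv.mulRight d) (fun s => α d * α s)

/-- A bilinear large-sieve type inequality on a finite abelian group. -/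
theorem sum_mul_sum_comp_sq_le {G : Type*} [CommGroup G] [Fintype G] (α β : G → ℝ)
    (hβ : ∀ g, 0 ≤ β g)
    (hG : ∀ F : G → ℝ, (∀ g, 0 ≤ F g) → ∑ s, F (s ^ 2) ≤ 2 * ∑ s, F s)
    {a b ca cb : ℝ} (ha : 0 ≤ a) (hb : 0 ≤ b)
    (hva : ∑ t, ((∑ d, α d * α (t * d)) - ca) ^ 2 ≤ a ^ 2)
    (hvb : ∑ t, ((∑ d, β d * β (t * d)) - cb) ^ 2 ≤ b ^ 2) :
    ∑ m, (∑ d, α d * β (m * d ^ 2)) ^ 2 ≤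
      2 * (∑ d, α d) ^ 2 * (∑ d, β d) ^ 2 / Fintype.card G + 2 * a * b := by
  rw [sum_mul_sum_comp_sq_eq]
  set R : G → ℝ := fun t => ∑ d, α d * α (t * d) with hR
  set Q : G → ℝ := fun t => ∑ d, β d * β (t * d) with hQ
  have hN : (0 : ℝ) < Fintype.card G := by exact_mod_cast Fintype.card_pos
  set μ : ℝ := (∑ d, α d) ^ 2 / Fintype.card G with hμ
  have hRsum : ∑ s, R s = μ * Fintype.card G := by
    rw [hμ, div_mul_cancel₀ _ hN.ne']
    exact sum_sum_ratio_eq α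
  have hvar : ∑ t, (R t - μ) ^ 2 ≤ a ^ 2 := by
    refine le_trans ?_ hva
    have : ∑ t, (R t - ca) ^ 2 = ∑ t, (R t - μ) ^ 2 + Fintype.card G * (μ - ca) ^ 2 := by
      have e : ∀ t, (R t - ca) ^ 2 = (R t - μ) ^ 2 + (2 * (μ - ca) * R t + (ca ^ 2 - μ ^ 2)) := by
        intro t; ring
      simp_rw [e, Finset.sum_add_distrib, ← Finset.mul_sum, hRsum, Finset.sum_const, nsmul_eq_mul,
        Finset.card_univ]
      ring
    change _ ≤ ∑ t, (R t - ca) ^ 2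
    rw [this]
    have : 0 ≤ Fintype.card G * (μ - ca) ^ 2 := by positivity
    linarith
  have hvb2 : ∑ s, (Q (s ^ 2) - cb) ^ 2 ≤ 2 * b ^ 2 :=
    (hG (fun t => (Q t - cb) ^ 2) fun _ => sq_nonneg _).trans (by gcongr)
  have hcs := Finset.sum_mul_sq_le_sq_mul_sq Finset.univ (fun s => R s - μ)
    (fun s => Q (s ^ 2) - cb)
  have h3 : ∑ s, (R s - μ) * (Q (s ^ 2) - cb) ≤ 2 * a * b := by
    refine (abs_le_of_sq_le_sq' ?_ (by positivity)).2
    calc _ ≤ _ := hcs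
      _ ≤ a ^ 2 * (2 * b ^ 2) := by gcongr
      _ ≤ (2 * a * b) ^ 2 := by nlinarith [mul_nonneg (sq_nonneg a) (sq_nonneg b)]
  have h4 : ∑ s, Q (s ^ 2) ≤ 2 * (∑ d, β d) ^ 2 := by
    refine (hG Q fun g => Finset.sum_nonneg fun d _ => mul_nonneg (hβ _) (hβ _)).trans ?_
    rw [← sum_sum_ratio_eq β]
  have h5 : ∑ s, R s * Q (s ^ 2) = ∑ s, (R s - μ) * (Q (s ^ 2) - cb) + μ * ∑ s, Q (s ^ 2) := by
    have e : ∀ s, R s * Q (s ^ 2) = (R s - μ) * (Q (s ^ 2) - cb) + μ * Q (s ^ 2) +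
        cb * (R s - μ) := by
      intro s; ring
    simp_rw [e, Finset.sum_add_distrib, ← Finset.mul_sum, Finset.sum_sub_distrib, hRsum,
      Finset.sum_const, nsmul_eq_mul, Finset.card_univ]
    ring
  change ∑ s, R s * Q (s ^ 2) ≤ _
  rw [h5]
  have h6 : μ * ∑ s, Q (s ^ 2) ≤ μ * (2 * (∑ d, β d) ^ 2) := by gcongr
  have h7 : μ * (2 * (∑ d, β d) ^ 2) = 2 * (∑ d, α d) ^ 2 * (∑ d, β d) ^ 2 / Fintype.card G := by
    rw [hμ]; ring
  linarith

theorem sum_units_comp_sq_le {F : Type*} [Field F] [Fintype F] [DecidableEq F] (f : Fˣ → ℝ)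
    (hf : ∀ g, 0 ≤ f g) : ∑ s, f (s ^ 2) ≤ 2 * ∑ s, f s := by
  rw [← Finset.sum_fiberwise_of_maps_to (t := Finset.univ) (g := fun s : Fˣ => s ^ 2)
    (fun _ _ => Finset.mem_univ _), Finset.mul_sum]
  apply Finset.sum_le_sum
  intro t _
  have e : ∑ s ∈ Finset.univ.filter (fun s : Fˣ => s ^ 2 = t), f (s ^ 2) =
      ∑ s ∈ Finset.univ.filter (fun s : Fˣ => s ^ 2 = t), f t :=
    Finset.sum_congr rfl fun s hs => by rw [(Finset.mem_filter.1 hs).2]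
  rw [e, Finset.sum_const, nsmul_eq_mul]
  apply mul_le_mul_of_nonneg_right _ (hf t)
  have : (Finset.univ.filter (fun s : Fˣ => s ^ 2 = t)).card ≤ 2 := by
    by_cases h : ∃ r : Fˣ, r ^ 2 = t
    · obtain ⟨r, hr⟩ := h
      refine (Finset.card_le_card (t := {r, -r}) ?_).trans Finset.card_le_two
      intro s hs
      have hs' := (Finset.mem_filter.1 hs).2
      rw [← hr] at hs'
      have h2 : ((s : F)) ^ 2 = (r : F) ^ 2 := by exact_mod_cast congrArg Units.val hs'
      rcases sq_eq_sq_iff_eq_or_eq_neg.1 h2 with h3 | h3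
      · simp [Units.ext h3]
      · have : s = -r := Units.ext (by simpa using h3)
        simp [this]
    · rw [Finset.filter_eq_empty_iff.2]
      · simp
      · intro s _ hs
        exact h ⟨s, hs⟩
  exact_mod_cast this

theorem sum_units_eq_sub {F : Type*} [Field F] [Fintype F] [DecidableEq F] (f : F → ℝ) :
    ∑ u : Fˣ, f u = ∑ x, f x - f 0 := by
  rw [← Finset.add_sum_erase Finset.univ f (Finset.mem_univ 0), add_sub_cancel_left]
  refine Finset.sum_bij (fun u _ => (u : F)) (fun u _ => by simp) (fun a _ b _ h => Units.ext h)
    (fun b hb => ⟨Units.mk0 b (by simpa using hb), Finset.mem_univ _, rfl⟩) (fun _ _ => rfl)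

theorem natAbs_valMinAbs_intCast_le {q : ℕ} [NeZero q] (j : ℤ) :
    ((j : ZMod q)).valMinAbs.natAbs ≤ j.natAbs :=
  ZMod.natAbs_min_of_le_div_two q _ _ (by rw [ZMod.coe_valMinAbs]) (ZMod.natAbs_valMinAbs_le _)

theorem natAbs_valMinAbs_natCast_le {q : ℕ} [NeZero q] (j : ℕ) :
    ((j : ZMod q)).valMinAbs.natAbs ≤ j := by
  simpa using natAbs_valMinAbs_intCast_le (q := q) (j : ℤ)

/-- The Fejér kernel modulo `q`. -/
noncomputable def fejer (q : ℕ) [NeZero q] (K : ℕ) (n : ZMod q) : ℝ :=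
  Complex.normSq (∑ k ∈ Finset.range K, ZMod.stdAddChar ((k : ZMod q) * n))

theorem fejer_eq_sum (q : ℕ) [NeZero q] (K : ℕ) (n : ZMod q) :
    (fejer q K n : ℂ) = ∑ p ∈ Finset.range K ×ˢ Finset.range K,
      ZMod.stdAddChar (n * ((p.1 : ZMod q) - (p.2 : ZMod q))) := by
  rw [fejer, ← Complex.mul_conj, map_sum, Finset.sum_mul_sum, Finset.sum_product]
  refine Finset.sum_congr rfl fun a _ => Finset.sum_congr rfl fun b _ => ?_
  rw [← AddChar.map_neg_eq_conj, ← AddChar.map_add_eq_mul]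
  congr 1
  ring

theorem fejer_zero (q : ℕ) [NeZero q] (K : ℕ) : fejer q K 0 = (K : ℝ) ^ 2 := by
  simp [fejer, Complex.normSq_apply, sq]

theorem natCast_inj_of_lt {q : ℕ} {a b : ℕ} (ha : a < q) (hb : b < q)
    (h : (a : ZMod q) = b) : a = b := by
  have := (ZMod.natCast_eq_natCast_iff a b q).1 h
  exact Nat.ModEq.eq_of_lt_of_lt this ha hb

theorem sum_fejer {q : ℕ} [NeZero q] {K : ℕ} (hK : K ≤ q) :
    ∑ n, fejer q K n = q * K := by
  have : ((∑ n, fejer q K n : ℝ) : ℂ) = ((q * K : ℝ) : ℂ) := by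
    push_cast
    simp_rw [fejer_eq_sum]
    rw [Finset.sum_comm]
    simp_rw [AddChar.sum_mulShift _ (ZMod.isPrimitive_stdAddChar q), ZMod.card]
    rw [Finset.sum_product]
    have : ∀ a ∈ Finset.range K, ∑ b ∈ Finset.range K,
        ((if (a : ZMod q) - b = 0 then q else 0 : ℕ) : ℂ) = q := by
      intro a ha
      rw [Finset.sum_eq_single_of_mem a ha]
      · simp
      · intro b hb hba
        rw [if_neg]
        · simp
        · intro h
          rw [Finset.mem_range] at ha hb
          exact hba (natCast_inj_of_lt (ha.trans_le hK) (hb.trans_le hK) (sub_eq_zero.1 h)).symm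
    rw [Finset.sum_congr rfl this]
    simp [mul_comm]
  exact_mod_cast this

theorem sum_fejer_mul_fejer {q : ℕ} [NeZero q] (K : ℕ) (t : ZMod q) :
    ∑ n, fejer q K n * fejer q K (t * n) =
      q * (((Finset.range K ×ˢ Finset.range K) ×ˢ (Finset.range K ×ˢ Finset.range K)).filter
          fun p =>
        ((p.1.1 : ZMod q) - p.1.2) + t * ((p.2.1 : ZMod q) - p.2.2) = 0).card := by
  have : ((∑ n, fejer q K n * fejer q K (t * n) : ℝ) : ℂ) =
      ((q * (((Finset.range K ×ˢ Finset.range K) ×ˢ (Finset.range K ×ˢ Finset.range K)).filter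
          fun p =>
        ((p.1.1 : ZMod q) - p.1.2) + t * ((p.2.1 : ZMod q) - p.2.2) = 0).card : ℝ) : ℂ) := by
    push_cast
    simp_rw [fejer_eq_sum, Finset.sum_mul_sum, ← AddChar.map_add_eq_mul]
    simp_rw [← Finset.sum_product']
    rw [Finset.sum_product_right]
    rw [Finset.card_filter]
    push_cast
    rw [Finset.mul_sum]
    refine Finset.sum_congr rfl fun p _ => ?_
    have e : ∀ x : ZMod q, x * ((p.1.1 : ZMod q) - p.1.2) + t * x * ((p.2.1 : ZMod q) - p.2.2) =
        x * (((p.1.1 : ZMod q) - p.1.2) + t * ((p.2.1 : ZMod q) - p.2.2)) := fun x => by ring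
    simp_rw [e, AddChar.sum_mulShift _ (ZMod.isPrimitive_stdAddChar q), ZMod.card]
    split_ifs <;> simp
  exact_mod_cast this

theorem le_fejer {q H K : ℕ} [NeZero q] (hK : 8 * ((K - 1) * H) ≤ q) {n : ZMod q}
    (hn : n.valMinAbs.natAbs ≤ H) : (K : ℝ) ^ 2 / 2 ≤ fejer q K n := by
  have hq : (0 : ℝ) < q := by exact_mod_cast Nat.pos_of_ne_zero (NeZero.ne q)
  have h1 : ∀ k ∈ Finset.range K, Real.sqrt 2 / 2 ≤ (ZMod.stdAddChar ((k : ZMod q) * n)).re := by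
    intro k hk
    rw [Finset.mem_range] at hk
    have e : (k : ZMod q) * n = ((k * n.valMinAbs : ℤ) : ZMod q) := by
      push_cast; simp
    rw [e, ZMod.stdAddChar_coe]
    have e2 : (2 * Real.pi * Complex.I * ((k * n.valMinAbs : ℤ) : ℂ) / q : ℂ) =
        ((2 * Real.pi * (k * n.valMinAbs) / q : ℝ) : ℂ) * Complex.I := by
      push_cast; ring
    rw [e2, Complex.exp_ofReal_mul_I_re, ← Real.cos_pi_div_four, ← Real.cos_abs (2 * _ * _ / _)]
    have h2 : |2 * Real.pi * (k * n.valMinAbs) / q| ≤ Real.pi / 4 := by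
      rw [abs_div, abs_mul, abs_mul, abs_mul, abs_of_pos hq, abs_of_pos Real.pi_pos, Nat.abs_cast,
        abs_two, div_le_iff₀ hq]
      have h3 : (8 : ℝ) * (k * |(n.valMinAbs : ℝ)|) ≤ q := by
        have h4 : 8 * (k * n.valMinAbs.natAbs) ≤ q :=
          le_trans (Nat.mul_le_mul_left _ (Nat.mul_le_mul (by omega) hn)) hK
        have h5 : ((8 * (k * n.valMinAbs.natAbs) : ℕ) : ℝ) ≤ q := by exact_mod_cast h4
        push_cast [Nat.cast_natAbs] at h5
        exact h5
      nlinarith [Real.pi_pos]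
    exact Real.cos_le_cos_of_nonneg_of_le_pi (abs_nonneg _) (by linarith [Real.pi_pos]) h2
  have h2 : (K : ℝ) * (Real.sqrt 2 / 2) ≤
      (∑ k ∈ Finset.range K, ZMod.stdAddChar ((k : ZMod q) * n)).re := by
    rw [Complex.re_sum]
    simpa using Finset.sum_le_sum h1
  rw [fejer, Complex.normSq_apply]
  have h3 : ((K : ℝ) * (Real.sqrt 2 / 2)) ^ 2 = K ^ 2 / 2 := by
    rw [mul_pow, div_pow, Real.sq_sqrt (by norm_num)]; ring
  have h4 : (0 : ℝ) ≤ K * (Real.sqrt 2 / 2) := by positivity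
  nlinarith [mul_self_nonneg (∑ k ∈ Finset.range K, ZMod.stdAddChar ((k : ZMod q) * n)).im]

theorem card_filter_le_card_ratio {q K : ℕ} [Fact q.Prime] (hK : K ≤ q) (t : (ZMod q)ˣ) :
    (((Finset.range K ×ˢ Finset.range K) ×ˢ (Finset.range K ×ˢ Finset.range K)).filter fun p =>
        ((p.1.1 : ZMod q) - p.1.2) + t * ((p.2.1 : ZMod q) - p.2.2) = 0).card ≤
      K ^ 2 + K ^ 2 * ((shortResidues q (K - 1)).filter fun l =>
        (t : ZMod q) * l ∈ shortResidues q (K - 1)).card := by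
  set B := shortResidues q (K - 1)
  set E := ((Finset.range K ×ˢ Finset.range K) ×ˢ (Finset.range K ×ˢ Finset.range K)).filter
      fun p =>
        ((p.1.1 : ZMod q) - p.1.2) + t * ((p.2.1 : ZMod q) - p.2.2) = 0
  have hd : ∀ a ∈ Finset.range K, ∀ b ∈ Finset.range K, (a : ZMod q) - b ≠ 0 →
      (a : ZMod q) - b ∈ B := by
    intro a ha b hb hab
    rw [Finset.mem_range] at ha hb
    refine mem_shortResidues.2 ⟨hab, ?_⟩
    have e : (a : ZMod q) - b = ((a - b : ℤ) : ZMod q) := by push_cast; rfl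
    rw [e]
    refine (natAbs_valMinAbs_intCast_le _).trans ?_
    omega
  have hinj : ∀ a ∈ Finset.range K, ∀ b ∈ Finset.range K, (a : ZMod q) = b → a = b :=
    fun a ha b hb h => natCast_inj_of_lt ((Finset.mem_range.1 ha).trans_le hK)
      ((Finset.mem_range.1 hb).trans_le hK) h
  rw [← Finset.card_filter_add_card_filter_not (s := E) (fun p => p.2.1 = p.2.2)]
  apply add_le_add
  · have : (Finset.range K ×ˢ Finset.range K).card = K ^ 2 := by simp [sq]
    rw [← this]
    apply Finset.card_le_card_of_injOn (fun p => (p.1.1, p.2.1))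
    · rintro ⟨⟨a, b⟩, c, d⟩ hp
      simp only [E, Finset.coe_filter, Finset.mem_filter, Finset.mem_product,
        Set.mem_ofPred_eq] at hp
      simp only [Finset.coe_product, Set.mem_prod, Finset.mem_coe]
      exact ⟨hp.1.1.1.1, hp.1.1.2.1⟩
    · rintro ⟨⟨a, b⟩, c, d⟩ hp ⟨⟨a', b'⟩, c', d'⟩ hp' h
      simp only [E, Finset.coe_filter, Finset.mem_filter, Finset.mem_product,
        Set.mem_ofPred_eq] at hp hp'
      simp only [Prod.mk.injEq] at h ⊢
      obtain ⟨⟨⟨⟨ha, hb⟩, hc, hd⟩, h0⟩, h1⟩ := hp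
      obtain ⟨⟨⟨⟨ha', hb'⟩, hc', hd'⟩, h0'⟩, h1'⟩ := hp'
      subst h1 h1'
      rw [sub_self, mul_zero, add_zero, sub_eq_zero] at h0 h0'
      have := hinj _ ha _ hb h0
      have := hinj _ ha' _ hb' h0'
      omega
  · have : ((Finset.range K ×ˢ Finset.range K) ×ˢ B.filter fun l => (t : ZMod q) * l ∈ B).card =
        K ^ 2 * (B.filter fun l => (t : ZMod q) * l ∈ B).card := by
      rw [Finset.card_product, Finset.card_product, Finset.card_range, sq]
    rw [← this]
    apply Finset.card_le_card_of_injOn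
      (fun p => ((p.1.1, p.2.1), ((p.2.2 : ZMod q) - p.2.1)))
    · rintro ⟨⟨a, b⟩, c, d⟩ hp
      simp only [E, Finset.coe_filter, Finset.mem_filter, Finset.mem_product,
        Set.mem_ofPred_eq] at hp
      simp only [Finset.coe_product, Set.mem_prod, Finset.mem_coe, Finset.mem_filter]
      obtain ⟨⟨⟨⟨ha, hb⟩, hc, hd'⟩, h0⟩, h1⟩ := hp
      have hne : (d : ZMod q) - c ≠ 0 := by
        rw [sub_ne_zero]
        intro h
        exact h1 (hinj _ hd' _ hc h).symm
      have e : (t : ZMod q) * (d - c) = a - b := by linear_combination -h0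
      refine ⟨⟨ha, hc⟩, hd _ hd' _ hc hne, ?_⟩
      rw [e]
      refine hd _ ha _ hb ?_
      rw [← e]
      exact mul_ne_zero t.ne_zero hne
    · rintro ⟨⟨a, b⟩, c, d⟩ hp ⟨⟨a', b'⟩, c', d'⟩ hp' h
      simp only [E, Finset.coe_filter, Finset.mem_filter, Finset.mem_product,
        Set.mem_ofPred_eq] at hp hp'
      simp only [Prod.mk.injEq] at h ⊢
      obtain ⟨⟨⟨⟨ha, hb⟩, hc, hd⟩, h0⟩, h1⟩ := hp
      obtain ⟨⟨⟨⟨ha', hb'⟩, hc', hd'⟩, h0'⟩, h1'⟩ := hp'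
      obtain ⟨⟨rfl, rfl⟩, h⟩ := h
      refine ⟨⟨rfl, hinj _ hb _ hb' ?_⟩, rfl, hinj _ hd _ hd' ?_⟩
      · linear_combination h0' - h0 - (t : ZMod q) * h
      · linear_combination h

theorem indicator_majorant {q H : ℕ} [Fact q.Prime] (C : ℝ)
    (hE : ∑ t : (ZMod q)ˣ, (((shortResidues q H).filter fun l =>
      (t : ZMod q) * l ∈ shortResidues q H).card : ℝ) ^ 2 ≤ C) :
    ∃ w : (ZMod q)ˣ → ℝ, (∀ t, 0 ≤ w t) ∧
      (∀ t : (ZMod q)ˣ, (t : ZMod q).valMinAbs.natAbs ≤ H → 1 ≤ w t) ∧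
      ∑ t, w t ≤ 2 * H ∧ ∑ t, ((∑ n, w n * w (t * n)) - 0) ^ 2 ≤ C := by
  set B := shortResidues q H with hB
  have hB0 : (0 : ZMod q) ∉ B := by simp [hB, mem_shortResidues]
  refine ⟨fun t => if (t : ZMod q) ∈ B then 1 else 0, fun t => ?_, fun t ht => ?_, ?_, ?_⟩
  · dsimp only
    split_ifs <;> norm_num
  · dsimp only
    rw [if_pos (mem_shortResidues.2 ⟨t.ne_zero, ht⟩)]
  · rw [sum_units_eq_sub (fun x : ZMod q => if x ∈ B then (1 : ℝ) else 0)]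
    have : (B.card : ℝ) ≤ 2 * H := by exact_mod_cast card_shortResidues_le q H
    simpa [hB0] using this
  · refine le_of_eq_of_le (Finset.sum_congr rfl fun t _ => ?_) hE
    congr 1
    simp_rw [Units.val_mul]
    rw [sum_units_eq_sub (fun x : ZMod q => (if x ∈ B then (1 : ℝ) else 0) *
      (if (t : ZMod q) * x ∈ B then 1 else 0)), if_neg hB0, zero_mul, sub_zero, sub_zero]
    simp_rw [mul_ite, mul_one, mul_zero, ← ite_and, Finset.sum_boole]
    congr 2
    ext x
    simp [and_comm]

theorem fejer_majorant {q H : ℕ} [Fact q.Prime] (hH : 1 ≤ H) (hqH : q ≤ 2 * H ^ 2) {C : ℝ}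
    (hC : 0 ≤ C)
    (hE : ∀ L : ℕ, 2 * L ^ 2 < q → ∑ t : (ZMod q)ˣ, (((shortResidues q L).filter fun l =>
      (t : ZMod q) * l ∈ shortResidues q L).card : ℝ) ^ 2 ≤ C * L ^ 2) :
    ∃ w : (ZMod q)ˣ → ℝ, (∀ t, 0 ≤ w t) ∧
      (∀ t : (ZMod q)ˣ, (t : ZMod q).valMinAbs.natAbs ≤ H → 1 ≤ w t) ∧
      ∑ t, w t ≤ 16 * H ∧ ∃ c, ∑ t, ((∑ n, w n * w (t * n)) - c) ^ 2 ≤ 1024 * C * H ^ 2 := by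
  have hq2 : 2 ≤ q := (Fact.out : q.Prime).two_le
  set K : ℕ := q / (8 * H) + 1 with hK
  have hK1 : 8 * ((K - 1) * H) ≤ q := by
    have := Nat.div_mul_le_self q (8 * H)
    rw [hK, Nat.add_sub_cancel]
    linarith
  have hK2 : q < 8 * H * K := Nat.lt_mul_div_succ q (by omega)
  have hKq : K ≤ q := by
    have : q / (8 * H) ≤ q / 2 := Nat.div_le_div_left (by omega) (by norm_num)
    omega
  have hK3 : 2 * (K - 1) ^ 2 < q := by
    by_contra! h
    have h1 : (8 * ((K - 1) * H)) ^ 2 ≤ q ^ 2 := Nat.pow_le_pow_left hK1 2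
    have h2 : q * q ≤ (2 * (K - 1) ^ 2) * (2 * H ^ 2) := Nat.mul_le_mul h hqH
    nlinarith
  have hKpos : (0 : ℝ) < K := by positivity
  have hqpos : (0 : ℝ) < q := by positivity
  have hHpos : (0 : ℝ) < H := by positivity
  have hK2' : (q : ℝ) < 8 * H * K := by exact_mod_cast hK2
  refine ⟨fun t => 2 / (K : ℝ) ^ 2 * fejer q K t, fun t => ?_, fun t ht => ?_, ?_,
    4 * q / K ^ 2 - 4, ?_⟩
  · have : 0 ≤ fejer q K t := Complex.normSq_nonneg _
    positivity
  · have := le_fejer hK1 ht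
    dsimp only
    rw [div_mul_eq_mul_div, le_div_iff₀ (by positivity)]
    linarith
  · rw [← Finset.mul_sum, sum_units_eq_sub (fejer q K), sum_fejer hKq, fejer_zero]
    rw [div_mul_eq_mul_div, div_le_iff₀ (by positivity)]
    nlinarith
  · set r : (ZMod q)ˣ → ℝ := fun t => ((shortResidues q (K - 1)).filter fun l =>
      (t : ZMod q) * l ∈ shortResidues q (K - 1)).card with hr
    have h1 : ∀ t : (ZMod q)ˣ, |(∑ n : (ZMod q)ˣ, 2 / (K : ℝ) ^ 2 * fejer q K n *
        (2 / (K : ℝ) ^ 2 * fejer q K ((t * n : (ZMod q)ˣ) : ZMod q))) -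
          (4 * (q : ℝ) / (K : ℝ) ^ 2 - 4)| ≤ 4 * q / K ^ 2 * r t := by
      intro t
      have e : ∀ n : (ZMod q)ˣ, 2 / (K : ℝ) ^ 2 * fejer q K n *
        (2 / (K : ℝ) ^ 2 * fejer q K ((t * n : (ZMod q)ˣ) : ZMod q)) =
          4 / K ^ 4 * (fejer q K n * fejer q K (t * (n : ZMod q))) := by
        intro n; rw [Units.val_mul]; ring
      simp_rw [e]
      rw [← Finset.mul_sum, sum_units_eq_sub (fun x : ZMod q => fejer q K x * fejer q K (t * x)),
        sum_fejer_mul_fejer, mul_zero, fejer_zero]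
      set E := ((Finset.range K ×ˢ Finset.range K) ×ˢ (Finset.range K ×ˢ Finset.range K)).filter
          fun p =>
        ((p.1.1 : ZMod q) - p.1.2) + t * ((p.2.1 : ZMod q) - p.2.2) = 0 with hEdef
      have hle : (E.card : ℝ) ≤ K ^ 2 + K ^ 2 * r t := by
        have := (Nat.cast_le (α := ℝ)).2 (card_filter_le_card_ratio hKq t)
        rwa [Nat.cast_add, Nat.cast_mul, Nat.cast_pow] at this
      have hge : (K : ℝ) ^ 2 ≤ E.card := by
        have : K ^ 2 ≤ E.card := by
          have : (Finset.range K ×ˢ Finset.range K).card = K ^ 2 := by simp [sq]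
          rw [← this]
          apply Finset.card_le_card_of_injOn (fun p => ((p.1, p.1), (p.2, p.2)))
          · rintro ⟨a, b⟩ hp
            simp_all
          · rintro ⟨a, b⟩ _ ⟨c, d⟩ _ h
            simp_all
        exact_mod_cast this
      have e3 : 4 / (K : ℝ) ^ 4 * (q * E.card - K ^ 2 * K ^ 2) - (4 * q / K ^ 2 - 4) =
          4 * q / K ^ 4 * (E.card - K ^ 2) := by
        field_simp
        ring
      rw [e3, abs_of_nonneg (mul_nonneg (by positivity) (by linarith))]
      calc _ ≤ 4 * q / K ^ 4 * (K ^ 2 * r t) := by gcongr; linarith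
        _ = _ := by field_simp
    calc _ ≤ ∑ t : (ZMod q)ˣ, (4 * q / K ^ 2 * r t) ^ 2 := by
          refine Finset.sum_le_sum fun t _ => ?_
          rw [← sq_abs]
          exact pow_le_pow_left₀ (abs_nonneg _) (h1 t) 2
      _ = (4 * q / K ^ 2) ^ 2 * ∑ t, r t ^ 2 := by rw [Finset.mul_sum]; simp_rw [mul_pow]
      _ ≤ (4 * q / K ^ 2) ^ 2 * (C * (K - 1 : ℕ) ^ 2) := by gcongr; exact hE _ hK3
      _ ≤ (4 * (8 * H * K) / K ^ 2) ^ 2 * (C * K ^ 2) := by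
          have : K - 1 ≤ K := Nat.sub_le _ _
          gcongr
      _ = _ := by field_simp; ring

theorem exists_majorant (η : ℝ) (hη : 0 < η) : ∃ C : ℝ, 0 < C ∧
    ∀ (q : ℕ) [Fact q.Prime] (H : ℕ), 1 ≤ H → ∃ w : (ZMod q)ˣ → ℝ, (∀ t, 0 ≤ w t) ∧
      (∀ t : (ZMod q)ˣ, (t : ZMod q).valMinAbs.natAbs ≤ H → 1 ≤ w t) ∧
      ∑ t, w t ≤ 16 * H ∧ ∃ c, ∑ t, ((∑ n, w n * w (t * n)) - c) ^ 2 ≤ C * (q : ℝ) ^ η * H ^ 2 := by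
  obtain ⟨C, hC, h⟩ := exists_sum_sq_card_ratio_le η hη
  refine ⟨1024 * C, by positivity, fun q _ H hH => ?_⟩
  rcases lt_or_ge (2 * H ^ 2) q with hq | hq
  · obtain ⟨w, h1, h2, h3, h4⟩ := indicator_majorant _ (h q H hq)
    refine ⟨w, h1, h2, h3.trans ?_, 0, h4.trans ?_⟩
    · have : (0 : ℝ) ≤ H := Nat.cast_nonneg H
      linarith
    · have : 0 ≤ C * (q : ℝ) ^ η * H ^ 2 := by positivity
      linarith
  · obtain ⟨w, h1, h2, h3, c, h4⟩ :=
      fejer_majorant hH hq (C := C * (q : ℝ) ^ η) (by positivity) (fun L hL => h q L hL)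
    exact ⟨w, h1, h2, h3, c, h4.trans_eq (by ring)⟩

/-- Mean square of the number of `d` in a set for which `m d²` has a small residue. -/
theorem exists_sum_sq_card_small_le (η : ℝ) (hη : 0 < η) : ∃ C : ℝ, 0 < C ∧
    ∀ (q : ℕ) [Fact q.Prime] (D H : ℕ), 1 ≤ D → 1 ≤ H → ∀ S : Finset ℕ,
      (∀ d ∈ S, 1 ≤ d ∧ d ≤ D ∧ d < q) →
      ∑ m : (ZMod q)ˣ, ((S.filter fun d : ℕ =>
        ((m : ZMod q) * (d : ZMod q) ^ 2).valMinAbs.natAbs ≤ H).card : ℝ) ^ 2 ≤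
        C * (q : ℝ) ^ η * ((D : ℝ) ^ 2 * H ^ 2 / q + D * H) := by
  obtain ⟨C, hC, hmaj⟩ := exists_majorant η hη
  refine ⟨4 * 16 ^ 4 + 2 * C, by positivity, fun q _ D H hD hH S hS => ?_⟩
  obtain ⟨α, α0, α1, α2, ca, α3⟩ := hmaj q D hD
  obtain ⟨β, β0, β1, β2, cb, β3⟩ := hmaj q H hH
  have hq2 : 2 ≤ q := (Fact.out : q.Prime).two_le
  have hq1 : (1 : ℝ) ≤ q := by exact_mod_cast (by omega : 1 ≤ q)
  have hqη : (1 : ℝ) ≤ (q : ℝ) ^ η := Real.one_le_rpow hq1 hη.le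
  have key := sum_mul_sum_comp_sq_le α β β0 sum_units_comp_sq_le
    (a := Real.sqrt (C * (q : ℝ) ^ η) * D) (b := Real.sqrt (C * (q : ℝ) ^ η) * H) (ca := ca)
        (cb := cb)
    (by positivity) (by positivity)
    (by rw [mul_pow, Real.sq_sqrt (by positivity)]; exact α3)
    (by rw [mul_pow, Real.sq_sqrt (by positivity)]; exact β3)
  have hcount : ∀ m : (ZMod q)ˣ, ((S.filter fun d : ℕ =>
      ((m : ZMod q) * (d : ZMod q) ^ 2).valMinAbs.natAbs ≤ H).card : ℝ) ≤
        ∑ d, α d * β (m * d ^ 2) := by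
    intro m
    have hne : ∀ d ∈ S, (d : ZMod q) ≠ 0 := by
      intro d hd h
      rw [ZMod.natCast_eq_zero_iff] at h
      have := hS d hd
      exact absurd (Nat.le_of_dvd (by omega) h) (by omega)
    set T := Finset.univ.filter fun u : (ZMod q)ˣ => (u : ZMod q).valMinAbs.natAbs ≤ D ∧
      ((m : ZMod q) * (u : ZMod q) ^ 2).valMinAbs.natAbs ≤ H with hT
    have hcard : (S.filter fun d : ℕ =>
      ((m : ZMod q) * (d : ZMod q) ^ 2).valMinAbs.natAbs ≤ H).card ≤ T.card := by
      apply Finset.card_le_card_of_injOn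
        (fun d : ℕ => if h : (d : ZMod q) ≠ 0 then Units.mk0 (d : ZMod q) h else 1)
      · intro d hd
        obtain ⟨hd, hd2⟩ := Finset.mem_filter.1 hd
        simp only [dif_pos (hne d hd), hT, Finset.coe_filter, Finset.mem_univ, true_and,
        Set.mem_ofPred_eq, Units.val_mk0]
        exact ⟨(natAbs_valMinAbs_natCast_le d).trans (hS d hd).2.1, hd2⟩
      · intro d hd e he hde
        have hd' := (Finset.mem_filter.1 hd).1
        have he' := (Finset.mem_filter.1 he).1
        simp only [dif_pos (hne d hd'), dif_pos (hne e he')] at hde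
        exact natCast_inj_of_lt (hS d hd').2.2 (hS e he').2.2 (congrArg Units.val hde)
    calc _ ≤ (T.card : ℝ) := by exact_mod_cast hcard
      _ = ∑ u ∈ T, (1 : ℝ) := by simp
      _ ≤ ∑ u ∈ T, α u * β (m * u ^ 2) := by
          refine Finset.sum_le_sum fun u hu => ?_
          obtain ⟨_, hu1, hu2⟩ := Finset.mem_filter.1 hu
          exact one_le_mul_of_one_le_of_one_le (α1 u hu1) (β1 _ (by simpa using hu2))
      _ ≤ _ := Finset.sum_le_sum_of_subset_of_nonneg (Finset.subset_univ _)
          fun u _ _ => mul_nonneg (α0 _) (β0 _)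
  have hcardG : (q : ℝ) / 2 ≤ Fintype.card (ZMod q)ˣ := by
    rw [ZMod.card_units]
    have : q ≤ 2 * (q - 1) := by omega
    have : (q : ℝ) ≤ 2 * ((q - 1 : ℕ) : ℝ) := by exact_mod_cast this
    linarith
  calc _ ≤ ∑ m : (ZMod q)ˣ, (∑ d, α d * β (m * d ^ 2)) ^ 2 :=
        Finset.sum_le_sum fun m _ => pow_le_pow_left₀ (by positivity) (hcount m) 2
    _ ≤ _ := key
    _ ≤ 2 * (16 * D) ^ 2 * (16 * H) ^ 2 / (q / 2) +
        2 * (Real.sqrt (C * (q : ℝ) ^ η) * D) * (Real.sqrt (C * (q : ℝ) ^ η) * H) := by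
        have := Finset.sum_nonneg fun t (_ : t ∈ Finset.univ) => α0 t
        have := Finset.sum_nonneg fun t (_ : t ∈ Finset.univ) => β0 t
        gcongr
    _ = 4 * 16 ^ 4 * ((D : ℝ) ^ 2 * H ^ 2 / q) * 1 +
        2 * (Real.sqrt (C * (q : ℝ) ^ η) * Real.sqrt (C * (q : ℝ) ^ η)) * (D * H) := by
        field_simp
        try ring
    _ = 4 * 16 ^ 4 * ((D : ℝ) ^ 2 * H ^ 2 / q) * 1 + 2 * C * (q : ℝ) ^ η * (D * H) := by
        rw [Real.mul_self_sqrt (by positivity)]; ring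
    _ ≤ 4 * 16 ^ 4 * ((D : ℝ) ^ 2 * H ^ 2 / q) * (q : ℝ) ^ η + 2 * C * (q : ℝ) ^ η * (D * H) := by
        gcongr
    _ ≤ _ := by
        have h1 : 0 ≤ (q : ℝ) ^ η * (D * H : ℝ) := by positivity
        have h2 : 0 ≤ C * (q : ℝ) ^ η * ((D : ℝ) ^ 2 * H ^ 2 / q) := by positivity
        nlinarith

theorem exists_log_two_le_rpow (η : ℝ) (hη : 0 < η) : ∃ C : ℝ, 0 < C ∧
    ∀ q : ℕ, 1 ≤ q → ((Nat.log 2 q + 1 : ℕ) : ℝ) ^ 4 ≤ C * (q : ℝ) ^ η := by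
  refine ⟨(1 / (η / 4 * Real.log 2) + 1) ^ 4, by positivity, fun q hq => ?_⟩
  have hq1 : (1 : ℝ) ≤ q := by exact_mod_cast hq
  have hl : 0 < Real.log 2 := Real.log_pos (by norm_num)
  have h1 : (Nat.log 2 q : ℝ) ≤ (q : ℝ) ^ (η / 4) / (η / 4 * Real.log 2) := by
    have h2 := Real.log_le_rpow_div (by positivity : (0 : ℝ) ≤ q) (by positivity : 0 < η / 4)
    have h3 : (Nat.log 2 q : ℝ) * Real.log 2 ≤ Real.log q := by
      rw [← Real.log_pow]
      apply Real.log_le_log (by positivity)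
      exact_mod_cast Nat.pow_log_le_self 2 (by omega)
    rw [← div_div, le_div_iff₀ hl]
    linarith
  have h2 : (1 : ℝ) ≤ (q : ℝ) ^ (η / 4) := Real.one_le_rpow hq1 (by positivity)
  have h3 : ((q : ℝ) ^ (η / 4)) ^ 4 = (q : ℝ) ^ η := by
    rw [← Real.rpow_natCast, ← Real.rpow_mul (by positivity)]
    congr 1; push_cast; ring
  rw [← h3, ← mul_pow]
  apply pow_le_pow_left₀ (by positivity)
  push_cast
  rw [add_mul, one_mul, one_div_mul_eq_div]
  linarith

theorem norm_sum_sq_le_card_mul_sum {ι κ : Type*} [DecidableEq κ] {S : Finset ι} {P : Finset κ}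
    {f : ι → κ} (hf : ∀ d ∈ S, f d ∈ P) {w : κ → ℝ} {a : ι → ℂ} (ha : ∀ d ∈ S, ‖a d‖ ≤ w (f d)) :
    ‖∑ d ∈ S, a d‖ ^ 2 ≤
      (P.card : ℝ) * ∑ p ∈ P, w p ^ 2 * ((S.filter fun d => f d = p).card : ℝ) ^ 2 := by
  have e1 : ‖∑ d ∈ S, a d‖ ≤ ∑ p ∈ P, w p * (S.filter fun d => f d = p).card := by
    refine (norm_sum_le_of_le S ha).trans_eq ?_
    rw [← Finset.sum_fiberwise_of_maps_to hf]
    refine Finset.sum_congr rfl fun p _ => ?_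
    rw [Finset.sum_congr rfl fun d hd => congrArg w (Finset.mem_filter.1 hd).2, Finset.sum_const,
      nsmul_eq_mul, mul_comm]
  have e2 := sq_sum_le_card_mul_sum_sq (s := P)
    (f := fun p => w p * ((S.filter fun d => f d = p).card : ℝ))
  simp_rw [mul_pow] at e2
  exact (pow_le_pow_left₀ (norm_nonneg _) e1 2).trans e2

theorem dyadic_weight_sq_mul_le {C q D R w T : ℝ} {i j : ℕ} (hC : 0 ≤ C) (hq : 0 < q)
    (hw : 0 ≤ w) (hw1 : w ≤ 1 / 2 ^ j) (hw2 : w ≤ R / 2 ^ i)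
    (hT : T ≤ C * (D ^ 2 * (2 ^ (j + 1)) ^ 2 / q + 2 ^ (i + 1) * 2 ^ (j + 1))) :
    w ^ 2 * T ≤ 4 * C * (D ^ 2 / q + R) := by
  have hw3 : w ^ 2 * (2 ^ (j + 1)) ^ 2 ≤ 4 := by
    calc _ ≤ (1 / 2 ^ j : ℝ) ^ 2 * (2 ^ (j + 1)) ^ 2 := by gcongr
      _ = 4 := by field_simp; ring
  have hw4 : w ^ 2 * (2 ^ (i + 1) * 2 ^ (j + 1)) ≤ 4 * R := by
    calc _ ≤ (1 / 2 ^ j * (R / 2 ^ i) : ℝ) * (2 ^ (i + 1) * 2 ^ (j + 1)) := by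
          rw [sq]; gcongr
      _ = 4 * R := by field_simp; ring
  calc _ ≤ w ^ 2 * _ := mul_le_mul_of_nonneg_left hT (sq_nonneg _)
    _ = C * (((w ^ 2 * (2 ^ (j + 1)) ^ 2) * (D ^ 2 / q)) +
        w ^ 2 * (2 ^ (i + 1) * 2 ^ (j + 1))) := by
        ring
    _ ≤ C * (4 * (D ^ 2 / q) + 4 * R) := by gcongr
    _ = _ := by ring

/-- Mean square of a sum over `d` of coefficients decaying in the residue of `m d²`. -/
theorem exists_sum_sq_norm_sum_le (η : ℝ) (hη : 0 < η) : ∃ C : ℝ, 0 < C ∧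
    ∀ (q : ℕ) [Fact q.Prime] (D : ℕ) (R : ℝ), 1 ≤ D → 0 ≤ R → ∀ S : Finset ℕ,
      (∀ d ∈ S, 1 ≤ d ∧ d ≤ D ∧ d < q) → ∀ g : ℕ → ZMod q → ℂ,
      (∀ d ∈ S, ∀ h : ZMod q, h ≠ 0 → ‖g d h‖ ≤ 1 / h.valMinAbs.natAbs ∧ ‖g d h‖ ≤ R / d) →
      ∑ m : (ZMod q)ˣ, ‖∑ d ∈ S, g d ((m : ZMod q) * (d : ZMod q) ^ 2)‖ ^ 2 ≤
        C * (q : ℝ) ^ η * ((D : ℝ) ^ 2 / q + R) := by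
  obtain ⟨C₁, hC₁, h₁⟩ := exists_sum_sq_card_small_le (η / 2) (by positivity)
  obtain ⟨C₂, hC₂, h₂⟩ := exists_log_two_le_rpow (η / 2) (by positivity)
  refine ⟨4 * C₁ * C₂, by positivity, fun q _ D R hD hR S hS g hg => ?_⟩
  have hq2 : 2 ≤ q := (Fact.out : q.Prime).two_le
  have hq0 : (0 : ℝ) < q := by positivity
  obtain ⟨L, hL⟩ : ∃ L, L = Nat.log 2 q + 1 := ⟨_, rfl⟩
  set P := Finset.range L ×ˢ Finset.range L with hP
  obtain ⟨w, hw⟩ : ∃ w : ℕ × ℕ → ℝ, w = fun p => min (1 / 2 ^ p.2) (R / 2 ^ p.1) := ⟨_, rfl⟩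
  obtain ⟨f, hf⟩ : ∃ f : (ZMod q)ˣ → ℕ → ℕ × ℕ, f = fun (m : (ZMod q)ˣ) (d : ℕ) =>
      (Nat.log 2 d, Nat.log 2 ((m : ZMod q) * (d : ZMod q) ^ 2).valMinAbs.natAbs) := ⟨_, rfl⟩
  have w0 : ∀ p, 0 ≤ w p := fun p => hw ▸ le_min (by positivity) (by positivity)
  have hne : ∀ (m : (ZMod q)ˣ), ∀ d ∈ S, (m : ZMod q) * (d : ZMod q) ^ 2 ≠ 0 := by
    intro m d hd
    refine mul_ne_zero m.ne_zero (pow_ne_zero _ fun h => ?_)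
    rw [ZMod.natCast_eq_zero_iff] at h
    have := hS d hd
    exact absurd (Nat.le_of_dvd (by omega) h) (by omega)
  have hmaps : ∀ m, ∀ d ∈ S, f m d ∈ P := by
    intro m d hd
    have h3 := ZMod.natAbs_valMinAbs_le ((m : ZMod q) * (d : ZMod q) ^ 2)
    have h4 := Nat.log_mono_right (b := 2) (h3.trans (Nat.div_le_self _ _))
    have h5 := Nat.log_mono_right (b := 2) (hS d hd).2.2.le
    simp only [hP, hf, Finset.mem_product, Finset.mem_range]
    omega
  have hterm : ∀ m : (ZMod q)ˣ, ∀ d ∈ S, ‖g d ((m : ZMod q) * (d : ZMod q) ^ 2)‖ ≤ w (f m d) := by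
    intro m d hd
    obtain ⟨ha, hb⟩ := hg d hd _ (hne m d hd)
    rw [hw, hf]
    refine le_min (ha.trans ?_) (hb.trans ?_)
    · apply one_div_le_one_div_of_le (by positivity)
      have := Nat.pow_log_le_self 2 (x := ((m : ZMod q) * (d : ZMod q) ^ 2).valMinAbs.natAbs)
        (by simpa using hne m d hd)
      exact_mod_cast this
    · apply div_le_div_of_nonneg_left hR (by positivity)
      have := Nat.pow_log_le_self 2 (x := d) (by have := hS d hd; omega)
      exact_mod_cast this
  have hpoint : ∀ m : (ZMod q)ˣ, ‖∑ d ∈ S, g d ((m : ZMod q) * (d : ZMod q) ^ 2)‖ ^ 2 ≤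
      (P.card : ℝ) * ∑ p ∈ P, w p ^ 2 * ((S.filter fun d => f m d = p).card : ℝ) ^ 2 := fun m =>
    norm_sum_sq_le_card_mul_sum (hmaps m) (hterm m)
  have hp : ∀ p ∈ P, w p ^ 2 * ∑ m, ((S.filter fun d => f m d = p).card : ℝ) ^ 2 ≤
      4 * (C₁ * (q : ℝ) ^ (η / 2)) * ((D : ℝ) ^ 2 / q + R) := by
    rintro ⟨i, j⟩ -
    have h3 := h₁ q (min (2 ^ (i + 1)) D) (2 ^ (j + 1)) (by simp [hD, Nat.one_le_two_pow])
        Nat.one_le_two_pow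
      (S.filter fun d => Nat.log 2 d = i) (by
        intro d hd
        obtain ⟨hd, hi⟩ := Finset.mem_filter.1 hd
        refine ⟨(hS d hd).1, le_min ?_ (hS d hd).2.1, (hS d hd).2.2⟩
        rw [← hi]
        exact (Nat.lt_pow_succ_log_self one_lt_two d).le)
    have h4 : ∑ m, ((S.filter fun d => f m d = (i, j)).card : ℝ) ^ 2 ≤
        C₁ * (q : ℝ) ^ (η / 2) * ((D : ℝ) ^ 2 * (2 ^ (j + 1)) ^ 2 / q +
            2 ^ (i + 1) * 2 ^ (j + 1)) := by
      refine (Finset.sum_le_sum fun m _ => pow_le_pow_left₀ (by positivity) ?_ 2).trans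
          (h3.trans ?_)
      · refine Nat.cast_le.2 (Finset.card_le_card fun d hd => ?_)
        obtain ⟨hd, hfd⟩ := Finset.mem_filter.1 hd
        simp only [hf, Prod.mk.injEq] at hfd
        refine Finset.mem_filter.2 ⟨Finset.mem_filter.2 ⟨hd, hfd.1⟩, ?_⟩
        rw [← hfd.2]
        exact (Nat.lt_pow_succ_log_self one_lt_two _).le
      · push_cast
        gcongr
        · exact min_le_right _ _
        · exact min_le_left _ _
    exact dyadic_weight_sq_mul_le (by positivity) (by positivity) (w0 _) (hw ▸ min_le_left _ _)
      (hw ▸ min_le_right _ _) h4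
  calc _ ≤ ∑ m : (ZMod q)ˣ, (P.card : ℝ) * ∑ p ∈ P, w p ^ 2 *
        ((S.filter fun d => f m d = p).card : ℝ) ^ 2 := Finset.sum_le_sum fun m _ => hpoint m
    _ = (P.card : ℝ) * ∑ p ∈ P, w p ^ 2 * ∑ m, ((S.filter fun d => f m d = p).card : ℝ) ^ 2 := by
        rw [← Finset.mul_sum, Finset.sum_comm]
        simp_rw [Finset.mul_sum]
    _ ≤ (P.card : ℝ) * ∑ p ∈ P, 4 * (C₁ * (q : ℝ) ^ (η / 2)) * ((D : ℝ) ^ 2 / q + R) := by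
        exact mul_le_mul_of_nonneg_left (Finset.sum_le_sum hp) (by positivity)
    _ = (L : ℝ) ^ 4 * (4 * C₁ * (q : ℝ) ^ (η / 2) * ((D : ℝ) ^ 2 / q + R)) := by
        rw [Finset.sum_const, hP, Finset.card_product, Finset.card_range, nsmul_eq_mul]
        push_cast; ring
    _ ≤ C₂ * (q : ℝ) ^ (η / 2) * (4 * C₁ * (q : ℝ) ^ (η / 2) * ((D : ℝ) ^ 2 / q + R)) := by
        gcongr; exact hL ▸ h₂ q (by omega)
    _ = 4 * C₁ * C₂ * ((q : ℝ) ^ (η / 2) * (q : ℝ) ^ (η / 2)) * ((D : ℝ) ^ 2 / q + R) := by ring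
    _ = _ := by rw [← Real.rpow_add hq0, add_halves]

/-- Normalised exponential sum of length `N` at frequency `h` modulo `q`. -/
noncomputable def expSumCoeff (q : ℕ) [NeZero q] (N : ℕ) (h : ZMod q) : ℂ :=
  (∑ n ∈ Finset.Icc 1 N, ZMod.stdAddChar (-(h * (n : ZMod q)))) / q

/-- The Fourier transform of the indicator function of `[0, t]` at an integer `r`. -/
noncomputable def intervalFourier (t : ℝ) (r : ℤ) : ℂ :=
  (1 - Complex.exp (Complex.I * ((-(2 * Real.pi * r * t) : ℝ) : ℂ))) / (2 * Real.pi * Complex.I * r)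

theorem two_div_pi_mul_abs_le_norm_exp_sub_one {y : ℝ} (hy : |y| ≤ Real.pi) :
    2 / Real.pi * |y| ≤ ‖Complex.exp (Complex.I * y) - 1‖ := by
  rw [Complex.norm_exp_I_mul_ofReal_sub_one, norm_mul, Real.norm_eq_abs, Real.norm_eq_abs, abs_two]
  have h := Real.mul_abs_le_abs_sin (x := y / 2) (by rw [abs_div, abs_two]; linarith)
  rw [abs_div, abs_two] at h
  linarith

theorem norm_exp_sub_one_sub_le (y : ℝ) :
    ‖Complex.exp (Complex.I * y) - 1 - Complex.I * y‖ ≤ 2 * y ^ 2 := by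
  have hn : ‖Complex.I * (y : ℂ)‖ = |y| := by simp
  rcases le_total |y| 1 with h | h
  · refine (Complex.norm_exp_sub_one_sub_id_le (by rwa [hn])).trans ?_
    rw [hn, sq_abs]
    nlinarith [sq_nonneg y]
  · refine (norm_sub_le _ _).trans ?_
    have h1 : ‖Complex.exp (Complex.I * y) - 1‖ ≤ |y| := Real.norm_exp_I_mul_ofReal_sub_one_le
    rw [hn, ← sq_abs]
    nlinarith

theorem sum_exp_mul_exp_sub_one (y : ℝ) (N : ℕ) :
    (∑ n ∈ Finset.Icc 1 N, Complex.exp (Complex.I * ((-(n * y) : ℝ) : ℂ))) *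
      (Complex.exp (Complex.I * y) - 1) = 1 - Complex.exp (Complex.I * ((-(N * y) : ℝ) : ℂ)) := by
  induction N with
  | zero => simp
  | succ N ih =>
    rw [Finset.sum_Icc_succ_top (by omega), add_mul, ih, mul_sub, ← Complex.exp_add]
    have : Complex.I * ((-((N + 1 : ℕ) * y) : ℝ) : ℂ) + Complex.I * y =
        Complex.I * ((-(N * y) : ℝ) : ℂ) := by push_cast; ring
    rw [this]
    ring

theorem norm_exp_I_mul_sub_le (a b : ℝ) :
    ‖Complex.exp (Complex.I * a) - Complex.exp (Complex.I * b)‖ ≤ |a - b| := by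
  have e : Complex.exp (Complex.I * a) - Complex.exp (Complex.I * b) =
      Complex.exp (Complex.I * b) * (Complex.exp (Complex.I * ((a - b : ℝ) : ℂ)) - 1) := by
    rw [mul_sub, ← Complex.exp_add, mul_one]
    congr 2
    push_cast; ring
  rw [e, norm_mul, Complex.norm_exp_I_mul_ofReal, one_mul]
  exact Real.norm_exp_I_mul_ofReal_sub_one_le

theorem norm_one_sub_exp_le_two (y : ℝ) : ‖1 - Complex.exp (Complex.I * y)‖ ≤ 2 := by
  refine (norm_sub_le _ _).trans ?_
  rw [Complex.norm_exp_I_mul_ofReal, norm_one]; norm_num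

theorem expSumCoeff_eq (q : ℕ) [NeZero q] (N : ℕ) (h : ZMod q) :
    expSumCoeff q N h = (∑ n ∈ Finset.Icc 1 N, Complex.exp (Complex.I *
      ((-(n * (2 * Real.pi * h.valMinAbs / q)) : ℝ) : ℂ))) / q := by
  rw [expSumCoeff]
  congr 1
  refine Finset.sum_congr rfl fun n _ => ?_
  have e : -(h * (n : ZMod q)) = ((-(h.valMinAbs * n) : ℤ) : ZMod q) := by
    push_cast; simp
  rw [e, ZMod.stdAddChar_coe]
  congr 1
  push_cast; ring

theorem norm_expSumCoeff_le (q : ℕ) [NeZero q] (N : ℕ) (h : ZMod q) :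
    ‖expSumCoeff q N h‖ ≤ N / q := by
  rw [expSumCoeff, norm_div, Complex.norm_natCast]
  gcongr
  refine (norm_sum_le _ _).trans ?_
  simp

theorem abs_two_pi_mul_valMinAbs_div_le (q : ℕ) [NeZero q] (h : ZMod q) :
    |2 * Real.pi * h.valMinAbs / q| ≤ Real.pi := by
  have hq : (0 : ℝ) < q := by exact_mod_cast Nat.pos_of_ne_zero (NeZero.ne q)
  obtain ⟨h1, h2⟩ := ZMod.valMinAbs_mem_Ioc h
  have h3 : |(h.valMinAbs : ℝ)| * 2 ≤ q := by
    have h4 : |(h.valMinAbs : ℝ) * 2| ≤ q :=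
      abs_le.2 ⟨by exact_mod_cast h1.le, by exact_mod_cast h2⟩
    rwa [abs_mul, abs_two] at h4
  rw [abs_div, abs_mul, abs_mul, abs_two, abs_of_pos Real.pi_pos, abs_of_pos hq, div_le_iff₀ hq]
  nlinarith [Real.pi_pos]

theorem norm_expSumCoeff_le_inv (q : ℕ) [NeZero q] (N : ℕ) {h : ZMod q} (hh : h ≠ 0) :
    ‖expSumCoeff q N h‖ ≤ 1 / h.valMinAbs.natAbs := by
  have hq : (0 : ℝ) < q := by exact_mod_cast Nat.pos_of_ne_zero (NeZero.ne q)
  have hr : (0 : ℝ) < (h.valMinAbs.natAbs : ℝ) := by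
    have : 0 < h.valMinAbs.natAbs := Nat.pos_of_ne_zero (by simpa using hh)
    exact_mod_cast this
  set y : ℝ := 2 * Real.pi * h.valMinAbs / q with hy
  have hyabs : |y| = 2 * Real.pi * h.valMinAbs.natAbs / q := by
    rw [hy, abs_div, abs_mul, abs_mul, abs_two, abs_of_pos Real.pi_pos, abs_of_pos hq,
      Nat.cast_natAbs, Int.cast_abs]
  have h1 := two_div_pi_mul_abs_le_norm_exp_sub_one (abs_two_pi_mul_valMinAbs_div_le q h)
  have h2 := congrArg norm (sum_exp_mul_exp_sub_one y N)
  rw [norm_mul] at h2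
  have h3 := norm_one_sub_exp_le_two (-(N * y))
  rw [← h2] at h3
  rw [expSumCoeff_eq, norm_div, Complex.norm_natCast, div_le_div_iff₀ hq hr, one_mul]
  set G := ‖∑ n ∈ Finset.Icc 1 N, Complex.exp (Complex.I * ((-(n * y) : ℝ) : ℂ))‖ with hG
  have h4 : G * (2 / Real.pi * |y|) ≤ 2 := (mul_le_mul_of_nonneg_left h1 (norm_nonneg _)).trans h3
  have h5 : G * (2 / Real.pi * |y|) = 4 * (G * h.valMinAbs.natAbs) / q := by
    rw [hyabs]; field_simp; ring
  rw [h5, div_le_iff₀ hq] at h4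
  nlinarith

theorem norm_intervalFourier_le (t : ℝ) {r : ℤ} (hr : r ≠ 0) :
    ‖intervalFourier t r‖ ≤ 1 / |(r : ℝ)| := by
  have hr' : (0 : ℝ) < |(r : ℝ)| := by simpa using hr
  have e : ‖(2 * Real.pi * Complex.I * r : ℂ)‖ = 2 * Real.pi * |(r : ℝ)| := by
    simp [abs_of_pos Real.pi_pos]
  rw [intervalFourier, norm_div, e, div_le_div_iff₀ (by positivity) hr', one_mul]
  have := norm_one_sub_exp_le_two (-(2 * Real.pi * r * t))
  nlinarith [Real.pi_gt_three]

theorem norm_expSumCoeff_sub_le (q : ℕ) [NeZero q] {t : ℝ} (ht : 0 ≤ t) {h : ZMod q} (hh : h ≠ 0) :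
    ‖expSumCoeff q ⌊q * t⌋₊ h - intervalFourier t h.valMinAbs‖ ≤ 8 / q := by
  have hq : (0 : ℝ) < q := by exact_mod_cast Nat.pos_of_ne_zero (NeZero.ne q)
  set r := h.valMinAbs with hr
  have hr0 : r ≠ 0 := by simpa [hr] using hh
  set y : ℝ := 2 * Real.pi * r / q with hy
  have hy0 : y ≠ 0 := by positivity
  have hya : 0 < |y| := abs_pos.2 hy0
  set N := ⌊q * t⌋₊ with hN
  have hz := two_div_pi_mul_abs_le_norm_exp_sub_one (abs_two_pi_mul_valMinAbs_div_le q h)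
  rw [← hr, ← hy] at hz
  set z := Complex.exp (Complex.I * y) - 1 with hzdef
  have hzpos : 0 < ‖z‖ := lt_of_lt_of_le (by positivity) hz
  have hz0 : z ≠ 0 := norm_pos_iff.1 hzpos
  set A := 1 - Complex.exp (Complex.I * ((-(N * y) : ℝ) : ℂ)) with hA
  set B := 1 - Complex.exp (Complex.I * ((-(2 * Real.pi * r * t) : ℝ) : ℂ)) with hB
  have e1 : expSumCoeff q N h = A / z / q := by
    rw [expSumCoeff_eq, ← hr, ← hy, hA, ← sum_exp_mul_exp_sub_one y N, mul_div_cancel_right₀ _ hz0]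
  have hyc : (y : ℂ) ≠ 0 := by exact_mod_cast hy0
  have hqc : (q : ℂ) ≠ 0 := by exact_mod_cast hq.ne'
  have e2 : intervalFourier t r = B / (Complex.I * y) / q := by
    rw [intervalFourier, ← hB, div_div]
    congr 1
    rw [hy]; push_cast; field_simp
  have e3 : expSumCoeff q N h - intervalFourier t r =
      (A * (Complex.I * y - z) / (z * (Complex.I * y)) + (A - B) / (Complex.I * y)) / q := by
    rw [e1, e2]
    field_simp
    ring
  have hIy : ‖Complex.I * (y : ℂ)‖ = |y| := by simp
  have b1 : ‖A * (Complex.I * y - z) / (z * (Complex.I * y))‖ ≤ 2 * Real.pi := by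
    rw [norm_div, norm_mul, norm_mul, hIy, div_le_iff₀ (by positivity), norm_sub_rev (_ * _)]
    have h1 := norm_exp_sub_one_sub_le y
    rw [← hzdef] at h1
    have h2 := norm_one_sub_exp_le_two (-(N * y))
    rw [← hA] at h2
    calc _ ≤ 2 * (2 * y ^ 2) := by gcongr
      _ = 2 * Real.pi * ((2 / Real.pi * |y|) * |y|) := by
          rw [← sq_abs]; field_simp
      _ ≤ _ := by gcongr
  have b2 : ‖(A - B) / (Complex.I * y)‖ ≤ 1 := by
    rw [norm_div, hIy, div_le_one hya]
    have e4 : A - B = Complex.exp (Complex.I * ((-(2 * Real.pi * r * t) : ℝ) : ℂ)) -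
      Complex.exp (Complex.I * ((-(N * y) : ℝ) : ℂ)) := by rw [hA, hB]; ring
    rw [e4]
    refine (norm_exp_I_mul_sub_le _ _).trans ?_
    have e5 : -(2 * Real.pi * r * t) - -(N * y) = -(y * (q * t - N)) := by
      rw [hy]; field_simp; ring
    rw [e5, abs_neg, abs_mul]
    have h1 := Nat.floor_le (show 0 ≤ q * t by positivity)
    have h2 := Nat.lt_floor_add_one (q * t)
    have h3 : |q * t - (N : ℝ)| ≤ 1 := abs_le.2 ⟨by linarith, by linarith⟩
    nlinarith
  rw [e3, norm_div, Complex.norm_natCast]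
  gcongr
  refine (norm_add_le _ _).trans ?_
  linarith [Real.pi_lt_d2]

theorem card_le_of_separated {ι : Type*} {L : Finset ι} {f : ι → ℕ} {D l : ℕ} (hl : 0 < l)
    (hf : ∀ x ∈ L, f x ≤ D) (hsep : ∀ x ∈ L, ∀ y ∈ L, x ≠ y → l ≤ ((f x : ℤ) - f y).natAbs) :
    L.card ≤ D / l + 1 := by
  rw [← Finset.card_range (D / l + 1)]
  apply Finset.card_le_card_of_injOn (fun x => f x / l)
  · intro x hx
    simp only [Finset.coe_range, Set.mem_Iio]
    exact Nat.lt_succ_of_le (Nat.div_le_div_right (hf x hx))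
  · intro x hx y hy hxy
    by_contra hne
    have h1 := hsep x hx y hy hne
    have h2 := Nat.div_add_mod (f x) l
    have h3 := Nat.div_add_mod (f y) l
    have h4 := Nat.mod_lt (f x) hl
    have h5 := Nat.mod_lt (f y) hl
    dsimp only at hxy
    rw [hxy] at h2
    omega

theorem card_collinear_le {L : Finset (ℕ × ℕ)} {D l : ℕ} {a b : ℤ} (hl : 0 < l)
    (hab : max a.natAbs b.natAbs = l) (hL : ∀ p ∈ L, p.1 ≤ D ∧ p.2 ≤ D)
    (hcol : ∀ p ∈ L, ∀ p' ∈ L, ((p.1 : ℤ) - p'.1) * b = ((p.2 : ℤ) - p'.2) * a)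
    (hsep : ∀ p ∈ L, ∀ p' ∈ L, p ≠ p' →
      l ≤ max ((p.1 : ℤ) - p'.1).natAbs ((p.2 : ℤ) - p'.2).natAbs) :
    L.card ≤ D / l + 1 := by
  rcases le_total b.natAbs a.natAbs with h | h
  · apply card_le_of_separated (f := Prod.fst) hl fun p hp => (hL p hp).1
    intro p hp p' hp' hne
    have h1 := congrArg Int.natAbs (hcol p hp p' hp')
    rw [Int.natAbs_mul, Int.natAbs_mul] at h1
    have h2 : ((p.2 : ℤ) - p'.2).natAbs ≤ ((p.1 : ℤ) - p'.1).natAbs := by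
      have ha : 0 < a.natAbs := by omega
      have := Nat.mul_le_mul_left ((p.1 : ℤ) - p'.1).natAbs h
      rw [h1] at this
      exact Nat.le_of_mul_le_mul_right this ha
    have := hsep p hp p' hp' hne
    rwa [max_eq_left h2] at this
  · apply card_le_of_separated (f := Prod.snd) hl fun p hp => (hL p hp).2
    intro p hp p' hp' hne
    have h1 := congrArg Int.natAbs (hcol p hp p' hp')
    rw [Int.natAbs_mul, Int.natAbs_mul] at h1
    have h2 : ((p.1 : ℤ) - p'.1).natAbs ≤ ((p.2 : ℤ) - p'.2).natAbs := by
      have hb : 0 < b.natAbs := by omega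
      have := Nat.mul_le_mul_left ((p.2 : ℤ) - p'.2).natAbs h
      rw [← h1] at this
      exact Nat.le_of_mul_le_mul_right this hb
    have := hsep p hp p' hp' hne
    rwa [max_eq_right h2] at this

theorem card_lattice_points_le {q : ℕ} [Fact q.Prime] {h₁ h₂ : ℤ} {H D : ℕ} (h₁0 : h₁ ≠ 0)
    (hh₁ : h₁.natAbs ≤ H) (hh₂ : h₂.natAbs ≤ H) {ρ : ZMod q}
    (hρ : (h₁ : ZMod q) * ρ ^ 2 = h₂) :
    (((Finset.Icc 1 D ×ˢ Finset.Icc 1 D).filter fun p : ℕ × ℕ =>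
        (p.2 : ZMod q) = ρ * (p.1 : ZMod q) ∧
      h₁ * (p.2 : ℤ) ^ 2 ≠ h₂ * (p.1 : ℤ) ^ 2).card : ℝ) ≤
      1 + 8 * (D : ℝ) ^ 2 / q + D * Real.sqrt (2 * H / q) := by
  set A := (Finset.Icc 1 D ×ˢ Finset.Icc 1 D).filter fun p : ℕ × ℕ =>
    (p.2 : ZMod q) = ρ * (p.1 : ZMod q) ∧ h₁ * (p.2 : ℤ) ^ 2 ≠ h₂ * (p.1 : ℤ) ^ 2 with hA
  have hq0 : (0 : ℝ) < q := by exact_mod_cast (Fact.out : q.Prime).pos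
  have hmem : ∀ p ∈ A, (1 ≤ p.1 ∧ p.1 ≤ D) ∧ (1 ≤ p.2 ∧ p.2 ≤ D) ∧
      (p.2 : ZMod q) = ρ * (p.1 : ZMod q) ∧ h₁ * (p.2 : ℤ) ^ 2 ≠ h₂ * (p.1 : ℤ) ^ 2 := by
    intro p hp
    simpa [hA, and_assoc] using hp
  have hpos : 0 ≤ 8 * (D : ℝ) ^ 2 / q := by positivity
  have hpos2 : 0 ≤ D * Real.sqrt (2 * H / q) := by positivity
  rcases le_or_gt A.card 1 with hcard | hcard
  · have : (A.card : ℝ) ≤ 1 := by exact_mod_cast hcard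
    linarith
  obtain ⟨p, hp, p', hp', hpp⟩ := Finset.one_lt_card.1 hcard
  have hdiff : ∀ p ∈ A, ∀ p' ∈ A,
      ((((p.2 : ℤ) - p'.2) : ℤ) : ZMod q) = ρ * (((p.1 : ℤ) - p'.1 : ℤ) : ZMod q) := by
    intro p hp p' hp'
    push_cast
    rw [(hmem p hp).2.2.1, (hmem p' hp').2.2.1]
    ring
  have hmaxpos : ∀ p p' : ℕ × ℕ, p ≠ p' →
      0 < max ((p.1 : ℤ) - p'.1).natAbs ((p.2 : ℤ) - p'.2).natAbs := by
    intro p p' hne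
    by_contra! h
    apply hne
    ext <;> omega
  have hex : ∃ n : ℕ, 0 < n ∧ ∃ a b : ℤ,
      max a.natAbs b.natAbs = n ∧ (b : ZMod q) = ρ * (a : ZMod q) :=
    ⟨_, hmaxpos p p' hpp, _, _, rfl, hdiff p hp p' hp'⟩
  classical
  obtain ⟨l, hl⟩ : ∃ l, l = Nat.find hex := ⟨_, rfl⟩
  obtain ⟨hl0, a, b, hab, hbρ⟩ := Nat.find_spec hex
  rw [← hl] at hl0 hab
  have hmin : ∀ p ∈ A, ∀ p' ∈ A, p ≠ p' →
      l ≤ max ((p.1 : ℤ) - p'.1).natAbs ((p.2 : ℤ) - p'.2).natAbs := by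
    intro p hp p' hp' hne
    rw [hl]
    exact Nat.find_min' hex ⟨hmaxpos p p' hne, _, _, rfl, hdiff p hp p' hp'⟩
  have hlD : l ≤ D := by
    have h1 := hmin p hp p' hp' hpp
    have h2 := hmem p hp
    have h3 := hmem p' hp'
    omega
  have hdvd : ∀ p ∈ A, (q : ℤ) ∣ p.1 * b - p.2 * a := by
    intro p hp
    rw [← ZMod.intCast_zmod_eq_zero_iff_dvd]
    push_cast
    rw [hbρ, (hmem p hp).2.2.1]
    ring
  set j : ℕ × ℕ → ℤ := fun p => (p.1 * b - p.2 * a) / q with hj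
  have hjq : ∀ p ∈ A, j p * q = p.1 * b - p.2 * a := fun p hp => Int.ediv_mul_cancel (hdvd p hp)
  set M := 2 * l * D / q with hM
  have hjM : ∀ p ∈ A, (j p).natAbs ≤ M := by
    intro p hp
    rw [hM, Nat.le_div_iff_mul_le (Fact.out : q.Prime).pos]
    have h1 : (j p).natAbs * q = ((p.1 : ℤ) * b - p.2 * a).natAbs := by
      rw [← hjq p hp, Int.natAbs_mul, Int.natAbs_natCast]
    rw [h1]
    obtain ⟨⟨-, h2⟩, ⟨-, h3⟩, -⟩ := hmem p hp
    calc _ ≤ ((p.1 : ℤ) * b).natAbs + ((p.2 : ℤ) * a).natAbs := Int.natAbs_sub_le _ _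
      _ = p.1 * b.natAbs + p.2 * a.natAbs := by simp [Int.natAbs_mul]
      _ ≤ D * l + D * l := by
          gcongr
          · omega
          · omega
      _ = 2 * l * D := by ring
  have hfib : ∀ i : ℤ, (A.filter fun p => j p = i).card ≤ D / l + 1 := by
    intro i
    refine card_collinear_le hl0 hab (fun p hp => ?_) (fun p hp p' hp' => ?_)
      (fun p hp p' hp' => ?_)
    · have := hmem p (Finset.mem_filter.1 hp).1
      exact ⟨this.1.2, this.2.1.2⟩
    · obtain ⟨hp, hi⟩ := Finset.mem_filter.1 hp
      obtain ⟨hp', hi'⟩ := Finset.mem_filter.1 hp'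
      have h1 := hjq p hp
      have h2 := hjq p' hp'
      rw [hi] at h1
      rw [hi'] at h2
      linear_combination h2 - h1
    · exact hmin p (Finset.mem_filter.1 hp).1 p' (Finset.mem_filter.1 hp').1
  have hcount : ∀ I : Finset ℤ, (∀ p ∈ A, j p ∈ I) → (A.card : ℝ) ≤ I.card * (D / l + 1) := by
    intro I hI
    have h1 := Finset.card_le_mul_card_image_of_maps_to hI (D / l + 1) fun i _ => hfib i
    calc (A.card : ℝ) ≤ (((D / l + 1) * I.card : ℕ) : ℝ) := by exact_mod_cast h1
      _ = I.card * (((D / l : ℕ) : ℝ) + 1) := by push_cast; ring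
      _ ≤ _ := by gcongr; exact Nat.cast_div_le
  have hl0' : (0 : ℝ) < l := by exact_mod_cast hl0
  have hlD' : (l : ℝ) ≤ D := by exact_mod_cast hlD
  have hMr : (M : ℝ) ≤ 2 * l * D / q := by
    have := Nat.cast_div_le (α := ℝ) (m := 2 * l * D) (n := q)
    push_cast at this
    exact this
  have hmain : 2 * (M : ℝ) * (D / l + 1) ≤ 8 * (D : ℝ) ^ 2 / q := by
    calc _ ≤ 2 * (2 * l * D / q) * (D / l + 1 : ℝ) := by gcongr
      _ = 4 * (D : ℝ) ^ 2 / q + 4 * D * l / q := by field_simp; ring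
      _ ≤ 4 * (D : ℝ) ^ 2 / q + 4 * D * D / q := by gcongr
      _ = _ := by ring
  by_cases hdiag : h₁ * b ^ 2 = h₂ * a ^ 2
  · have h1 := hcount ((Finset.Icc (-(M : ℤ)) M).erase 0) (by
      intro p hp
      rw [Finset.mem_erase, Finset.mem_Icc]
      have := hjM p hp
      refine ⟨fun h0 => ?_, by omega, by omega⟩
      have h2 := hjq p hp
      rw [h0, zero_mul] at h2
      apply (hmem p hp).2.2.2
      have ha : a ≠ 0 := by
        rintro rfl
        have : b = 0 := by simpa [h₁0] using hdiag
        subst this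
        simp at hab
        omega
      have h3 : a ^ 2 ≠ 0 := pow_ne_zero _ ha
      apply mul_right_cancel₀ h3
      have h4 : (p.2 : ℤ) * a = p.1 * b := by linarith
      calc h₁ * (p.2 : ℤ) ^ 2 * a ^ 2 = h₁ * (p.2 * a) ^ 2 := by ring
        _ = (h₁ * b ^ 2) * p.1 ^ 2 := by rw [h4]; ring
        _ = _ := by rw [hdiag]; ring)
    have h5 : ((Finset.Icc (-(M : ℤ)) M).erase 0).card = 2 * M := by
      rw [Finset.card_erase_of_mem (by simp), Int.card_Icc]; omega
    rw [h5] at h1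
    push_cast at h1
    linarith
  · have h1 := hcount (Finset.Icc (-(M : ℤ)) M) (by
      intro p hp
      rw [Finset.mem_Icc]
      have := hjM p hp
      omega)
    have h5 : (Finset.Icc (-(M : ℤ)) M).card = 2 * M + 1 := by
      rw [Int.card_Icc]; omega
    rw [h5] at h1
    push_cast at h1
    have hqle : q ≤ 2 * H * l ^ 2 := by
      have h2 : (q : ℤ) ∣ h₁ * b ^ 2 - h₂ * a ^ 2 := by
        rw [← ZMod.intCast_zmod_eq_zero_iff_dvd]
        push_cast
        rw [hbρ, ← hρ]
        ring
      have h3 := Int.le_of_dvd (Int.natCast_pos.2 (Int.natAbs_pos.2 (sub_ne_zero.2 hdiag)))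
        (Int.dvd_natAbs.2 h2)
      have h4 : (h₁ * b ^ 2 - h₂ * a ^ 2).natAbs ≤ 2 * H * l ^ 2 := by
        calc _ ≤ (h₁ * b ^ 2).natAbs + (h₂ * a ^ 2).natAbs := Int.natAbs_sub_le _ _
          _ = h₁.natAbs * b.natAbs ^ 2 + h₂.natAbs * a.natAbs ^ 2 := by
              simp [Int.natAbs_mul, Int.natAbs_pow]
          _ ≤ H * l ^ 2 + H * l ^ 2 := by
              gcongr
              · omega
              · omega
          _ = _ := by ring
      omega
    have hqle' : (q : ℝ) ≤ 2 * H * l ^ 2 := by exact_mod_cast hqle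
    have h6 : (D : ℝ) / l ≤ D * Real.sqrt (2 * H / q) := by
      rw [div_eq_mul_inv]
      gcongr
      apply Real.le_sqrt_of_sq_le
      rw [inv_pow, inv_eq_one_div, div_le_div_iff₀ (by positivity) hq0]
      linarith
    linarith

/-- Off-diagonal solutions of `h₁ d₂² ≡ h₂ d₁²` modulo `q`. -/
theorem card_offDiag_le {q : ℕ} [Fact q.Prime] {h₁ h₂ : ℤ} {H D : ℕ} (h₁0 : h₁ ≠ 0)
    (hh₁ : h₁.natAbs ≤ H) (hh₂ : h₂.natAbs ≤ H) (hH : H < q) (hD : D < q) :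
    (((Finset.Icc 1 D ×ˢ Finset.Icc 1 D).filter fun p : ℕ × ℕ =>
      (h₁ : ZMod q) * (p.2 : ZMod q) ^ 2 = (h₂ : ZMod q) * (p.1 : ZMod q) ^ 2 ∧
      h₁ * (p.2 : ℤ) ^ 2 ≠ h₂ * (p.1 : ℤ) ^ 2).card : ℝ) ≤
      2 * (1 + 8 * (D : ℝ) ^ 2 / q + D * Real.sqrt (2 * H / q)) := by
  set A := (Finset.Icc 1 D ×ˢ Finset.Icc 1 D).filter fun p : ℕ × ℕ =>
      (h₁ : ZMod q) * (p.2 : ZMod q) ^ 2 = (h₂ : ZMod q) * (p.1 : ZMod q) ^ 2 ∧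
      h₁ * (p.2 : ℤ) ^ 2 ≠ h₂ * (p.1 : ℤ) ^ 2 with hA
  rcases A.eq_empty_or_nonempty with hempty | ⟨⟨u₀, v₀⟩, hp⟩
  · rw [hempty]
    simp only [Finset.card_empty, Nat.cast_zero]
    positivity
  have hu : ∀ u : ℕ, 1 ≤ u → u ≤ D → (u : ZMod q) ≠ 0 := by
    intro u h1 h2 h
    rw [ZMod.natCast_eq_zero_iff] at h
    exact absurd (Nat.le_of_dvd h1 h) (by omega)
  have hh₁q : (h₁ : ZMod q) ≠ 0 := by
    intro h
    rw [ZMod.intCast_zmod_eq_zero_iff_dvd] at h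
    have := Int.eq_zero_of_dvd_of_natAbs_lt_natAbs h (by simp; omega)
    exact h₁0 this
  simp only [hA, Finset.mem_filter, Finset.mem_product, Finset.mem_Icc] at hp
  obtain ⟨⟨⟨hu1, hu2⟩, -⟩, he, -⟩ := hp
  have hu0 := hu u₀ hu1 hu2
  set ρ : ZMod q := (v₀ : ZMod q) / u₀ with hρ
  have hρ2 : (h₁ : ZMod q) * ρ ^ 2 = h₂ := by
    rw [hρ, div_pow, mul_div_assoc', he, mul_div_cancel_right₀ _ (pow_ne_zero _ hu0)]
  have hsub : A ⊆ ((Finset.Icc 1 D ×ˢ Finset.Icc 1 D).filter fun p : ℕ × ℕ =>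
        (p.2 : ZMod q) = ρ * (p.1 : ZMod q) ∧ h₁ * (p.2 : ℤ) ^ 2 ≠ h₂ * (p.1 : ℤ) ^ 2) ∪
      ((Finset.Icc 1 D ×ˢ Finset.Icc 1 D).filter fun p : ℕ × ℕ =>
        (p.2 : ZMod q) = -ρ * (p.1 : ZMod q) ∧ h₁ * (p.2 : ℤ) ^ 2 ≠ h₂ * (p.1 : ℤ) ^ 2) := by
    rintro ⟨u, v⟩ hp
    simp only [hA, Finset.mem_filter] at hp
    simp only [Finset.mem_union, Finset.mem_filter]
    obtain ⟨hp1, hp2, hp3⟩ := hp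
    have h1 : (v : ZMod q) ^ 2 = (ρ * u) ^ 2 := by
      apply mul_left_cancel₀ hh₁q
      rw [hp2, ← hρ2]
      ring
    rcases sq_eq_sq_iff_eq_or_eq_neg.1 h1 with h2 | h2
    · exact Or.inl ⟨hp1, h2, hp3⟩
    · exact Or.inr ⟨hp1, by rw [h2]; ring, hp3⟩
  have h1 := (Finset.card_le_card hsub).trans (Finset.card_union_le _ _)
  have h2 := card_lattice_points_le (D := D) h₁0 hh₁ hh₂ hρ2
  have h3 := card_lattice_points_le (D := D) h₁0 hh₁ hh₂ (ρ := -ρ) (by rw [neg_sq]; exact hρ2)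
  have h4 := (Nat.cast_le (α := ℝ)).2 h1
  rw [Nat.cast_add] at h4
  linarith

theorem ofReal_div_cpow_half {r : ℝ} (hr : 0 < r) {b : ℂ} (hb : 0 < b.re) :
    ((r : ℂ) / b) ^ (1 / 2 : ℂ) = (√r : ℝ) * b ^ (-(1 / 2) : ℂ) := by
  have hb0 : b ≠ 0 := by rintro rfl; simp at hb
  have harg : b.arg ≠ Real.pi := by
    intro h
    rw [Complex.arg_eq_pi_iff] at h
    linarith [h.1]
  rw [div_eq_mul_inv, Complex.cpow_def_of_ne_zero (by simp [hr.ne', hb0]),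
    Complex.log_ofReal_mul hr (inv_ne_zero hb0), Complex.log_inv _ harg, add_mul, Complex.exp_add,
    Complex.cpow_def_of_ne_zero hb0, Real.sqrt_eq_rpow, Complex.ofReal_cpow hr.le,
    Complex.cpow_def_of_ne_zero (by simp [hr.ne']), Complex.ofReal_log hr.le]
  congr 2
  · push_cast; rfl
  · ring

theorem sin_sq_mul_exp_eq (s v : ℝ) :
    Real.sin (Real.pi * v ^ 2) ^ 2 * Real.exp (-s * v ^ 2) =
      1 / 2 * Real.exp (-s * v ^ 2) -
        1 / 2 * (Complex.exp (-((s : ℂ) + 2 * Real.pi * Complex.I) * (v : ℂ) ^ 2)).re := by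
  rw [Complex.exp_re, Real.sin_sq_eq_half_sub]
  have h1 : (-((s : ℂ) + 2 * Real.pi * Complex.I) * (v : ℂ) ^ 2).re = -s * v ^ 2 := by
    simp [← Complex.ofReal_pow]
  have h2 : (-((s : ℂ) + 2 * Real.pi * Complex.I) * (v : ℂ) ^ 2).im = -(2 * (Real.pi * v ^ 2)) := by
    simp [← Complex.ofReal_pow]
    ring
  rw [h1, h2, Real.cos_neg]
  ring

theorem integrableOn_sin_sq_mul_exp {s : ℝ} (hs : 0 < s) :
    IntegrableOn (fun v : ℝ => Real.sin (Real.pi * v ^ 2) ^ 2 * Real.exp (-s * v ^ 2))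
      (Set.Ioi 0) := by
  simp only [sin_sq_mul_exp_eq]
  have hb : 0 < ((s : ℂ) + 2 * Real.pi * Complex.I).re := by simpa using hs
  exact (((integrable_exp_neg_mul_sq hs).const_mul _).sub
    ((integrable_cexp_neg_mul_sq hb).re.const_mul _)).integrableOn

theorem integral_sin_sq_mul_exp {s : ℝ} (hs : 0 < s) :
    ∫ v in Set.Ioi (0 : ℝ), Real.sin (Real.pi * v ^ 2) ^ 2 * Real.exp (-s * v ^ 2) =
      √Real.pi / 4 * (1 / √s - (((s : ℂ) + 2 * Real.pi * Complex.I) ^ (-(1 / 2) : ℂ)).re) := by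
  simp only [sin_sq_mul_exp_eq]
  have hb : 0 < ((s : ℂ) + 2 * Real.pi * Complex.I).re := by simpa using hs
  have hre := (integrable_cexp_neg_mul_sq hb).integrableOn (s := Set.Ioi 0)
  have hre' : Integrable (fun v : ℝ =>
      (Complex.exp (-((s : ℂ) + 2 * Real.pi * Complex.I) * (v : ℂ) ^ 2)).re)
      (volume.restrict (Set.Ioi 0)) := hre.re
  rw [integral_sub ((integrable_exp_neg_mul_sq hs).const_mul _).integrableOn
    (hre'.const_mul _), integral_const_mul, integral_const_mul, integral_gaussian_Ioi]
  have h1 := integral_re hre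
  simp only [RCLike.re_to_complex] at h1
  rw [h1, integral_gaussian_complex_Ioi hb, ofReal_div_cpow_half Real.pi_pos hb,
    Real.sqrt_div Real.pi_pos.le]
  have h2 : ((√Real.pi : ℝ) * ((s : ℂ) + 2 * Real.pi * Complex.I) ^ (-(1 / 2) : ℂ) / 2).re =
      √Real.pi / 2 * (((s : ℂ) + 2 * Real.pi * Complex.I) ^ (-(1 / 2) : ℂ)).re := by
    rw [mul_div_assoc, Complex.re_ofReal_mul]
    have : ∀ w : ℂ, (w / 2).re = w.re / 2 := fun w => by
      simp
    rw [this]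
    ring
  rw [h2]
  ring

theorem sqrt_sub_re_cpow_half_hasDerivAt {s : ℝ} (hs : 0 < s) :
    HasDerivAt (fun s : ℝ => √Real.pi / 2 *
        (√s - (((s : ℂ) + 2 * Real.pi * Complex.I) ^ (1 / 2 : ℂ)).re))
      (√Real.pi / 4 * (1 / √s - (((s : ℂ) + 2 * Real.pi * Complex.I) ^ (-(1 / 2) : ℂ)).re)) s := by
  have h1 := Real.hasDerivAt_sqrt hs.ne'
  have h2 : HasDerivAt (fun w : ℂ => (w + 2 * Real.pi * Complex.I) ^ (1 / 2 : ℂ))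
      ((1 / 2 : ℂ) * ((s : ℂ) + 2 * Real.pi * Complex.I) ^ (1 / 2 - 1 : ℂ) * 1) (s : ℂ) := by
    apply HasDerivAt.cpow_const
    · exact (hasDerivAt_id _).add_const _
    · left; simpa using hs
  have h3 := h2.real_of_complex
  refine ((h1.sub h3).const_mul (√Real.pi / 2)).congr_deriv ?_
  have h4 : ((1 / 2 : ℂ) * ((s : ℂ) + 2 * Real.pi * Complex.I) ^ (1 / 2 - 1 : ℂ) * 1).re =
      1 / 2 * (((s : ℂ) + 2 * Real.pi * Complex.I) ^ (-(1 / 2) : ℂ)).re := by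
    rw [mul_one, show (1 / 2 : ℂ) = ((1 / 2 : ℝ) : ℂ) by push_cast; rfl, Complex.re_ofReal_mul]
    norm_num
  rw [h4]
  ring

theorem sqrt_sub_re_cpow_half_continuousWithinAt :
    ContinuousWithinAt (fun s : ℝ => √Real.pi / 2 *
        (√s - (((s : ℂ) + 2 * Real.pi * Complex.I) ^ (1 / 2 : ℂ)).re)) (Set.Ici 0) 0 := by
  apply ContinuousAt.continuousWithinAt
  refine continuousAt_const.mul (Real.continuous_sqrt.continuousAt.sub ?_)
  apply Complex.continuous_re.continuousAt.comp
  apply ContinuousAt.cpow (by fun_prop) continuousAt_const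
  right
  simp [Real.pi_ne_zero]

theorem sqrt_sub_re_cpow_half_zero :
    √Real.pi / 2 *
        (√(0 : ℝ) - ((((0 : ℝ) : ℂ) + 2 * Real.pi * Complex.I) ^ (1 / 2 : ℂ)).re) =
            -(Real.pi / 2) := by
  have h := Complex.cpow_ofReal_re (((0 : ℝ) : ℂ) + 2 * Real.pi * Complex.I) (1 / 2)
  have h0 : ((0 : ℝ) : ℂ) + 2 * Real.pi * Complex.I = ((2 * Real.pi : ℝ) : ℂ) * Complex.I := by
    push_cast; ring
  have h1 : ‖((0 : ℝ) : ℂ) + 2 * Real.pi * Complex.I‖ = 2 * Real.pi := by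
    rw [h0]; simp [Real.pi_pos.le]
  have h2 : (((0 : ℝ) : ℂ) + 2 * Real.pi * Complex.I).arg = Real.pi / 2 := by
    rw [h0, Complex.arg_real_mul _ (by positivity), Complex.arg_I]
  rw [h1, h2, show Real.pi / 2 * (1 / 2) = Real.pi / 4 by ring, Real.cos_pi_div_four,
    ← Real.sqrt_eq_rpow, Real.sqrt_mul (by norm_num)] at h
  push_cast at h ⊢
  rw [h, Real.sqrt_zero]
  have h3 := Real.mul_self_sqrt Real.pi_pos.le
  have h4 := Real.mul_self_sqrt (show (0 : ℝ) ≤ 2 by norm_num)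
  linear_combination (-(1 / 4) * √2 * √2) * h3 - 1 / 4 * Real.pi * h4

theorem sqrt_sub_re_cpow_half_tendsto :
    Filter.Tendsto (fun s : ℝ => √Real.pi / 2 *
        (√s - (((s : ℂ) + 2 * Real.pi * Complex.I) ^ (1 / 2 : ℂ)).re)) Filter.atTop (nhds 0) := by
  suffices h : Filter.Tendsto (fun s : ℝ => √s -
      (((s : ℂ) + 2 * Real.pi * Complex.I) ^ (1 / 2 : ℂ)).re) Filter.atTop (nhds 0) by
    simpa using h.const_mul (√Real.pi / 2)
  have hbound : ∀ s : ℝ, 0 < s → ‖√s -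
      (((s : ℂ) + 2 * Real.pi * Complex.I) ^ (1 / 2 : ℂ)).re‖ ≤ 2 * Real.pi * (√s)⁻¹ := by
    intro s hs
    obtain ⟨w, hw⟩ : ∃ w, w = ((s : ℂ) + 2 * Real.pi * Complex.I) ^ (1 / 2 : ℂ) := ⟨_, rfl⟩
    have hw2 : w ^ 2 = (s : ℂ) + 2 * Real.pi * Complex.I := by
      rw [hw, ← Complex.cpow_nat_mul]; norm_num
    have hwre : 0 ≤ w.re := by
      have h := Complex.cpow_ofReal_re ((s : ℂ) + 2 * Real.pi * Complex.I) (1 / 2)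
      rw [show (((1 / 2 : ℝ)) : ℂ) = 1 / 2 by push_cast; rfl, ← hw] at h
      rw [h]
      apply mul_nonneg (by positivity)
      apply Real.cos_nonneg_of_neg_pi_div_two_le_of_le
      · linarith [Complex.neg_pi_lt_arg ((s : ℂ) + 2 * Real.pi * Complex.I)]
      · linarith [Complex.arg_le_pi ((s : ℂ) + 2 * Real.pi * Complex.I)]
    rw [← hw]
    have hss : √s ^ 2 = s := Real.sq_sqrt hs.le
    have hs0 : 0 < √s := Real.sqrt_pos.2 hs
    have hmul : (((√s : ℝ) : ℂ) - w) * ((√s : ℝ) + w) = -(2 * Real.pi * Complex.I) := by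
      have : ((√s : ℝ) : ℂ) ^ 2 = s := by rw [← Complex.ofReal_pow, hss]
      linear_combination this - hw2
    have hnorm := congrArg norm hmul
    rw [norm_mul, norm_neg] at hnorm
    have hr : ‖(2 * Real.pi * Complex.I : ℂ)‖ = 2 * Real.pi := by simp [Real.pi_pos.le]
    rw [hr] at hnorm
    have h1 : √s ≤ ‖((√s : ℝ) : ℂ) + w‖ := by
      refine le_trans ?_ (Complex.re_le_norm _)
      simpa using hwre
    have h2 : ‖√s - w.re‖ ≤ ‖((√s : ℝ) : ℂ) - w‖ := by
      have := Complex.abs_re_le_norm (((√s : ℝ) : ℂ) - w)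
      simpa using this
    rw [← div_eq_mul_inv, le_div_iff₀ hs0, ← hnorm]
    gcongr
  apply squeeze_zero_norm' (a := fun s => 2 * Real.pi * (√s)⁻¹)
  · filter_upwards [Filter.eventually_gt_atTop 0] with s hs using hbound s hs
  · have := (tendsto_inv_atTop_zero.comp Real.tendsto_sqrt_atTop).const_mul (2 * Real.pi)
    simpa using this

theorem lintegral_sin_sq_div_sq :
    ∫⁻ v in Set.Ioi (0 : ℝ), ENNReal.ofReal (Real.sin (Real.pi * v ^ 2) ^ 2 / v ^ 2) =
      ENNReal.ofReal (Real.pi / 2) := by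
  have h1 : ∀ v ∈ Set.Ioi (0 : ℝ), ENNReal.ofReal (Real.sin (Real.pi * v ^ 2) ^ 2 / v ^ 2) =
      ∫⁻ s in Set.Ioi (0 : ℝ),
        ENNReal.ofReal (Real.sin (Real.pi * v ^ 2) ^ 2 * Real.exp (-s * v ^ 2)) := by
    intro v hv
    have hv2 : -v ^ 2 < 0 := by have := pow_pos (Set.mem_Ioi.1 hv) 2; linarith
    have hint : IntegrableOn
        (fun s => Real.sin (Real.pi * v ^ 2) ^ 2 * Real.exp (-s * v ^ 2)) (Set.Ioi 0) := by
      have : (fun s => Real.sin (Real.pi * v ^ 2) ^ 2 * Real.exp (-s * v ^ 2)) =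
          fun s => Real.sin (Real.pi * v ^ 2) ^ 2 * Real.exp (-v ^ 2 * s) := by
        ext s
        congr 2
        ring
      rw [this]
      exact (integrableOn_exp_mul_Ioi hv2 0).const_mul _
    rw [← ofReal_integral_eq_lintegral_ofReal hint (ae_of_all _ fun s => by positivity)]
    congr 1
    rw [integral_const_mul]
    have : (fun s : ℝ => Real.exp (-s * v ^ 2)) = fun s => Real.exp (-v ^ 2 * s) := by
      ext s; congr 1; ring
    rw [this, integral_exp_mul_Ioi hv2]
    have hv0 : v ≠ 0 := (Set.mem_Ioi.1 hv).ne'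
    simp
    field_simp
  rw [setLIntegral_congr_fun measurableSet_Ioi h1, lintegral_lintegral_swap (by fun_prop)]
  have h2 : ∀ s ∈ Set.Ioi (0 : ℝ), ∫⁻ v in Set.Ioi (0 : ℝ),
      ENNReal.ofReal (Real.sin (Real.pi * v ^ 2) ^ 2 * Real.exp (-s * v ^ 2)) =
      ENNReal.ofReal (√Real.pi / 4 *
        (1 / √s - (((s : ℂ) + 2 * Real.pi * Complex.I) ^ (-(1 / 2) : ℂ)).re)) := by
    intro s hs
    rw [← ofReal_integral_eq_lintegral_ofReal (integrableOn_sin_sq_mul_exp hs)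
      (ae_of_all _ fun v => by positivity), integral_sin_sq_mul_exp hs]
  have hnn : ∀ s ∈ Set.Ioi (0 : ℝ), 0 ≤ √Real.pi / 4 *
        (1 / √s - (((s : ℂ) + 2 * Real.pi * Complex.I) ^ (-(1 / 2) : ℂ)).re) := by
    intro s hs
    rw [← integral_sin_sq_mul_exp hs]
    exact integral_nonneg fun v => by positivity
  rw [setLIntegral_congr_fun measurableSet_Ioi h2,
    ← ofReal_integral_eq_lintegral_ofReal
      (integrableOn_Ioi_deriv_of_nonneg sqrt_sub_re_cpow_half_continuousWithinAt
        (fun s hs => sqrt_sub_re_cpow_half_hasDerivAt hs) hnn sqrt_sub_re_cpow_half_tendsto)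
      (by filter_upwards [ae_restrict_mem measurableSet_Ioi] with s hs using hnn s hs),
    integral_Ioi_of_hasDerivAt_of_nonneg sqrt_sub_re_cpow_half_continuousWithinAt
        (fun s hs => sqrt_sub_re_cpow_half_hasDerivAt hs) hnn sqrt_sub_re_cpow_half_tendsto,
    sqrt_sub_re_cpow_half_zero]
  congr 1
  ring

theorem integrableOn_sin_sq_div_sq :
    IntegrableOn (fun v : ℝ => Real.sin (Real.pi * v ^ 2) ^ 2 / v ^ 2) (Set.Ioi 0) := by
  refine ⟨(by fun_prop : Measurable _).aestronglyMeasurable, ?_⟩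
  rw [hasFiniteIntegral_iff_ofReal (ae_of_all _ fun v => by positivity), lintegral_sin_sq_div_sq]
  exact ENNReal.ofReal_lt_top

theorem integral_sin_sq_div_sq :
    ∫ v in Set.Ioi (0 : ℝ), Real.sin (Real.pi * v ^ 2) ^ 2 / v ^ 2 = Real.pi / 2 := by
  rw [integral_eq_lintegral_of_nonneg_ae (ae_of_all _ fun v => by positivity)
    (by fun_prop : Measurable _).aestronglyMeasurable, lintegral_sin_sq_div_sq,
    ENNReal.toReal_ofReal (by positivity)]

/-- The `1`-periodic function `{t}(1 - {t})`. -/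
noncomputable def fractProd (t : ℝ) : ℝ := Int.fract t * (1 - Int.fract t)

theorem measurable_fractProd : Measurable fractProd :=
  measurable_fract.mul (measurable_const.sub measurable_fract)

theorem fractProd_nonneg (t : ℝ) : 0 ≤ fractProd t :=
  mul_nonneg (Int.fract_nonneg t) (sub_nonneg.2 (Int.fract_lt_one t).le)

theorem fractProd_le_one (t : ℝ) : fractProd t ≤ 1 := by
  have h1 := Int.fract_nonneg t
  have h2 := Int.fract_lt_one t
  unfold fractProd
  nlinarith

theorem fractProd_zero : fractProd 0 = 0 := by simp [fractProd]

theorem abs_fractProd_sub_le (s t : ℝ) : |fractProd s - fractProd t| ≤ |s - t| := by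
  wlog h : s ≤ t generalizing s t
  · rw [abs_sub_comm, abs_sub_comm s]
    exact this t s (le_of_not_ge h)
  rw [abs_of_nonpos (sub_nonpos.2 h)]
  have hs0 := Int.fract_nonneg s
  have hs1 := Int.fract_lt_one s
  have ht0 := Int.fract_nonneg t
  have ht1 := Int.fract_lt_one t
  have hs := Int.floor_add_fract s
  have ht := Int.floor_add_fract t
  have hfl : ⌊s⌋ ≤ ⌊t⌋ := Int.floor_le_floor h
  unfold fractProd
  rcases eq_or_lt_of_le hfl with h1 | h1
  · have h2 : Int.fract s ≤ Int.fract t := by rw [h1] at hs; linarith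
    have h3 : -(s - t) = Int.fract t - Int.fract s := by rw [h1] at hs; linarith
    rw [h3, abs_le]
    constructor <;> nlinarith
  · have h2 : (⌊s⌋ : ℝ) + 1 ≤ ⌊t⌋ := by exact_mod_cast h1
    have h3 : Int.fract t + 1 - Int.fract s ≤ -(s - t) := by linarith
    refine le_trans ?_ h3
    rw [abs_le]
    constructor <;> nlinarith

theorem fractProd_le_self {t : ℝ} (ht : 0 ≤ t) : fractProd t ≤ t := by
  have := abs_fractProd_sub_le t 0
  rwa [fractProd_zero, sub_zero, sub_zero, abs_of_nonneg (fractProd_nonneg t),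
    abs_of_nonneg ht] at this

theorem le_rpow_of_le_one_of_le {w t θ : ℝ} (hw : 0 ≤ w) (hw1 : w ≤ 1) (hwt : w ≤ t) (hθ : 0 ≤ θ)
    (hθ1 : θ ≤ 1) : w ≤ t ^ θ :=
  calc w ≤ w ^ θ := Real.self_le_rpow_of_le_one hw hw1 hθ1
    _ ≤ t ^ θ := Real.rpow_le_rpow hw hwt hθ

theorem hasSum_fractProd (t : ℝ) :
    HasSum (fun k : ℕ => 2 * Real.sin (Real.pi * (k * t)) ^ 2 / (Real.pi ^ 2 * (k : ℝ) ^ 2))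
      (fractProd t) := by
  have h1 := hasSum_one_div_nat_pow_mul_cos one_ne_zero
    (x := Int.fract t) ⟨Int.fract_nonneg t, (Int.fract_lt_one t).le⟩
  have h2 := bernoulliFun_two (Int.fract t)
  rw [bernoulliFun] at h2
  rw [mul_one, h2] at h1
  have h3 := (hasSum_zeta_two.sub h1).mul_left (1 / Real.pi ^ 2)
  have hpi := Real.pi_ne_zero
  have hv : 1 / Real.pi ^ 2 * (Real.pi ^ 2 / 6 - (-1) ^ (1 + 1) * (2 * Real.pi) ^ 2 / 2 /
      (Nat.factorial 2 : ℕ) * (Int.fract t ^ 2 - Int.fract t + 6⁻¹)) = fractProd t := by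
    unfold fractProd
    simp [Nat.factorial]
    field_simp
    ring
  rw [hv] at h3
  refine Eq.mp (congrArg (fun f => HasSum f (fractProd t)) (funext fun k : ℕ => Eq.symm ?_)) h3
  have hcos : Real.cos (2 * Real.pi * k * Int.fract t) =
      1 - 2 * Real.sin (Real.pi * (k * t)) ^ 2 := by
    rw [Real.sin_sq_eq_half_sub]
    have : 2 * Real.pi * k * Int.fract t =
        2 * (Real.pi * (k * t)) - ((k * ⌊t⌋ : ℤ) : ℝ) * (2 * Real.pi) := by
      rw [Int.fract]; push_cast; ring
    rw [this, Real.cos_sub_int_mul_two_pi]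
    ring
  rw [hcos]
  rcases eq_or_ne (k : ℝ) 0 with hk | hk
  · simp [hk]
  · field_simp
    ring

theorem integral_sin_sq_mul_div_sq {a : ℝ} (ha : 0 ≤ a) :
    IntegrableOn (fun v : ℝ => Real.sin (Real.pi * (a / v ^ 2)) ^ 2) (Set.Ioi 0) ∧
      ∫ v in Set.Ioi (0 : ℝ), Real.sin (Real.pi * (a / v ^ 2)) ^ 2 = √a * (Real.pi / 2) := by
  rcases ha.eq_or_lt with rfl | ha
  · simp
  have hs : 0 < √a := Real.sqrt_pos.2 ha
  have hsa : √a ^ 2 = a := Real.sq_sqrt ha.le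
  have hscale : ∀ v ∈ Set.Ioi (0 : ℝ),
      a * (Real.sin (Real.pi * (√a * v) ^ 2) ^ 2 / (√a * v) ^ 2) =
      (|(-1 : ℝ)| * v ^ ((-1 : ℝ) - 1)) • Real.sin (Real.pi * (a / (v ^ (-1 : ℝ)) ^ 2)) ^ 2 := by
    intro v hv
    have hv0 : 0 < v := hv
    have h1 : v ^ ((-1 : ℝ) - 1) = (v ^ 2)⁻¹ := by
      rw [show (-1 : ℝ) - 1 = -((2 : ℕ) : ℝ) by norm_num, Real.rpow_neg hv0.le, Real.rpow_natCast]
    rw [h1, Real.rpow_neg_one, mul_pow, hsa]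
    simp
    field_simp
  constructor
  · rw [← integrableOn_Ioi_comp_rpow_iff _ (p := -1) (by norm_num)]
    refine IntegrableOn.congr_fun ?_ hscale measurableSet_Ioi
    refine Integrable.const_mul ?_ a
    have := (integrableOn_Ioi_comp_mul_left_iff
      (fun v : ℝ => Real.sin (Real.pi * v ^ 2) ^ 2 / v ^ 2) 0 hs).2
    rw [mul_zero] at this
    exact this integrableOn_sin_sq_div_sq
  · rw [← integral_comp_rpow_Ioi _ (p := -1) (by norm_num),
      ← setIntegral_congr_fun measurableSet_Ioi hscale, integral_const_mul,
      integral_comp_mul_left_Ioi (fun v : ℝ => Real.sin (Real.pi * v ^ 2) ^ 2 / v ^ 2) 0 hs,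
      mul_zero, integral_sin_sq_div_sq]
    rw [smul_eq_mul]
    nth_rewrite 1 [← hsa]
    field_simp

theorem integrableOn_fractProd_div_sq {Y : ℝ} (hY : 0 ≤ Y) :
    IntegrableOn (fun u : ℝ => fractProd (Y / u ^ 2)) (Set.Ioi 0) := by
  have hm : Measurable fun u : ℝ => fractProd (Y / u ^ 2) :=
    measurable_fractProd.comp (by fun_prop)
  rw [← Set.Ioc_union_Ioi_eq_Ioi zero_le_one]
  apply IntegrableOn.union
  · refine Measure.integrableOn_of_bounded (M := 1) (by simp) hm.aestronglyMeasurable ?_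
    exact ae_of_all _ fun u => by
      rw [Real.norm_of_nonneg (fractProd_nonneg _)]; exact fractProd_le_one _
  · refine Integrable.mono' ((integrableOn_Ioi_rpow_of_lt (a := -2) (by norm_num)
      zero_lt_one).const_mul Y) hm.aestronglyMeasurable ?_
    filter_upwards [ae_restrict_mem measurableSet_Ioi] with u hu
    have hu0 : (0 : ℝ) < u := zero_lt_one.trans hu
    rw [Real.norm_of_nonneg (fractProd_nonneg _)]
    refine (fractProd_le_self (by positivity)).trans (le_of_eq ?_)
    rw [show (-2 : ℝ) = -((2 : ℕ) : ℝ) by norm_num, Real.rpow_neg hu0.le, Real.rpow_natCast]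
    rfl

theorem hasSum_riemannZeta_three_halves_re :
    HasSum (fun k : ℕ => 1 / (k : ℝ) ^ (3 / 2 : ℝ)) (riemannZeta (3 / 2)).re := by
  have h1 : (1 : ℝ) < (3 / 2 : ℂ).re := by norm_num
  have h2 : Summable fun k : ℕ => 1 / (k : ℝ) ^ (3 / 2 : ℝ) :=
    Real.summable_one_div_nat_rpow.2 (by norm_num)
  have h3 : riemannZeta (3 / 2) = ((∑' k : ℕ, 1 / (k : ℝ) ^ (3 / 2 : ℝ) : ℝ) : ℂ) := by
    rw [zeta_eq_tsum_one_div_nat_cpow h1, Complex.ofReal_tsum]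
    congr 1
    ext k
    push_cast
    rw [Complex.ofReal_cpow (Nat.cast_nonneg k)]
    push_cast
    rfl
  rw [h3, Complex.ofReal_re]
  exact h2.hasSum

theorem integral_fractProd_div_sq {Y : ℝ} (hY : 0 ≤ Y) :
    ∫ u in Set.Ioi (0 : ℝ), fractProd (Y / u ^ 2) =
      (riemannZeta (3 / 2)).re / Real.pi * √Y := by
  set F : ℕ → ℝ → ℝ := fun k u =>
    2 * Real.sin (Real.pi * (k * (Y / u ^ 2))) ^ 2 / (Real.pi ^ 2 * (k : ℝ) ^ 2) with hF
  have hFe : ∀ k : ℕ, F k = fun u => 2 / (Real.pi ^ 2 * (k : ℝ) ^ 2) *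
      Real.sin (Real.pi * ((k * Y) / u ^ 2)) ^ 2 := by
    intro k; ext u; simp only [hF]; rw [mul_div_assoc (k : ℝ)]; ring
  have hkY : ∀ k : ℕ, 0 ≤ (k : ℝ) * Y := fun k => by positivity
  have hint : ∀ k, Integrable (F k) (volume.restrict (Set.Ioi 0)) := by
    intro k
    rw [hFe]
    exact (integral_sin_sq_mul_div_sq (hkY k)).1.const_mul _
  have hval : ∀ k : ℕ, ∫ u in Set.Ioi (0 : ℝ),
      F k u = √Y / Real.pi * (1 / (k : ℝ) ^ (3 / 2 : ℝ)) := by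
    intro k
    rw [hFe, integral_const_mul, (integral_sin_sq_mul_div_sq (hkY k)).2,
      Real.sqrt_mul (Nat.cast_nonneg k)]
    rcases Nat.eq_zero_or_pos k with rfl | hk
    · simp
    have hk0 : (0 : ℝ) < k := by exact_mod_cast hk
    rw [show (3 / 2 : ℝ) = 1 + 1 / 2 by norm_num, Real.rpow_add hk0, Real.rpow_one,
      ← Real.sqrt_eq_rpow]
    have hs : √(k : ℝ) ^ 2 = k := Real.sq_sqrt hk0.le
    have hs0 : 0 < √(k : ℝ) := Real.sqrt_pos.2 hk0
    have hpi := Real.pi_pos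
    field_simp
    linear_combination √Y * hs
  have hnorm : ∀ k : ℕ, ∫ u in Set.Ioi (0 : ℝ), ‖F k u‖ = ∫ u in Set.Ioi (0 : ℝ), F k u := by
    intro k
    congr 1
    ext u
    exact Real.norm_of_nonneg (by simp only [hF]; positivity)
  have hz := hasSum_riemannZeta_three_halves_re.mul_left (√Y / Real.pi)
  have h1 := hasSum_integral_of_summable_integral_norm hint (by
    simp only [hnorm, hval]; exact hz.summable)
  simp only [hval] at h1
  have h2 : ∀ u, ∑' k, F k u = fractProd (Y / u ^ 2) := fun u => (hasSum_fractProd _).tsum_eq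
  simp only [h2] at h1
  rw [h1.unique hz]
  ring

theorem abs_fractProd_div_sq_sub_le {Y k u : ℝ} (hY : 0 ≤ Y) (hk : 1 ≤ k) (hku : k ≤ u)
    (huk : u ≤ k + 1) :
    |fractProd (Y / k ^ 2) - fractProd (Y / u ^ 2)| ≤
      (2 * Y) ^ (2 / 5 : ℝ) * k ^ (-(6 / 5) : ℝ) := by
  have hk0 : 0 < k := by linarith
  have hu0 : 0 < u := by linarith
  have h1 : |Y / k ^ 2 - Y / u ^ 2| ≤ 2 * Y * k ^ (-3 : ℝ) := by
    have h2 : Y / k ^ 2 - Y / u ^ 2 = Y * ((u ^ 2 - k ^ 2) / (k ^ 2 * u ^ 2)) := by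
      field_simp
    rw [h2, abs_of_nonneg (mul_nonneg hY (div_nonneg (by nlinarith) (by positivity))),
      show (-3 : ℝ) = -((3 : ℕ) : ℝ) by norm_num, Real.rpow_neg hk0.le, Real.rpow_natCast,
      mul_comm 2 Y, mul_assoc]
    gcongr
    rw [← div_eq_mul_inv, div_le_div_iff₀ (by positivity) (by positivity)]
    have h3 : u ^ 2 - k ^ 2 ≤ 2 * u := by nlinarith
    have h4 : 2 * u * k ^ 3 ≤ 2 * (k ^ 2 * u ^ 2) := by
      have : 0 < k ^ 2 * u := by positivity
      nlinarith
    calc _ ≤ 2 * u * k ^ 3 := by gcongr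
      _ ≤ _ := h4
  have h5 : |fractProd (Y / k ^ 2) - fractProd (Y / u ^ 2)| ≤ 1 := by
    have := fractProd_nonneg (Y / k ^ 2)
    have := fractProd_nonneg (Y / u ^ 2)
    have := fractProd_le_one (Y / k ^ 2)
    have := fractProd_le_one (Y / u ^ 2)
    rw [abs_le]; constructor <;> linarith
  refine (le_rpow_of_le_one_of_le (abs_nonneg _) h5 ((abs_fractProd_sub_le _ _).trans h1)
    (θ := 2 / 5) (by norm_num) (by norm_num)).trans (le_of_eq ?_)
  rw [Real.mul_rpow (by positivity) (by positivity), ← Real.rpow_mul hk0.le]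
  norm_num

theorem summable_fractProd_div_sq {Y : ℝ} (hY : 0 ≤ Y) :
    Summable fun k : ℕ => fractProd (Y / ((k : ℝ) + 1) ^ 2) := by
  have h := (summable_nat_add_iff 1).2 (Real.summable_one_div_nat_pow.2 (one_lt_two))
  refine Summable.of_nonneg_of_le (fun k => fractProd_nonneg _)
    (fun k => (fractProd_le_self (by positivity)).trans (le_of_eq ?_)) (h.mul_left Y)
  push_cast
  ring

theorem exists_abs_tsum_fractProd_sub_le :
    ∃ C : ℝ, 0 < C ∧ ∀ Y : ℝ, 0 ≤ Y →
      |∑' k : ℕ, fractProd (Y / ((k : ℝ) + 1) ^ 2) -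
        (riemannZeta (3 / 2)).re / Real.pi * √Y| ≤ C * Y ^ (2 / 5 : ℝ) := by
  have hsum : Summable fun k : ℕ => ((k : ℝ) + 1) ^ (-(6 / 5) : ℝ) := by
    have := (summable_nat_add_iff 1).2
        (Real.summable_nat_rpow.2 (show (-(6 / 5) : ℝ) < -1 by norm_num))
    simpa using this
  set S := ∑' k : ℕ, ((k : ℝ) + 1) ^ (-(6 / 5) : ℝ) with hS
  have hS0 : 0 ≤ S := tsum_nonneg fun k => by positivity
  refine ⟨2 ^ (2 / 5 : ℝ) * S + 5, by positivity, fun Y hY => ?_⟩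
  have hint := integrableOn_fractProd_div_sq hY
  have hint1 : IntegrableOn (fun u : ℝ => fractProd (Y / u ^ 2)) (Set.Ioi 1) :=
    hint.mono_set (Set.Ioi_subset_Ioi zero_le_one)
  have hint0 : IntegrableOn (fun u : ℝ => fractProd (Y / u ^ 2)) (Set.Ioc 0 1) :=
    hint.mono_set Set.Ioc_subset_Ioi_self
  have hsplit : ∫ u in Set.Ioi (0 : ℝ), fractProd (Y / u ^ 2) =
      (∫ u in Set.Ioc (0 : ℝ) 1, fractProd (Y / u ^ 2)) +
        ∫ u in Set.Ioi (1 : ℝ), fractProd (Y / u ^ 2) := by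
    rw [← Set.Ioc_union_Ioi_eq_Ioi zero_le_one]
    exact setIntegral_union (Set.Ioc_disjoint_Ioi le_rfl) measurableSet_Ioi hint0 hint1
  have hhead : |∫ u in Set.Ioc (0 : ℝ) 1, fractProd (Y / u ^ 2)| ≤ 5 * Y ^ (2 / 5 : ℝ) := by
    rw [abs_of_nonneg (integral_nonneg fun u => fractProd_nonneg _)]
    have hi : IntegrableOn (fun u : ℝ => Y ^ (2 / 5 : ℝ) * u ^ (-(4 / 5) : ℝ)) (Set.Ioc 0 1) := by
      have := intervalIntegral.intervalIntegrable_rpow' (a := 0) (b := 1)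
        (show (-1 : ℝ) < -(4 / 5) by norm_num)
      rw [intervalIntegrable_iff_integrableOn_Ioc_of_le zero_le_one] at this
      exact this.const_mul _
    calc _ ≤ ∫ u in Set.Ioc (0 : ℝ) 1, Y ^ (2 / 5 : ℝ) * u ^ (-(4 / 5) : ℝ) := by
          refine setIntegral_mono_on hint0 hi measurableSet_Ioc fun u hu => ?_
          have hu0 : 0 < u := hu.1
          refine (le_rpow_of_le_one_of_le (fractProd_nonneg _) (fractProd_le_one _)
            (fractProd_le_self (by positivity)) (θ := 2 / 5) (by norm_num)
            (by norm_num)).trans (le_of_eq ?_)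
          rw [Real.div_rpow hY (by positivity), div_eq_mul_inv, ← Real.rpow_natCast,
            ← Real.rpow_mul hu0.le, ← Real.rpow_neg hu0.le]
          norm_num
      _ = _ := by
          rw [integral_const_mul, ← intervalIntegral.integral_of_le zero_le_one,
            integral_rpow (Or.inl (by norm_num))]
          norm_num
          ring
  have hterm : ∀ k : ℕ, |fractProd (Y / ((k : ℝ) + 1) ^ 2) -
      ∫ u in (1 + (k : ℝ))..(1 + ((k + 1 : ℕ) : ℝ)), fractProd (Y / u ^ 2)| ≤
      (2 * Y) ^ (2 / 5 : ℝ) * ((k : ℝ) + 1) ^ (-(6 / 5) : ℝ) := by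
    intro k
    have hle : (1 + (k : ℝ)) ≤ 1 + ((k + 1 : ℕ) : ℝ) := by push_cast; linarith
    have hii : IntervalIntegrable (fun u : ℝ => fractProd (Y / u ^ 2)) volume
        (1 + (k : ℝ)) (1 + ((k + 1 : ℕ) : ℝ)) := by
      rw [intervalIntegrable_iff_integrableOn_Ioc_of_le hle]
      exact hint.mono_set fun u hu =>
        lt_of_le_of_lt (by positivity : (0 : ℝ) ≤ 1 + k) hu.1
    have h1 : fractProd (Y / ((k : ℝ) + 1) ^ 2) -
        ∫ u in (1 + (k : ℝ))..(1 + ((k + 1 : ℕ) : ℝ)), fractProd (Y / u ^ 2) =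
        ∫ u in (1 + (k : ℝ))..(1 + ((k + 1 : ℕ) : ℝ)),
          (fractProd (Y / ((k : ℝ) + 1) ^ 2) - fractProd (Y / u ^ 2)) := by
      rw [intervalIntegral.integral_sub (by simp) hii, intervalIntegral.integral_const]
      push_cast
      simp
    rw [h1]
    have h2 := intervalIntegral.norm_integral_le_of_norm_le_const
      (a := 1 + (k : ℝ)) (b := 1 + ((k + 1 : ℕ) : ℝ))
      (f := fun u : ℝ => fractProd (Y / ((k : ℝ) + 1) ^ 2) - fractProd (Y / u ^ 2))
      (C := (2 * Y) ^ (2 / 5 : ℝ) * ((k : ℝ) + 1) ^ (-(6 / 5) : ℝ)) fun u hu => ?_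
    · refine h2.trans (le_of_eq ?_)
      push_cast
      rw [show (1 + ((k : ℝ) + 1) - (1 + k)) = 1 by ring, abs_one, mul_one]
    · rw [Set.uIoc_of_le hle] at hu
      push_cast at hu
      exact abs_fractProd_div_sq_sub_le hY (by linarith [k.cast_nonneg (α := ℝ)])
        (by linarith [hu.1]) (by linarith [hu.2])
  have hlim1 : Filter.Tendsto (fun n : ℕ => ∑ k ∈ Finset.range n,
      fractProd (Y / ((k : ℝ) + 1) ^ 2)) Filter.atTop
      (nhds (∑' k : ℕ, fractProd (Y / ((k : ℝ) + 1) ^ 2))) :=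
    (summable_fractProd_div_sq hY).hasSum.tendsto_sum_nat
  have hlim2 : Filter.Tendsto (fun n : ℕ => ∫ u in (1 : ℝ)..(1 + (n : ℝ)), fractProd (Y / u ^ 2))
      Filter.atTop (nhds (∫ u in Set.Ioi (1 : ℝ), fractProd (Y / u ^ 2))) :=
    intervalIntegral_tendsto_integral_Ioi 1 hint1
      (Filter.tendsto_atTop_add_const_left _ _ tendsto_natCast_atTop_atTop)
  have htail : |∑' k : ℕ, fractProd (Y / ((k : ℝ) + 1) ^ 2) -
      ∫ u in Set.Ioi (1 : ℝ), fractProd (Y / u ^ 2)| ≤ (2 * Y) ^ (2 / 5 : ℝ) * S := by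
    refine le_of_tendsto (hlim1.sub hlim2).abs (Filter.Eventually.of_forall fun n => ?_)
    have hadj := intervalIntegral.sum_integral_adjacent_intervals (μ := volume)
      (f := fun u : ℝ => fractProd (Y / u ^ 2)) (a := fun k : ℕ => 1 + (k : ℝ)) (n := n)
      fun k _ => by
        rw [intervalIntegrable_iff_integrableOn_Ioc_of_le (by push_cast; linarith)]
        exact hint.mono_set fun u hu =>
          lt_of_le_of_lt (by positivity : (0 : ℝ) ≤ 1 + k) hu.1
    rw [Nat.cast_zero, add_zero] at hadj
    rw [← hadj, ← Finset.sum_sub_distrib]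
    calc _ ≤ ∑ k ∈ Finset.range n, (2 * Y) ^ (2 / 5 : ℝ) * ((k : ℝ) + 1) ^ (-(6 / 5) : ℝ) :=
          (Finset.abs_sum_le_sum_abs _ _).trans (Finset.sum_le_sum fun k _ => hterm k)
      _ = (2 * Y) ^ (2 / 5 : ℝ) * ∑ k ∈ Finset.range n, ((k : ℝ) + 1) ^ (-(6 / 5) : ℝ) := by
          rw [Finset.mul_sum]
      _ ≤ _ := by
          gcongr
          exact hsum.sum_le_tsum _ fun k _ => by positivity
  rw [← integral_fractProd_div_sq hY, hsplit]
  rw [Real.mul_rpow (by norm_num) hY] at htail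
  rw [abs_le] at *
  constructor <;> linarith [hhead.1, hhead.2, htail.1, htail.2]

theorem summable_of_multiplicative {F : ℕ → ℝ} (hF0 : F 0 = 0) (hF1 : F 1 = 1)
    (hmul : ∀ {m n : ℕ}, m.Coprime n → F (m * n) = F m * F n) (hnn : ∀ n, 0 ≤ F n)
    {u : ℕ → ℝ} (hu : Summable u) (hu0 : ∀ n, 0 ≤ u n)
    (hF3 : ∀ p : ℕ, p.Prime → ∀ k, F (p ^ (k + 3)) = 0)
    (hFu : ∀ p : ℕ, p.Prime → F p + F (p ^ 2) ≤ u p) : Summable F := by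
  have hfin : ∀ {p : ℕ}, p.Prime → ∀ k ∉ Finset.range 3, F (p ^ k) = 0 := by
    intro p hp k hk
    rw [Finset.mem_range, not_lt] at hk
    obtain ⟨j, rfl⟩ := Nat.exists_eq_add_of_le' hk
    exact hF3 p hp j
  apply summable_of_sum_range_le (c := Real.exp (∑' n, u n)) hnn
  intro N
  have h1 := (EulerProduct.summable_and_hasSum_smoothNumbers_prod_primesBelow_tsum hF1 hmul
    (fun {p} hp => summable_of_ne_finset_zero (s := Finset.range 3) fun k hk => by
      rw [hfin hp k hk, norm_zero]) N).2
  have h2 : HasSum (Set.indicator (N.smoothNumbers : Set ℕ) F)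
      (∏ p ∈ N.primesBelow, ∑' n : ℕ, F (p ^ n)) := hasSum_subtype_iff_indicator.1 h1
  calc ∑ i ∈ Finset.range N, F i
      ≤ ∑ i ∈ Finset.range N, Set.indicator (N.smoothNumbers : Set ℕ) F i := by
        refine Finset.sum_le_sum fun i hi => ?_
        rcases Nat.eq_zero_or_pos i with rfl | hi0
        · rw [hF0]; exact Set.indicator_nonneg (fun x _ => hnn x) _
        · rw [Set.indicator_of_mem (Nat.mem_smoothNumbers_of_lt hi0 (Finset.mem_range.1 hi))]
    _ ≤ ∏ p ∈ N.primesBelow, ∑' n : ℕ, F (p ^ n) :=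
        sum_le_hasSum _ (fun i _ => Set.indicator_nonneg (fun x _ => hnn x) _) h2
    _ ≤ ∏ p ∈ N.primesBelow, Real.exp (u p) := by
        refine Finset.prod_le_prod (fun p _ => tsum_nonneg fun k => hnn _) fun p hp => ?_
        have hp' := Nat.prime_of_mem_primesBelow hp
        rw [tsum_eq_sum (hfin hp')]
        simp only [Finset.sum_range_succ, Finset.range_zero, Finset.sum_empty, pow_zero, hF1,
            pow_one]
        linarith [hFu p hp', Real.add_one_le_exp (u p)]
    _ = Real.exp (∑ p ∈ N.primesBelow, u p) := (Real.exp_sum _ _).symm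
    _ ≤ Real.exp (∑' n, u n) := Real.exp_le_exp.2 (hu.sum_le_tsum _ fun n _ => hu0 n)

/-- The multiplicative function `μ²(n) ∏_{p ∣ n} (1 - 2 / p²)⁻¹`. -/
noncomputable def sqfWeight : ArithmeticFunction ℝ :=
  ((ArithmeticFunction.moebius : ArithmeticFunction ℝ).pmul
    (ArithmeticFunction.moebius : ArithmeticFunction ℝ)).pmul
    (ArithmeticFunction.prodPrimeFactors fun p : ℕ => (1 - 2 / (p : ℝ) ^ 2)⁻¹)

/-- The Möbius transform of `sqfWeight`. -/
noncomputable def sqfWeightTransform : ArithmeticFunction ℝ :=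
  (ArithmeticFunction.moebius : ArithmeticFunction ℝ) * sqfWeight

theorem isMultiplicative_sqfWeight : sqfWeight.IsMultiplicative :=
  (ArithmeticFunction.isMultiplicative_moebius.intCast.pmul
    ArithmeticFunction.isMultiplicative_moebius.intCast).pmul
    (ArithmeticFunction.IsMultiplicative.prodPrimeFactors _)

theorem isMultiplicative_sqfWeightTransform : sqfWeightTransform.IsMultiplicative :=
  ArithmeticFunction.isMultiplicative_moebius.intCast.mul isMultiplicative_sqfWeight

theorem sum_divisors_sqfWeightTransform (n : ℕ) :
    ∑ d ∈ n.divisors, sqfWeightTransform d = sqfWeight n := by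
  rw [← ArithmeticFunction.coe_zeta_mul_apply, sqfWeightTransform, ← mul_assoc,
    ArithmeticFunction.coe_zeta_mul_coe_moebius, one_mul]

theorem sqfWeight_apply {n : ℕ} (hn : n ≠ 0) :
    sqfWeight n = (ArithmeticFunction.moebius n : ℝ) ^ 2 *
      ∏ p ∈ n.primeFactors, (1 - 2 / (p : ℝ) ^ 2)⁻¹ := by
  simp [sqfWeight, ArithmeticFunction.prodPrimeFactors_apply hn, sq]

theorem sqfWeight_prime {p : ℕ} (hp : p.Prime) : sqfWeight p = (1 - 2 / (p : ℝ) ^ 2)⁻¹ := by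
  rw [sqfWeight_apply hp.ne_zero, ArithmeticFunction.moebius_apply_prime hp, hp.primeFactors]
  simp

theorem sqfWeight_prime_pow {p : ℕ} (hp : p.Prime) (k : ℕ) : sqfWeight (p ^ (k + 2)) = 0 := by
  rw [sqfWeight_apply (pow_ne_zero _ hp.ne_zero),
    ArithmeticFunction.moebius_apply_prime_pow hp (by omega)]
  simp

theorem sqfWeightTransform_prime_pow {p : ℕ} (hp : p.Prime) (k : ℕ) :
    sqfWeightTransform (p ^ (k + 1)) = sqfWeight (p ^ (k + 1)) - sqfWeight (p ^ k) := by
  rw [← sum_divisors_sqfWeightTransform, ← sum_divisors_sqfWeightTransform (p ^ k),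
    Nat.sum_divisors_prime_pow hp, Nat.sum_divisors_prime_pow hp, Finset.sum_range_succ _ (k + 1)]
  ring

theorem sqfWeightTransform_prime {p : ℕ} (hp : p.Prime) :
    sqfWeightTransform p = (1 - 2 / (p : ℝ) ^ 2)⁻¹ - 1 := by
  have := sqfWeightTransform_prime_pow hp 0
  rwa [zero_add, pow_one, pow_zero, isMultiplicative_sqfWeight.map_one, sqfWeight_prime hp] at this

theorem sqfWeightTransform_prime_sq {p : ℕ} (hp : p.Prime) :
    sqfWeightTransform (p ^ 2) = -(1 - 2 / (p : ℝ) ^ 2)⁻¹ := by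
  have := sqfWeightTransform_prime_pow hp 1
  rw [show 1 + 1 = 0 + 2 by rfl, sqfWeight_prime_pow hp, pow_one, sqfWeight_prime hp] at this
  simpa using this

theorem sqfWeightTransform_prime_pow_eq_zero {p : ℕ} (hp : p.Prime) (k : ℕ) :
    sqfWeightTransform (p ^ (k + 3)) = 0 := by
  have := sqfWeightTransform_prime_pow hp (k + 2)
  rw [sqfWeight_prime_pow hp, show k + 2 + 1 = k + 1 + 2 by ring, sqfWeight_prime_pow hp] at this
  simpa using this

theorem one_half_le_one_sub_two_div_sq {p : ℕ} (hp : p.Prime) : 1 / 2 ≤ 1 - 2 / (p : ℝ) ^ 2 := by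
  have h2 : (2 : ℝ) ≤ p := by exact_mod_cast hp.two_le
  have : 2 / (p : ℝ) ^ 2 ≤ 1 / 2 := by
    rw [div_le_div_iff₀ (by positivity) (by norm_num)]
    nlinarith
  linarith

theorem summable_abs_sqfWeightTransform_mul_rpow :
    Summable fun n : ℕ => |sqfWeightTransform n| * (n : ℝ) ^ (-(4 / 5) : ℝ) := by
  have hu : Summable fun n : ℕ => 6 * (n : ℝ) ^ (-(8 / 5) : ℝ) :=
    (Real.summable_nat_rpow.2 (by norm_num)).mul_left 6
  refine summable_of_multiplicative (by simp)
    (by simp [isMultiplicative_sqfWeightTransform.map_one]) (fun {m n} hmn => ?_)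
    (fun n => by positivity) hu (fun n => by positivity) (fun p hp k => ?_) fun p hp => ?_
  · rw [isMultiplicative_sqfWeightTransform.map_mul_of_coprime hmn, abs_mul, Nat.cast_mul,
      Real.mul_rpow (Nat.cast_nonneg _) (Nat.cast_nonneg _)]
    ring
  · rw [sqfWeightTransform_prime_pow_eq_zero hp]
    simp
  · have hp1 : (1 : ℝ) ≤ p := by exact_mod_cast hp.one_lt.le
    have hp0 : (0 : ℝ) < p := by linarith
    have h1 := one_half_le_one_sub_two_div_sq hp
    have h0 : 0 < 1 - 2 / (p : ℝ) ^ 2 := by linarith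
    have hinv : (1 - 2 / (p : ℝ) ^ 2)⁻¹ ≤ 2 := by
      rw [inv_le_comm₀ h0 (by norm_num)]
      linarith
    have hb1 : |sqfWeightTransform p| ≤ 4 * (p : ℝ) ^ (-2 : ℝ) := by
      have he : sqfWeightTransform p = 2 / (p : ℝ) ^ 2 * (1 - 2 / (p : ℝ) ^ 2)⁻¹ := by
        have h2 : 2 / (p : ℝ) ^ 2 * (1 - 2 / (p : ℝ) ^ 2)⁻¹ =
            (1 - (1 - 2 / (p : ℝ) ^ 2)) * (1 - 2 / (p : ℝ) ^ 2)⁻¹ := by ring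
        rw [sqfWeightTransform_prime hp, h2, sub_mul, mul_inv_cancel₀ h0.ne', one_mul]
      rw [he, abs_of_nonneg (by positivity), show (-2 : ℝ) = -((2 : ℕ) : ℝ) by norm_num,
        Real.rpow_neg hp0.le, Real.rpow_natCast]
      calc _ ≤ 2 / (p : ℝ) ^ 2 * 2 := by gcongr
        _ = _ := by ring
    have hb2 : |sqfWeightTransform (p ^ 2)| ≤ 2 := by
      rw [sqfWeightTransform_prime_sq hp, abs_neg, abs_of_nonneg (by positivity)]
      exact hinv
    have h2 : (p : ℝ) ^ (-2 : ℝ) * (p : ℝ) ^ (-(4 / 5) : ℝ) ≤ (p : ℝ) ^ (-(8 / 5) : ℝ) := by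
      rw [← Real.rpow_add hp0]
      exact Real.rpow_le_rpow_of_exponent_le hp1 (by norm_num)
    have h3 : (((p ^ 2 : ℕ)) : ℝ) ^ (-(4 / 5) : ℝ) = (p : ℝ) ^ (-(8 / 5) : ℝ) := by
      rw [Nat.cast_pow, ← Real.rpow_natCast, ← Real.rpow_mul hp0.le]
      norm_num
    rw [h3]
    calc _ ≤ 4 * (p : ℝ) ^ (-2 : ℝ) * (p : ℝ) ^ (-(4 / 5) : ℝ) + 2 * (p : ℝ) ^ (-(8 / 5) : ℝ) := by
          gcongr
      _ ≤ _ := by linarith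

theorem summable_abs_sqfWeightTransform_div :
    Summable fun n : ℕ => |sqfWeightTransform n / n| := by
  refine Summable.of_nonneg_of_le (fun n => abs_nonneg _) (fun n => ?_)
    summable_abs_sqfWeightTransform_mul_rpow
  rw [abs_div, Nat.abs_cast, div_eq_mul_inv]
  rcases Nat.eq_zero_or_pos n with rfl | hn
  · simp
  have hn1 : (1 : ℝ) ≤ n := by exact_mod_cast hn
  rw [← Real.rpow_neg_one]
  gcongr
  norm_num

theorem hasProd_sqfWeightTransform_div :
    HasProd (fun p : Nat.Primes => 1 + ((1 - 2 / ((p : ℕ) : ℝ) ^ 2)⁻¹ - 1) / ((p : ℕ) : ℝ) +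
      -(1 - 2 / ((p : ℕ) : ℝ) ^ 2)⁻¹ / ((p : ℕ) : ℝ) ^ 2) (∑' n : ℕ, sqfWeightTransform n / n) := by
  have h := EulerProduct.eulerProduct_hasProd (f := fun n : ℕ => sqfWeightTransform n / n)
    (by simp [isMultiplicative_sqfWeightTransform.map_one])
    (fun {m n} hmn => by
      rw [isMultiplicative_sqfWeightTransform.map_mul_of_coprime hmn, Nat.cast_mul]
      exact mul_div_mul_comm _ _ _ _) summable_abs_sqfWeightTransform_div (by simp)
  convert! h using 1
  ext p
  have hp := p.2
  rw [tsum_eq_sum (s := Finset.range 3) fun k hk => ?_]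
  · simp only [Finset.sum_range_succ, Finset.range_zero, Finset.sum_empty, pow_zero, pow_one,
      sqfWeightTransform_prime_sq hp, sqfWeightTransform_prime hp,
      isMultiplicative_sqfWeightTransform.map_one]
    simp
  · rw [Finset.mem_range, not_lt] at hk
    obtain ⟨j, rfl⟩ := Nat.exists_eq_add_of_le' hk
    rw [sqfWeightTransform_prime_pow_eq_zero hp, zero_div]

/-- The function `n ↦ 1_{(n, g) = 1} μ(n) τ(n) / n²`. -/
noncomputable def coprimeMoebiusTau (g n : ℕ) : ℝ :=
  if n.Coprime g then (ArithmeticFunction.moebius n : ℝ) * n.divisors.card / (n : ℝ) ^ 2 else 0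

theorem summable_abs_coprimeMoebiusTau (g : ℕ) : Summable fun n => |coprimeMoebiusTau g n| := by
  obtain ⟨C, hC0, hC⟩ := exists_card_divisors_le_rpow (1 / 2) (by norm_num)
  have hs : Summable fun n : ℕ => C * (n : ℝ) ^ (-(3 / 2) : ℝ) :=
    (Real.summable_nat_rpow.2 (by norm_num)).mul_left C
  refine Summable.of_nonneg_of_le (fun n => abs_nonneg _) (fun n => ?_) hs
  unfold coprimeMoebiusTau
  rcases Nat.eq_zero_or_pos n with rfl | hn
  · simp only [ArithmeticFunction.map_zero]
    simp
  have hn0 : (0 : ℝ) < n := by exact_mod_cast hn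
  split_ifs
  · rw [abs_div, abs_mul, abs_of_nonneg (by positivity : (0 : ℝ) ≤ (n : ℝ) ^ 2), Nat.abs_cast]
    have h1 : |(ArithmeticFunction.moebius n : ℝ)| ≤ 1 := by
      exact_mod_cast ArithmeticFunction.abs_moebius_le_one (n := n)
    calc _ ≤ 1 * (C * (n : ℝ) ^ (1 / 2 : ℝ)) / (n : ℝ) ^ 2 := by
          gcongr
          exact hC n hn.ne'
      _ = C * (n : ℝ) ^ (-(3 / 2) : ℝ) := by
          rw [one_mul, mul_div_assoc, ← Real.rpow_natCast, ← Real.rpow_sub hn0]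
          norm_num
  · rw [abs_zero]; positivity

theorem hasProd_coprimeMoebiusTau (g : ℕ) :
    HasProd (fun p : Nat.Primes => if (p : ℕ) ∣ g then 1 else 1 - 2 / ((p : ℕ) : ℝ) ^ 2)
      (∑' n, coprimeMoebiusTau g n) := by
  have h := EulerProduct.eulerProduct_hasProd (f := coprimeMoebiusTau g)
    (by simp [coprimeMoebiusTau]) (fun {m n} hmn => by
      unfold coprimeMoebiusTau
      rw [ArithmeticFunction.isMultiplicative_moebius.map_mul_of_coprime hmn,
        hmn.card_divisors_mul]
      simp only [Nat.coprime_mul_iff_left]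
      by_cases h1 : m.Coprime g
      · by_cases h2 : n.Coprime g
        · rw [if_pos ⟨h1, h2⟩, if_pos h1, if_pos h2]
          push_cast
          ring
        · rw [if_neg fun h => h2 h.2, if_neg h2, mul_zero]
      · rw [if_neg fun h => h1 h.1, if_neg h1, zero_mul]) (summable_abs_coprimeMoebiusTau g)
          (by simp [coprimeMoebiusTau])
  convert! h using 1
  ext p
  have hp := p.2
  rw [tsum_eq_sum (s := Finset.range 2) fun k hk => ?_]
  · simp only [Finset.sum_range_succ, Finset.range_zero, Finset.sum_empty, pow_zero, pow_one,
      coprimeMoebiusTau, ArithmeticFunction.moebius_apply_prime hp, hp.coprime_iff_not_dvd,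
      hp.divisors]
    rw [Finset.card_pair hp.one_lt.ne]
    by_cases h1 : (p : ℕ) ∣ g
    · simp [h1]
    · simp [h1]
      ring
  · rw [Finset.mem_range, not_lt] at hk
    obtain ⟨j, rfl⟩ := Nat.exists_eq_add_of_le' hk
    rw [coprimeMoebiusTau, ArithmeticFunction.moebius_apply_prime_pow hp (by omega)]
    simp

theorem tsum_coprimeMoebiusTau {g : ℕ} (hg : g ≠ 0) :
    ∑' n, coprimeMoebiusTau g n =
      (∑' n, coprimeMoebiusTau 1 n) * ∏ p ∈ g.primeFactors, (1 - 2 / (p : ℝ) ^ 2)⁻¹ := by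
  have h1 := hasProd_coprimeMoebiusTau 1
  have hg' := hasProd_coprimeMoebiusTau g
  set i : g.primeFactors ↪ Nat.Primes :=
    ⟨fun p => ⟨p.1, Nat.prime_of_mem_primeFactors p.2⟩, fun a b h =>
      Subtype.ext (congrArg (fun p : Nat.Primes => (p : ℕ)) h)⟩ with hi
  set s : Finset Nat.Primes := g.primeFactors.attach.map i with hs
  have hfin : HasProd (fun p : Nat.Primes => if (p : ℕ) ∣ g then 1 - 2 / ((p : ℕ) : ℝ) ^ 2 else 1)
      (∏ p ∈ s, if (p : ℕ) ∣ g then 1 - 2 / ((p : ℕ) : ℝ) ^ 2 else 1) :=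
    hasProd_prod_of_ne_finset_one fun p hp => by
      have : ¬ (p : ℕ) ∣ g := fun h => hp (by
        exact Finset.mem_map.2 ⟨⟨p, Nat.mem_primeFactors.2 ⟨p.2, h, hg⟩⟩,
          Finset.mem_attach _ _, rfl⟩)
      simp [this]
  have hval : (∏ p ∈ s, if (p : ℕ) ∣ g then 1 - 2 / ((p : ℕ) : ℝ) ^ 2 else 1) =
      ∏ p ∈ g.primeFactors, (1 - 2 / (p : ℝ) ^ 2) := by
    rw [hs, Finset.prod_map, ← Finset.prod_attach g.primeFactors]
    exact Finset.prod_congr rfl fun p _ => if_pos (Nat.dvd_of_mem_primeFactors p.2)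
  rw [hval] at hfin
  have hmul := hg'.mul hfin
  have heq : (fun p : Nat.Primes => (if (p : ℕ) ∣ g then 1 else 1 - 2 / ((p : ℕ) : ℝ) ^ 2) *
      if (p : ℕ) ∣ g then 1 - 2 / ((p : ℕ) : ℝ) ^ 2 else 1) =
      fun p : Nat.Primes => if (p : ℕ) ∣ 1 then 1 else 1 - 2 / ((p : ℕ) : ℝ) ^ 2 := by
    ext p
    have : ¬ (p : ℕ) ∣ 1 := p.2.one_lt.ne' ∘ Nat.dvd_one.1
    rw [if_neg this]
    split_ifs <;> ring
  rw [heq] at hmul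
  rw [h1.unique hmul, Finset.prod_inv_distrib, mul_assoc, mul_inv_cancel₀, mul_one]
  refine Finset.prod_ne_zero_iff.2 fun p hp => ?_
  have := one_half_le_one_sub_two_div_sq (Nat.prime_of_mem_primeFactors hp)
  exact (by linarith : 0 < 1 - 2 / (p : ℝ) ^ 2).ne'

theorem tsum_coprimeMoebiusTau_mul_tsum :
    (∑' n, coprimeMoebiusTau 1 n) * ∑' n : ℕ, sqfWeightTransform n / n =
      ∏' p : Nat.Primes, (1 - 3 / ((p : ℕ) : ℝ) ^ 2 + 2 / ((p : ℕ) : ℝ) ^ 3) := by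
  have h := (hasProd_coprimeMoebiusTau 1).mul hasProd_sqfWeightTransform_div
  rw [← h.tprod_eq]
  congr 1
  ext p
  have : ¬ (p : ℕ) ∣ 1 := p.2.one_lt.ne' ∘ Nat.dvd_one.1
  rw [if_neg this]
  have h1 := one_half_le_one_sub_two_div_sq p.2
  have h0 : 1 - 2 / ((p : ℕ) : ℝ) ^ 2 ≠ 0 :=
    (by linarith : 0 < 1 - 2 / ((p : ℕ) : ℝ) ^ 2).ne'
  have hp0 : ((p : ℕ) : ℝ) ≠ 0 := by exact_mod_cast p.2.ne_zero
  generalize ((p : ℕ) : ℝ) = x at *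
  have e : (1 - 2 / x ^ 2) * (1 + ((1 - 2 / x ^ 2)⁻¹ - 1) / x + -(1 - 2 / x ^ 2)⁻¹ / x ^ 2) =
      (1 - 2 / x ^ 2) + (1 - (1 - 2 / x ^ 2)) / x - 1 / x ^ 2 := by
    generalize 1 - 2 / x ^ 2 = y at *
    field_simp
    ring
  rw [e]
  field_simp
  ring

theorem tsum_eq_tsum_sum_divisorsAntidiagonal {F : ℕ × ℕ → ℝ} (hF : Summable F)
    (h0 : ∀ p : ℕ × ℕ, p.1 * p.2 = 0 → F p = 0) :
    ∑' p, F p = ∑' n : ℕ, ∑ p ∈ n.divisorsAntidiagonal, F p := by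
  have h := (hF.hasSum.tsum_fiberwise fun p : ℕ × ℕ => p.1 * p.2).tsum_eq
  rw [← h]
  refine tsum_congr fun n => ?_
  rcases Nat.eq_zero_or_pos n with rfl | hn
  · rw [Nat.divisorsAntidiagonal_zero, Finset.sum_empty]
    exact (tsum_congr fun p : (fun p : ℕ × ℕ => p.1 * p.2) ⁻¹' {0} => h0 p.1 p.2).trans tsum_zero
  · rw [← Finset.tsum_subtype]
    have : (fun p : ℕ × ℕ => p.1 * p.2) ⁻¹' {n} = {p | p ∈ n.divisorsAntidiagonal} := by
      ext p
      simp [hn.ne']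
    rw [this]
    rfl

theorem moebius_mul_eq_ite (m n : ℕ) :
    ArithmeticFunction.moebius (m * n) =
      if m.Coprime n then ArithmeticFunction.moebius m * ArithmeticFunction.moebius n else 0 := by
  split_ifs with h
  · exact ArithmeticFunction.isMultiplicative_moebius.map_mul_of_coprime h
  · exact ArithmeticFunction.moebius_eq_zero_of_not_squarefree fun hs =>
      h (Nat.coprime_of_squarefree_mul hs)

theorem summable_mul_mul_of_nonneg {f g h : ℕ → ℝ} (hf : Summable f) (hg : Summable g)
    (hh : Summable h) (hf0 : 0 ≤ f) (hg0 : 0 ≤ g) (hh0 : 0 ≤ h) :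
    Summable fun t : ℕ × ℕ × ℕ => f t.1 * (g t.2.1 * h t.2.2) :=
  hf.mul_of_nonneg (hg.mul_of_nonneg hh hg0 hh0) hf0 fun _ => mul_nonneg (hg0 _) (hh0 _)

/-- The summand attached to a common factor `g` and two coprime cofactors. -/
noncomputable def gcdSummand (X : ℝ) (t : ℕ × ℕ × ℕ) : ℝ :=
  if t.2.1.Coprime t.2.2 then
    (ArithmeticFunction.moebius (t.1 * t.2.1) : ℝ) * ArithmeticFunction.moebius (t.1 * t.2.2) *
      fractProd (X / (t.1 : ℝ) ^ 2) / ((t.2.1 : ℝ) * t.2.2) ^ 2 else 0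

theorem abs_gcdSummand_le {X θ : ℝ} (hX : 0 ≤ X) (hθ0 : 0 ≤ θ) (hθ1 : θ ≤ 1) (g a b : ℕ) :
    |gcdSummand X (g, a, b)| ≤ (X / (g : ℝ) ^ 2) ^ θ / ((a : ℝ) * b) ^ 2 := by
  have hm : ∀ n : ℕ, |(ArithmeticFunction.moebius n : ℝ)| ≤ 1 := fun n => by
    exact_mod_cast ArithmeticFunction.abs_moebius_le_one (n := n)
  have hY : 0 ≤ X / (g : ℝ) ^ 2 := by positivity
  unfold gcdSummand
  split_ifs
  · rw [abs_div, abs_mul, abs_mul, abs_of_nonneg (fractProd_nonneg _),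
      abs_of_nonneg (by positivity : 0 ≤ ((a : ℝ) * b) ^ 2)]
    refine div_le_div_of_nonneg_right ?_ (by positivity)
    calc _ ≤ 1 * 1 * fractProd (X / (g : ℝ) ^ 2) := by
          gcongr
          · exact fractProd_nonneg _
          · exact hm _
          · exact hm _
      _ ≤ _ := by
          rw [one_mul, one_mul]
          exact le_rpow_of_le_one_of_le (fractProd_nonneg _) (fractProd_le_one _)
            (fractProd_le_self hY) hθ0 hθ1
  · rw [abs_zero]
    positivity

theorem gcdSummand_eq_zero {X : ℝ} {g a b : ℕ} (h : g * (a * b) = 0) :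
    gcdSummand X (g, a, b) = 0 := by
  unfold gcdSummand
  rcases Nat.mul_eq_zero.1 h with rfl | h
  · simp
  rcases Nat.mul_eq_zero.1 h with rfl | rfl <;> simp

theorem abs_gcdSummand_le_rpow {X θ : ℝ} (hX : 0 ≤ X) (hθ0 : 0 ≤ θ) (hθ1 : θ ≤ 1) {g a b M : ℕ}
    (hM : 0 < M) (h : M ≤ g * a ∨ M ≤ g * b) :
    |gcdSummand X (g, a, b)| ≤ X ^ θ * (M : ℝ) ^ (-(1 / 2) : ℝ) *
      ((g : ℝ) ^ (-(2 * θ - 1 / 2)) * ((a : ℝ) ^ (-(3 / 2) : ℝ) * (b : ℝ) ^ (-(3 / 2) : ℝ))) := by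
  by_cases h0 : g * (a * b) = 0
  · rw [gcdSummand_eq_zero h0, abs_zero]
    positivity
  have hg : 0 < g := Nat.pos_of_ne_zero fun h => h0 (by simp [h])
  have ha : 0 < a := Nat.pos_of_ne_zero fun h => h0 (by simp [h])
  have hb : 0 < b := Nat.pos_of_ne_zero fun h => h0 (by simp [h])
  have hgab : (M : ℝ) ≤ (g : ℝ) * (a * b) := by
    have : M ≤ g * (a * b) := by
      rcases h with h | h
      · exact h.trans (Nat.mul_le_mul_left g (Nat.le_mul_of_pos_right a hb))
      · exact h.trans (Nat.mul_le_mul_left g (Nat.le_mul_of_pos_left b ha))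
    exact_mod_cast this
  have hg' : (0 : ℝ) < g := by exact_mod_cast hg
  have ha' : (0 : ℝ) < a := by exact_mod_cast ha
  have hb' : (0 : ℝ) < b := by exact_mod_cast hb
  have hM' : (0 : ℝ) < M := by exact_mod_cast hM
  refine (abs_gcdSummand_le hX hθ0 hθ1 g a b).trans ?_
  have key : 1 ≤ (M : ℝ) ^ (-(1 / 2) : ℝ) * ((g : ℝ) ^ (1 / 2 : ℝ) *
      ((a : ℝ) ^ (1 / 2 : ℝ) * (b : ℝ) ^ (1 / 2 : ℝ))) := by
    rw [← Real.mul_rpow ha'.le hb'.le, ← Real.mul_rpow hg'.le (by positivity),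
      Real.rpow_neg hM'.le, ← div_eq_inv_mul, one_le_div (by positivity)]
    exact Real.rpow_le_rpow hM'.le hgab (by norm_num)
  have e1 : (X / (g : ℝ) ^ 2) ^ θ = X ^ θ * (g : ℝ) ^ (-(2 * θ)) := by
    rw [Real.div_rpow hX (by positivity), Real.rpow_neg hg'.le, ← Real.rpow_natCast,
      ← Real.rpow_mul hg'.le, div_eq_mul_inv]
    norm_num
  have e2 : (g : ℝ) ^ (-(2 * θ - 1 / 2)) = (g : ℝ) ^ (-(2 * θ)) * (g : ℝ) ^ (1 / 2 : ℝ) := by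
    rw [← Real.rpow_add hg']; ring_nf
  have e3 : ∀ y : ℝ, 0 < y → y ^ (-(3 / 2) : ℝ) = (y ^ 2)⁻¹ * y ^ (1 / 2 : ℝ) := fun y hy => by
    rw [← Real.rpow_natCast, ← Real.rpow_neg hy.le, ← Real.rpow_add hy]; norm_num
  rw [e1, e2, e3 _ ha', e3 _ hb']
  calc _ = X ^ θ * (g : ℝ) ^ (-(2 * θ)) * (((a : ℝ) ^ 2)⁻¹ * ((b : ℝ) ^ 2)⁻¹) * 1 := by
        rw [mul_pow, mul_one, div_eq_mul_inv, mul_inv]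
    _ ≤ X ^ θ * (g : ℝ) ^ (-(2 * θ)) * (((a : ℝ) ^ 2)⁻¹ * ((b : ℝ) ^ 2)⁻¹) * _ :=
        mul_le_mul_of_nonneg_left key (by positivity)
    _ = _ := by ring

theorem summable_rpow_triple {θ : ℝ} (hθ : 3 / 4 < θ) :
    Summable fun t : ℕ × ℕ × ℕ => (t.1 : ℝ) ^ (-(2 * θ - 1 / 2)) *
      ((t.2.1 : ℝ) ^ (-(3 / 2) : ℝ) * (t.2.2 : ℝ) ^ (-(3 / 2) : ℝ)) :=
  summable_mul_mul_of_nonneg (f := fun n : ℕ => (n : ℝ) ^ (-(2 * θ - 1 / 2)))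
    (g := fun n : ℕ => (n : ℝ) ^ (-(3 / 2) : ℝ)) (h := fun n : ℕ => (n : ℝ) ^ (-(3 / 2) : ℝ))
    (Real.summable_nat_rpow.2 (by linarith))
    (Real.summable_nat_rpow.2 (by norm_num)) (Real.summable_nat_rpow.2 (by norm_num))
    (fun n => by positivity) (fun n => by positivity) (fun n => by positivity)

theorem summable_gcdSummand {X : ℝ} (hX : 0 ≤ X) : Summable (gcdSummand X) := by
  refine Summable.of_norm_bounded ((summable_rpow_triple (θ := 4 / 5) (by norm_num)).mul_left
    (X ^ (4 / 5 : ℝ))) fun ⟨g, a, b⟩ => ?_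
  rw [Real.norm_eq_abs]
  by_cases h0 : g * (a * b) = 0
  · rw [gcdSummand_eq_zero h0, abs_zero]
    positivity
  have := abs_gcdSummand_le_rpow (θ := 4 / 5) (M := 1) (g := g) (a := a) (b := b) hX (by norm_num)
    (by norm_num) one_pos (Or.inl (Nat.one_le_iff_ne_zero.2 fun h =>
      h0 (by rw [← mul_assoc, h, zero_mul])))
  simpa using this

/-- The triples `(gcd(d₁, d₂), d₁ / gcd(d₁, d₂), d₂ / gcd(d₁, d₂))` with `1 ≤ d₁, d₂ ≤ N`. -/
def gcdTriples (N : ℕ) : Finset (ℕ × ℕ × ℕ) :=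
  (Finset.Icc 1 N ×ˢ Finset.Icc 1 N).image fun p =>
    (p.1.gcd p.2, p.1 / p.1.gcd p.2, p.2 / p.1.gcd p.2)

theorem sum_gcdTriples (N : ℕ) (F : ℕ × ℕ × ℕ → ℝ) :
    ∑ t ∈ gcdTriples N, F t = ∑ p ∈ Finset.Icc 1 N ×ˢ Finset.Icc 1 N,
      F (p.1.gcd p.2, p.1 / p.1.gcd p.2, p.2 / p.1.gcd p.2) := by
  refine Finset.sum_image fun p _ r _ h => ?_
  simp only [Prod.mk.injEq] at h
  obtain ⟨h1, h2, h3⟩ := h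
  ext
  · rw [← Nat.mul_div_cancel' (Nat.gcd_dvd_left p.1 p.2), h2, h1,
      Nat.mul_div_cancel' (Nat.gcd_dvd_left r.1 r.2)]
  · rw [← Nat.mul_div_cancel' (Nat.gcd_dvd_right p.1 p.2), h3, h1,
      Nat.mul_div_cancel' (Nat.gcd_dvd_right r.1 r.2)]

theorem mem_gcdTriples {N g a b : ℕ} (hg : 0 < g) (ha : 0 < a) (hb : 0 < b) (hab : a.Coprime b)
    (hga : g * a ≤ N) (hgb : g * b ≤ N) : (g, a, b) ∈ gcdTriples N := by
  refine Finset.mem_image.2 ⟨(g * a, g * b), ?_, ?_⟩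
  · rw [Finset.mem_product, Finset.mem_Icc, Finset.mem_Icc]
    exact ⟨⟨Nat.mul_pos hg ha, hga⟩, Nat.mul_pos hg hb, hgb⟩
  · have : (g * a).gcd (g * b) = g := by rw [Nat.gcd_mul_left, hab.gcd_eq_one, mul_one]
    simp only [this, Nat.mul_div_cancel_left _ hg]

theorem gcdTriples_subset (N : ℕ) :
    gcdTriples N ⊆ Finset.Icc 1 N ×ˢ (Finset.Icc 1 N ×ˢ Finset.Icc 1 N) := by
  refine Finset.image_subset_iff.2 fun p hp => ?_
  simp only [Finset.mem_product, Finset.mem_Icc] at hp ⊢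
  obtain ⟨⟨h1, h2⟩, h3, h4⟩ := hp
  have hg := Nat.gcd_pos_of_pos_left p.2 h1
  exact ⟨⟨hg, (Nat.gcd_le_left _ h1).trans h2⟩,
    ⟨Nat.div_pos (Nat.gcd_le_left _ h1) hg, (Nat.div_le_self _ _).trans h2⟩,
    Nat.div_pos (Nat.gcd_le_right _ h3) hg, (Nat.div_le_self _ _).trans h4⟩

theorem abs_tsum_gcdSummand_sub_le {X θ : ℝ} (hX : 0 ≤ X) (hθ : 3 / 4 < θ) (hθ1 : θ ≤ 1) (N : ℕ) :
    |∑' t, gcdSummand X t - ∑ t ∈ gcdTriples N, gcdSummand X t| ≤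
      X ^ θ * ((N + 1 : ℕ) : ℝ) ^ (-(1 / 2) : ℝ) * ∑' t : ℕ × ℕ × ℕ,
        (t.1 : ℝ) ^ (-(2 * θ - 1 / 2)) *
          ((t.2.1 : ℝ) ^ (-(3 / 2) : ℝ) * (t.2.2 : ℝ) ^ (-(3 / 2) : ℝ)) := by
  have h1 := (summable_gcdSummand hX).hasSum
  have h2 : HasSum (fun t => if t ∈ gcdTriples N then gcdSummand X t else 0)
      (∑ t ∈ gcdTriples N, gcdSummand X t) := by
    rw [← Finset.sum_congr rfl fun t ht => if_pos ht]
    exact hasSum_sum_of_ne_finset_zero fun t ht => if_neg ht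
  have h3 := (summable_rpow_triple hθ).hasSum.mul_left
    (X ^ θ * ((N + 1 : ℕ) : ℝ) ^ (-(1 / 2) : ℝ))
  refine (h1.sub h2).norm_le_of_bounded h3 fun ⟨g, a, b⟩ => ?_
  rw [Real.norm_eq_abs]
  by_cases ht : (g, a, b) ∈ gcdTriples N
  · rw [if_pos ht, sub_self, abs_zero]
    positivity
  rw [if_neg ht, sub_zero]
  by_cases hab : a.Coprime b
  swap
  · rw [gcdSummand, if_neg hab, abs_zero]
    positivity
  by_cases h0 : g * (a * b) = 0
  · rw [gcdSummand_eq_zero h0, abs_zero]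
    positivity
  refine abs_gcdSummand_le_rpow hX (by linarith) hθ1 N.succ_pos ?_
  by_contra! h
  exact ht (mem_gcdTriples (Nat.pos_of_ne_zero fun h => h0 (by simp [h]))
    (Nat.pos_of_ne_zero fun h => h0 (by simp [h])) (Nat.pos_of_ne_zero fun h => h0 (by simp [h]))
    hab (Nat.lt_succ_iff.1 h.1) (Nat.lt_succ_iff.1 h.2))

theorem tsum_gcdSummand_fst {X : ℝ} (hX : 0 ≤ X) (g : ℕ) :
    ∑' p : ℕ × ℕ, gcdSummand X (g, p) =
      (∑' n, coprimeMoebiusTau 1 n) * (sqfWeight g * fractProd (X / (g : ℝ) ^ 2)) := by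
  rcases Nat.eq_zero_or_pos g with rfl | hg
  · rw [ArithmeticFunction.map_zero, zero_mul, mul_zero]
    exact (tsum_congr fun p => gcdSummand_eq_zero (zero_mul _)).trans tsum_zero
  have hs : Summable fun p : ℕ × ℕ => gcdSummand X (g, p) := (summable_gcdSummand hX).prod_factor g
  rw [tsum_eq_tsum_sum_divisorsAntidiagonal hs fun p hp =>
    gcdSummand_eq_zero (by rw [hp, mul_zero])]
  have h : ∀ n : ℕ, ∑ p ∈ n.divisorsAntidiagonal, gcdSummand X (g, p) =
      (ArithmeticFunction.moebius g : ℝ) ^ 2 * fractProd (X / (g : ℝ) ^ 2) *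
        coprimeMoebiusTau g n := by
    intro n
    have h' : ∀ p ∈ n.divisorsAntidiagonal, gcdSummand X (g, p) =
        (ArithmeticFunction.moebius g : ℝ) ^ 2 * fractProd (X / (g : ℝ) ^ 2) *
          if n.Coprime g then (ArithmeticFunction.moebius n : ℝ) / (n : ℝ) ^ 2 else 0 := by
      rintro ⟨a, b⟩ hp
      obtain ⟨rfl, -⟩ := Nat.mem_divisorsAntidiagonal.1 hp
      simp only [gcdSummand, moebius_mul_eq_ite, Nat.coprime_mul_iff_left]
      by_cases h1 : a.Coprime b
      · by_cases h2 : a.Coprime g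
        · by_cases h3 : b.Coprime g
          · rw [if_pos h1, if_pos h1, if_pos h2.symm, if_pos h3.symm, if_pos ⟨h2, h3⟩]
            push_cast
            ring
          · rw [if_neg (fun h => h3 h.symm : ¬ g.Coprime b),
              if_neg (fun h => h3 h.2 : ¬ (a.Coprime g ∧ b.Coprime g))]
            simp
        · rw [if_neg (fun h => h2 h.symm : ¬ g.Coprime a),
            if_neg (fun h => h2 h.1 : ¬ (a.Coprime g ∧ b.Coprime g))]
          simp
      · rw [if_neg h1, if_neg h1]
        simp
    rw [Finset.sum_congr rfl h', Finset.sum_const, ← Nat.map_div_right_divisors, Finset.card_map,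
      nsmul_eq_mul, coprimeMoebiusTau]
    split_ifs <;> ring
  rw [tsum_congr h, tsum_mul_left, tsum_coprimeMoebiusTau hg.ne', sqfWeight_apply hg.ne']
  ring

theorem tsum_sqfWeight_mul_fractProd {X : ℝ} (hX : 0 ≤ X) :
    ∑' g : ℕ, sqfWeight g * fractProd (X / (g : ℝ) ^ 2) =
      ∑' m : ℕ, sqfWeightTransform m * ∑' k : ℕ,
        fractProd (X / (m : ℝ) ^ 2 / ((k : ℝ) + 1) ^ 2) := by
  have hF : Summable fun p : ℕ × ℕ =>
      sqfWeightTransform p.1 * fractProd (X / ((p.1 : ℝ) * p.2) ^ 2) := by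
    have hs : Summable fun p : ℕ × ℕ => X ^ (3 / 5 : ℝ) *
        (|sqfWeightTransform p.1| * (p.1 : ℝ) ^ (-(4 / 5) : ℝ) * (p.2 : ℝ) ^ (-(6 / 5) : ℝ)) :=
      (summable_abs_sqfWeightTransform_mul_rpow.mul_of_nonneg
        (Real.summable_nat_rpow.2 (by norm_num)) (fun n => by positivity)
        fun n => by positivity).mul_left _
    refine Summable.of_norm_bounded hs fun ⟨m, k⟩ => ?_
    dsimp only
    rcases Nat.eq_zero_or_pos m with rfl | hm
    · simp
    have hm1 : (1 : ℝ) ≤ m := by exact_mod_cast hm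
    have hm0 : (0 : ℝ) < m := by linarith
    have hk0 : (0 : ℝ) ≤ k := Nat.cast_nonneg k
    rw [Real.norm_eq_abs, abs_mul, abs_of_nonneg (fractProd_nonneg _)]
    have h1 : fractProd (X / ((m : ℝ) * k) ^ 2) ≤ (X / ((m : ℝ) * k) ^ 2) ^ (3 / 5 : ℝ) :=
      le_rpow_of_le_one_of_le (fractProd_nonneg _) (fractProd_le_one _)
        (fractProd_le_self (by positivity)) (by norm_num) (by norm_num)
    have h2 : (X / ((m : ℝ) * k) ^ 2) ^ (3 / 5 : ℝ) =
        X ^ (3 / 5 : ℝ) * ((m : ℝ) ^ (-(6 / 5) : ℝ) * (k : ℝ) ^ (-(6 / 5) : ℝ)) := by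
      rw [Real.div_rpow hX (by positivity), ← Real.mul_rpow hm0.le hk0,
        Real.rpow_neg (by positivity), ← Real.rpow_natCast,
        ← Real.rpow_mul (by positivity), div_eq_mul_inv]
      norm_num
    have h3 : (m : ℝ) ^ (-(6 / 5) : ℝ) ≤ (m : ℝ) ^ (-(4 / 5) : ℝ) :=
      Real.rpow_le_rpow_of_exponent_le hm1 (by norm_num)
    calc _ ≤ |sqfWeightTransform m| * (X ^ (3 / 5 : ℝ) *
          ((m : ℝ) ^ (-(4 / 5) : ℝ) * (k : ℝ) ^ (-(6 / 5) : ℝ))) := by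
          rw [h2] at h1
          refine mul_le_mul_of_nonneg_left (h1.trans ?_) (abs_nonneg _)
          gcongr
      _ = _ := by ring
  have h1 := tsum_eq_tsum_sum_divisorsAntidiagonal hF fun p hp => by
    have : (p.1 : ℝ) * p.2 = 0 := by exact_mod_cast hp
    simp [this, fractProd_zero]
  have h2 : ∀ n : ℕ, ∑ p ∈ n.divisorsAntidiagonal,
      sqfWeightTransform p.1 * fractProd (X / ((p.1 : ℝ) * p.2) ^ 2) =
      sqfWeight n * fractProd (X / (n : ℝ) ^ 2) := by
    intro n
    rw [← sum_divisors_sqfWeightTransform, Finset.sum_mul,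
      Nat.sum_divisorsAntidiagonal
        fun m k => sqfWeightTransform m * fractProd (X / ((m : ℝ) * k) ^ 2)]
    refine Finset.sum_congr rfl fun d hd => ?_
    have : (d : ℝ) * ((n / d : ℕ) : ℝ) = n := by
      exact_mod_cast Nat.mul_div_cancel' (Nat.dvd_of_mem_divisors hd)
    rw [this]
  rw [← tsum_congr h2, ← h1, hF.tsum_prod]
  refine tsum_congr fun m => ?_
  dsimp only
  rw [tsum_mul_left]
  congr 1
  rcases Nat.eq_zero_or_pos m with rfl | hm
  · simp [fractProd_zero]
  have hsum : Summable fun k : ℕ => fractProd (X / ((m : ℝ) * k) ^ 2) := by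
    rw [← summable_nat_add_iff 1]
    refine (summable_fractProd_div_sq (Y := X / (m : ℝ) ^ 2) (by positivity)).congr fun k => ?_
    rw [div_div, mul_pow]
    push_cast
    rfl
  rw [hsum.tsum_eq_zero_add]
  simp only [Nat.cast_zero, mul_zero, ne_eq, OfNat.ofNat_ne_zero, not_false_eq_true, zero_pow,
    div_zero, fractProd_zero, zero_add]
  refine tsum_congr fun k => ?_
  rw [div_div, mul_pow]
  push_cast
  rfl

theorem exists_abs_tsum_sqfWeight_mul_fractProd_sub_le :
    ∃ C : ℝ, 0 < C ∧ ∀ X : ℝ, 0 ≤ X →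
      |∑' g : ℕ, sqfWeight g * fractProd (X / (g : ℝ) ^ 2) -
        (riemannZeta (3 / 2)).re / Real.pi * (∑' m : ℕ, sqfWeightTransform m / m) * √X| ≤
        C * X ^ (2 / 5 : ℝ) := by
  obtain ⟨C, hC0, hC⟩ := exists_abs_tsum_fractProd_sub_le
  have hs := summable_abs_sqfWeightTransform_mul_rpow
  set A : ℝ := ∑' n : ℕ, |sqfWeightTransform n| * (n : ℝ) ^ (-(4 / 5) : ℝ) with hA
  have hA0 : 0 ≤ A := tsum_nonneg fun n => by positivity
  refine ⟨C * A + 1, by positivity, fun X hX => ?_⟩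
  set c : ℝ := (riemannZeta (3 / 2)).re / Real.pi with hc
  have h1 : HasSum (fun m : ℕ => c * √X * (sqfWeightTransform m / m))
      (c * √X * ∑' m : ℕ, sqfWeightTransform m / m) :=
    summable_abs_sqfWeightTransform_div.of_abs.hasSum.mul_left _
  have hbound : ∀ m : ℕ, ‖sqfWeightTransform m * ∑' k : ℕ,
        fractProd (X / (m : ℝ) ^ 2 / ((k : ℝ) + 1) ^ 2) - c * √X * (sqfWeightTransform m / m)‖ ≤
      C * X ^ (2 / 5 : ℝ) * (|sqfWeightTransform m| * (m : ℝ) ^ (-(4 / 5) : ℝ)) := by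
    intro m
    rcases Nat.eq_zero_or_pos m with rfl | hm
    · simp
    have hm0 : (0 : ℝ) < m := by exact_mod_cast hm
    have h := hC (X / (m : ℝ) ^ 2) (by positivity)
    have e1 : √(X / (m : ℝ) ^ 2) = √X / m := by
      rw [Real.sqrt_div hX, Real.sqrt_sq hm0.le]
    have e2 : (X / (m : ℝ) ^ 2) ^ (2 / 5 : ℝ) = X ^ (2 / 5 : ℝ) * (m : ℝ) ^ (-(4 / 5) : ℝ) := by
      rw [Real.div_rpow hX (by positivity), Real.rpow_neg hm0.le, ← Real.rpow_natCast,
        ← Real.rpow_mul hm0.le, div_eq_mul_inv]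
      norm_num
    rw [e1, e2] at h
    have e3 : ∀ s b : ℝ, b * s - c * √X * (b / m) = b * (s - c * (√X / m)) := fun s b => by ring
    rw [e3, Real.norm_eq_abs, abs_mul]
    calc _ ≤ |sqfWeightTransform m| * (C * (X ^ (2 / 5 : ℝ) * (m : ℝ) ^ (-(4 / 5) : ℝ))) :=
          mul_le_mul_of_nonneg_left h (abs_nonneg _)
      _ = _ := by ring
  have h2 : Summable fun m : ℕ => sqfWeightTransform m * (∑' k : ℕ,
        fractProd (X / (m : ℝ) ^ 2 / ((k : ℝ) + 1) ^ 2)) - c * √X * (sqfWeightTransform m / m) :=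
    Summable.of_norm_bounded (hs.mul_left _) hbound
  have h3 : Summable fun m : ℕ => sqfWeightTransform m * ∑' k : ℕ,
        fractProd (X / (m : ℝ) ^ 2 / ((k : ℝ) + 1) ^ 2) :=
    (h2.add h1.summable).congr fun m => by ring
  rw [tsum_sqfWeight_mul_fractProd hX]
  have h4 := (h3.hasSum.sub h1).norm_le_of_bounded (hs.hasSum.mul_left _) hbound
  rw [Real.norm_eq_abs, show c * √X * ∑' m : ℕ, sqfWeightTransform m / m =
    c * (∑' m : ℕ, sqfWeightTransform m / m) * √X by ring] at h4
  refine h4.trans ?_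
  have := Real.rpow_nonneg hX (2 / 5)
  nlinarith

theorem exists_abs_sum_gcdSummand_sub_le {θ : ℝ} (hθ : 3 / 4 < θ) (hθ1 : θ ≤ 1) :
    ∃ C : ℝ, 0 < C ∧ ∀ (X : ℝ) (N : ℕ), 0 ≤ X →
      |∑ t ∈ gcdTriples N, gcdSummand X t - (riemannZeta (3 / 2)).re / Real.pi *
        (∏' p : Nat.Primes, (1 - 3 / ((p : ℕ) : ℝ) ^ 2 + 2 / ((p : ℕ) : ℝ) ^ 3)) * √X| ≤
        C * (X ^ (2 / 5 : ℝ) + X ^ θ * ((N + 1 : ℕ) : ℝ) ^ (-(1 / 2) : ℝ)) := by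
  obtain ⟨C, hC0, hC⟩ := exists_abs_tsum_sqfWeight_mul_fractProd_sub_le
  set B : ℝ := ∑' t : ℕ × ℕ × ℕ, (t.1 : ℝ) ^ (-(2 * θ - 1 / 2)) *
          ((t.2.1 : ℝ) ^ (-(3 / 2) : ℝ) * (t.2.2 : ℝ) ^ (-(3 / 2) : ℝ)) with hB
  have hB0 : 0 ≤ B := tsum_nonneg fun t => by positivity
  set P : ℝ := ∑' n, coprimeMoebiusTau 1 n with hP
  refine ⟨|P| * C + B + 1, by positivity, fun X N hX => ?_⟩
  have h1 := abs_tsum_gcdSummand_sub_le hX hθ hθ1 N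
  rw [← hB, (summable_gcdSummand hX).tsum_prod, tsum_congr (tsum_gcdSummand_fst hX), tsum_mul_left,
    ← hP] at h1
  have h2 := hC X hX
  have h3 := tsum_coprimeMoebiusTau_mul_tsum
  rw [← hP] at h3
  rw [← h3]
  generalize (∑' g : ℕ, sqfWeight g * fractProd (X / (g : ℝ) ^ 2)) = s at *
  generalize (∑ t ∈ gcdTriples N, gcdSummand X t) = s' at *
  generalize (∑' m : ℕ, sqfWeightTransform m / (m : ℝ)) = b at *
  generalize (riemannZeta (3 / 2)).re / Real.pi = c at *
  have h4 : |P * (s - c * b * √X)| ≤ |P| * (C * X ^ (2 / 5 : ℝ)) := by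
    rw [abs_mul]
    exact mul_le_mul_of_nonneg_left h2 (abs_nonneg _)
  have e : s' - c * (P * b) * √X = P * (s - c * b * √X) - (P * s - s') := by ring
  rw [e]
  refine (abs_sub _ _).trans ((add_le_add h4 h1).trans ?_)
  have ha : 0 ≤ X ^ (2 / 5 : ℝ) := by positivity
  have hb : 0 ≤ X ^ θ * ((N + 1 : ℕ) : ℝ) ^ (-(1 / 2) : ℝ) := by positivity
  have hPC : 0 ≤ |P| * C := by positivity
  nlinarith [mul_nonneg hB0 ha, mul_nonneg hPC hb]

/-- Partial sums of the Fourier series of `fractProd`. -/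
noncomputable def fractProdPartial (K : ℕ) (t : ℝ) : ℝ :=
  ∑ k ∈ Finset.range (K + 1), 2 * Real.sin (Real.pi * (k * t)) ^ 2 / (Real.pi ^ 2 * (k : ℝ) ^ 2)

theorem fractProdPartial_le (K : ℕ) (t : ℝ) : fractProdPartial K t ≤ fractProd t :=
  sum_le_hasSum _ (fun k _ => by positivity) (hasSum_fractProd t)

theorem fractProdPartial_nonneg (K : ℕ) (t : ℝ) : 0 ≤ fractProdPartial K t :=
  Finset.sum_nonneg fun k _ => by positivity

theorem fractProd_le_partial_add (K : ℕ) (t : ℝ) :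
    fractProd t ≤ fractProdPartial K t + 1 / (K + 1) := by
  refine le_of_tendsto' (hasSum_fractProd t).tendsto_sum_nat fun n => ?_
  have hsub : Finset.range n ⊆ Finset.range (K + 1) ∪ Finset.Ioo K n := fun k hk => by
    simp only [Finset.mem_union, Finset.mem_range, Finset.mem_Ioo] at hk ⊢
    omega
  refine (Finset.sum_le_sum_of_subset_of_nonneg hsub fun k _ _ => by positivity).trans ?_
  rw [Finset.sum_union (Finset.disjoint_left.2 fun k hk hk' => by
    simp only [Finset.mem_range, Finset.mem_Ioo] at hk hk'
    omega), fractProdPartial]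
  refine add_le_add le_rfl ?_
  have hpi : 9 < Real.pi ^ 2 := by nlinarith [Real.pi_gt_three]
  have h1 : ∀ k ∈ Finset.Ioo K n, 2 * Real.sin (Real.pi * (k * t)) ^ 2 /
      (Real.pi ^ 2 * (k : ℝ) ^ 2) ≤ 1 / 2 * ((k : ℝ) ^ 2)⁻¹ := fun k hk => by
    have hk0 : (0 : ℝ) < k := by
      exact_mod_cast (Nat.zero_le K).trans_lt (Finset.mem_Ioo.1 hk).1
    have hs := Real.sin_sq_le_one (Real.pi * (k * t))
    rw [← div_eq_mul_inv, div_le_div_iff₀ (by positivity) (by positivity)]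
    have : 0 < (k : ℝ) ^ 2 := by positivity
    nlinarith [mul_le_mul_of_nonneg_right hs this.le]
  refine (Finset.sum_le_sum h1).trans ?_
  rw [← Finset.mul_sum]
  have := sum_Ioo_inv_sq_le (α := ℝ) K n
  calc _ ≤ 1 / 2 * (2 / ((K : ℝ) + 1)) := by gcongr
    _ = _ := by ring

theorem norm_intervalFourier_sq (t : ℝ) (r : ℤ) :
    ‖intervalFourier t r‖ ^ 2 =
      Real.sin (Real.pi * (r * t)) ^ 2 / (Real.pi ^ 2 * (r : ℝ) ^ 2) := by
  rw [intervalFourier, ← norm_neg, ← neg_div, neg_sub, norm_div,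
    Complex.norm_exp_I_mul_ofReal_sub_one, div_pow,
    show -(2 * Real.pi * r * t) / 2 = -(Real.pi * (r * t)) by ring, Real.sin_neg]
  simp only [norm_mul, Complex.norm_I, Complex.norm_real, Complex.norm_intCast, norm_neg,
    Real.norm_eq_abs, Complex.norm_ofNat, mul_one, mul_pow, sq_abs]
  rcases eq_or_ne r 0 with rfl | hr
  · simp
  have : (r : ℝ) ≠ 0 := by exact_mod_cast hr
  field_simp

theorem intervalFourier_mul_sq (t : ℝ) {e : ℕ} (he : e ≠ 0) (k : ℤ) :
    intervalFourier (t / (e : ℝ) ^ 2) (k * (e : ℤ) ^ 2) =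
      intervalFourier t k / (e : ℂ) ^ 2 := by
  have he' : (e : ℝ) ≠ 0 := by exact_mod_cast he
  have he'' : (e : ℂ) ≠ 0 := by exact_mod_cast he
  have e1 : -(2 * Real.pi * ((k * (e : ℤ) ^ 2 : ℤ) : ℝ) * (t / (e : ℝ) ^ 2)) =
      -(2 * Real.pi * k * t) := by
    push_cast
    field_simp
  rw [intervalFourier, intervalFourier, e1, div_div]
  push_cast
  ring_nf

theorem sum_Icc_neg_eq_two_mul {f : ℤ → ℝ} (hf : ∀ k, f (-k) = f k) (h0 : f 0 = 0) (K : ℕ) :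
    ∑ k ∈ Finset.Icc (-(K : ℤ)) K, f k = 2 * ∑ k ∈ Finset.range (K + 1), f k := by
  induction K with
  | zero => simp [h0]
  | succ K ih =>
    have h : Finset.Icc (-((K + 1 : ℕ) : ℤ)) ((K + 1 : ℕ) : ℤ) =
        insert (-((K + 1 : ℕ) : ℤ)) (insert ((K + 1 : ℕ) : ℤ) (Finset.Icc (-(K : ℤ)) K)) := by
      ext k
      simp only [Finset.mem_insert, Finset.mem_Icc]
      push_cast
      omega
    rw [h, Finset.sum_insert, Finset.sum_insert, ih, Finset.sum_range_succ _ (K + 1), hf]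
    · ring
    · simp only [Finset.mem_Icc]
      push_cast
      omega
    · simp only [Finset.mem_insert, Finset.mem_Icc]
      push_cast
      omega

theorem exists_eq_mul_sq_of_mul_sq_eq {a b : ℕ} (ha : a ≠ 0) (hab : a.Coprime b) {h₁ h₂ : ℤ}
    (h : h₁ * (b : ℤ) ^ 2 = h₂ * (a : ℤ) ^ 2) :
    ∃ k : ℤ, h₁ = k * (a : ℤ) ^ 2 ∧ h₂ = k * (b : ℤ) ^ 2 := by
  have hc : IsCoprime ((a : ℤ) ^ 2) ((b : ℤ) ^ 2) := (Nat.isCoprime_iff_coprime.2 hab).pow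
  obtain ⟨k, hk⟩ := hc.dvd_of_dvd_mul_right (Dvd.intro_left h₂ h.symm)
  refine ⟨k, by rw [hk, mul_comm], ?_⟩
  have ha' : (a : ℤ) ^ 2 ≠ 0 := pow_ne_zero _ (by exact_mod_cast ha)
  refine mul_right_cancel₀ ha' ?_
  rw [← h, hk]
  ring

theorem sum_intervalFourier_mul_conj (X : ℝ) {g a b : ℕ} (hg : g ≠ 0) (ha : a ≠ 0) (hb : b ≠ 0)
    (hab : a.Coprime b) (H : ℕ) :
    ∑ h ∈ (Finset.Icc (-(H : ℤ)) H ×ˢ Finset.Icc (-(H : ℤ)) H).filter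
        (fun h => h.1 * ((g * b : ℕ) : ℤ) ^ 2 = h.2 * ((g * a : ℕ) : ℤ) ^ 2),
      intervalFourier (X / ((g * a : ℕ) : ℝ) ^ 2) h.1 *
        (starRingEnd ℂ) (intervalFourier (X / ((g * b : ℕ) : ℝ) ^ 2) h.2) =
      ((fractProdPartial (H / (max a b) ^ 2) (X / (g : ℝ) ^ 2) / ((a : ℝ) * b) ^ 2 : ℝ) : ℂ) := by
  set K := H / (max a b) ^ 2 with hK
  have hm : 0 < (max a b) ^ 2 := pow_pos (lt_max_of_lt_left (Nat.pos_of_ne_zero ha)) 2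
  have hgz : ((g : ℤ)) ^ 2 ≠ 0 := pow_ne_zero _ (by exact_mod_cast hg)
  have haz : ((a : ℤ)) ^ 2 ≠ 0 := pow_ne_zero _ (by exact_mod_cast ha)
  have hmem : ∀ k : ℤ, k ∈ Finset.Icc (-(K : ℤ)) K ↔
      k * (a : ℤ) ^ 2 ∈ Finset.Icc (-(H : ℤ)) H ∧ k * (b : ℤ) ^ 2 ∈ Finset.Icc (-(H : ℤ)) H := by
    intro k
    have h1 : k ∈ Finset.Icc (-(K : ℤ)) K ↔ k.natAbs ≤ K := by rw [Finset.mem_Icc]; omega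
    have h2 : ∀ c : ℕ, k * (c : ℤ) ^ 2 ∈ Finset.Icc (-(H : ℤ)) H ↔ k.natAbs * c ^ 2 ≤ H := by
      intro c
      have : (k * (c : ℤ) ^ 2).natAbs = k.natAbs * c ^ 2 := by
        rw [Int.natAbs_mul, Int.natAbs_pow, Int.natAbs_natCast]
      rw [← this, Finset.mem_Icc]
      omega
    rw [h1, h2, h2, hK, Nat.le_div_iff_mul_le hm]
    rcases le_total a b with h | h
    · rw [max_eq_right h]
      exact ⟨fun h' => ⟨(Nat.mul_le_mul_left _ (Nat.pow_le_pow_left h 2)).trans h', h'⟩,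
        fun h' => h'.2⟩
    · rw [max_eq_left h]
      exact ⟨fun h' => ⟨h', (Nat.mul_le_mul_left _ (Nat.pow_le_pow_left h 2)).trans h'⟩,
        fun h' => h'.1⟩
  have hsum : ∑ k ∈ Finset.Icc (-(K : ℤ)) K,
      ((Real.sin (Real.pi * (k * (X / (g : ℝ) ^ 2))) ^ 2 / (Real.pi ^ 2 * (k : ℝ) ^ 2) /
        ((a : ℝ) * b) ^ 2 : ℝ) : ℂ) =
      ((fractProdPartial K (X / (g : ℝ) ^ 2) / ((a : ℝ) * b) ^ 2 : ℝ) : ℂ) := by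
    rw [← Complex.ofReal_sum, ← Finset.sum_div, sum_Icc_neg_eq_two_mul
      (f := fun k : ℤ => Real.sin (Real.pi * (k * (X / (g : ℝ) ^ 2))) ^ 2 /
        (Real.pi ^ 2 * (k : ℝ) ^ 2)) (fun k => by
          push_cast
          rw [neg_mul, mul_neg, Real.sin_neg, neg_sq, neg_sq]) (by simp),
      fractProdPartial, Finset.mul_sum]
    simp only [Int.cast_natCast, mul_div_assoc]
  rw [← hsum]
  symm
  refine Finset.sum_bij (fun k _ => (k * (a : ℤ) ^ 2, k * (b : ℤ) ^ 2)) (fun k hk => ?_)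
    (fun k _ l _ h => ?_) (fun h hh => ?_) (fun k _ => ?_)
  · rw [Finset.mem_filter, Finset.mem_product]
    refine ⟨(hmem k).1 hk, ?_⟩
    push_cast
    ring
  · exact mul_right_cancel₀ haz (Prod.mk.inj h).1
  · rw [Finset.mem_filter, Finset.mem_product] at hh
    have h' : h.1 * (b : ℤ) ^ 2 = h.2 * (a : ℤ) ^ 2 := by
      refine mul_right_cancel₀ hgz ?_
      have := hh.2
      push_cast at this
      linear_combination this
    obtain ⟨k, h1, h2⟩ := exists_eq_mul_sq_of_mul_sq_eq ha hab h'
    exact ⟨k, (hmem k).2 (by rw [← h1, ← h2]; exact hh.1), by rw [← h1, ← h2]⟩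
  · have e : ∀ c : ℕ, X / ((g * c : ℕ) : ℝ) ^ 2 = X / (g : ℝ) ^ 2 / (c : ℝ) ^ 2 := fun c => by
      rw [div_div, Nat.cast_mul, mul_pow]
    rw [e, e, intervalFourier_mul_sq _ ha, intervalFourier_mul_sq _ hb, map_div₀, map_pow,
      Complex.conj_natCast, div_mul_div_comm, Complex.mul_conj', ← Complex.ofReal_pow,
      norm_intervalFourier_sq]
    push_cast
    rw [mul_pow]

theorem abs_sub_fractProdPartial_le {a b : ℕ} (ha : a ≠ 0) (hb : b ≠ 0) (H : ℕ) (t : ℝ) :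
    |fractProdPartial (H / (max a b) ^ 2) t - fractProd t| ≤
      ((a : ℝ) * b) ^ (1 / 2 : ℝ) * ((H + 1 : ℕ) : ℝ) ^ (-(1 / 4) : ℝ) := by
  set K := H / (max a b) ^ 2 with hK
  have ha' : 0 < a := Nat.pos_of_ne_zero ha
  have hb' : 0 < b := Nat.pos_of_ne_zero hb
  have hab : 0 < (a : ℝ) * b := by positivity
  have h1 := fractProdPartial_le K t
  have h2 := fractProd_le_partial_add K t
  have h3 := fractProdPartial_nonneg K t
  have h4 := fractProd_le_one t
  rw [abs_sub_comm, abs_of_nonneg (sub_nonneg.2 h1)]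
  have hlt : H + 1 ≤ (K + 1) * (a * b) ^ 2 := by
    have hm : 0 < (max a b) ^ 2 := pow_pos (lt_max_of_lt_left ha') 2
    have : max a b ≤ a * b :=
      max_le (Nat.le_mul_of_pos_right a hb') (Nat.le_mul_of_pos_left b ha')
    calc H + 1 ≤ (K + 1) * (max a b) ^ 2 := by
          have := Nat.lt_div_mul_add (a := H) hm
          rw [← hK] at this
          rw [add_mul, one_mul]
          omega
      _ ≤ _ := Nat.mul_le_mul_left _ (Nat.pow_le_pow_left this 2)
  have hlt' : ((H + 1 : ℕ) : ℝ) ≤ ((K : ℝ) + 1) * ((a : ℝ) * b) ^ 2 := by exact_mod_cast hlt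
  have hH : (0 : ℝ) < ((H + 1 : ℕ) : ℝ) := by positivity
  have h5 : fractProd t - fractProdPartial K t ≤ ((a : ℝ) * b) ^ 2 / ((H + 1 : ℕ) : ℝ) := by
    have : 1 / ((K : ℝ) + 1) ≤ ((a : ℝ) * b) ^ 2 / ((H + 1 : ℕ) : ℝ) := by
      rw [div_le_div_iff₀ (by positivity) hH]
      linarith
    linarith
  refine (le_rpow_of_le_one_of_le (θ := 1 / 4) (sub_nonneg.2 h1) (by linarith) h5 (by norm_num)
    (by norm_num)).trans (le_of_eq ?_)
  rw [Real.div_rpow (by positivity) hH.le, Real.rpow_neg hH.le, ← Real.rpow_natCast,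
    ← Real.rpow_mul hab.le, div_eq_mul_inv]
  norm_num

theorem exists_norm_diag_sub_le :
    ∃ C : ℝ, 0 < C ∧ ∀ (X : ℝ) (N H : ℕ),
      ‖∑ p ∈ Finset.Icc 1 N ×ˢ Finset.Icc 1 N,
          ((ArithmeticFunction.moebius p.1 : ℂ) * ArithmeticFunction.moebius p.2) *
          ∑ h ∈ (Finset.Icc (-(H : ℤ)) H ×ˢ Finset.Icc (-(H : ℤ)) H).filter
            (fun h => h.1 * (p.2 : ℤ) ^ 2 = h.2 * (p.1 : ℤ) ^ 2),
          intervalFourier (X / (p.1 : ℝ) ^ 2) h.1 *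
            (starRingEnd ℂ) (intervalFourier (X / (p.2 : ℝ) ^ 2) h.2) -
        ((∑ t ∈ gcdTriples N, gcdSummand X t : ℝ) : ℂ)‖ ≤
        C * (N * ((H + 1 : ℕ) : ℝ) ^ (-(1 / 4) : ℝ)) := by
  have hs : Summable fun n : ℕ => (n : ℝ) ^ (-(3 / 2) : ℝ) :=
    Real.summable_nat_rpow.2 (by norm_num)
  set Z : ℝ := ∑' n : ℕ, (n : ℝ) ^ (-(3 / 2) : ℝ) with hZ
  have hZ0 : 0 ≤ Z := tsum_nonneg fun n => by positivity
  refine ⟨Z * Z + 1, by positivity, fun X N H => ?_⟩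
  set δ : ℝ := ((H + 1 : ℕ) : ℝ) ^ (-(1 / 4) : ℝ) with hδ
  have hδ0 : 0 ≤ δ := by positivity
  set F : ℕ × ℕ × ℕ → ℝ := fun t => (t.2.1 : ℝ) ^ (-(3 / 2) : ℝ) * (t.2.2 : ℝ) ^ (-(3 / 2) : ℝ) * δ
    with hF
  have hF0 : ∀ t, 0 ≤ F t := fun t => by rw [hF]; positivity
  have hm : ∀ n : ℕ, ‖(ArithmeticFunction.moebius n : ℂ)‖ ≤ 1 := fun n => by
    rw [Complex.norm_intCast]
    exact_mod_cast ArithmeticFunction.abs_moebius_le_one (n := n)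
  rw [sum_gcdTriples, Complex.ofReal_sum, ← Finset.sum_sub_distrib]
  calc _ ≤ ∑ p ∈ Finset.Icc 1 N ×ˢ Finset.Icc 1 N,
        F (p.1.gcd p.2, p.1 / p.1.gcd p.2, p.2 / p.1.gcd p.2) := by
        refine norm_sum_le_of_le _ fun p hp => ?_
        simp only [Finset.mem_product, Finset.mem_Icc] at hp
        obtain ⟨⟨h1, -⟩, h2, -⟩ := hp
        have hg := Nat.gcd_pos_of_pos_left p.2 h1
        obtain ⟨g, hgdef⟩ : ∃ g, g = p.1.gcd p.2 := ⟨_, rfl⟩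
        obtain ⟨a, ha⟩ : ∃ a, a = p.1 / g := ⟨_, rfl⟩
        obtain ⟨b, hb⟩ : ∃ b, b = p.2 / g := ⟨_, rfl⟩
        have hab : a.Coprime b := by
          rw [ha, hb, hgdef]
          exact Nat.coprime_div_gcd_div_gcd hg
        have e1 : p.1 = g * a := by
          rw [ha, hgdef, Nat.mul_div_cancel' (Nat.gcd_dvd_left _ _)]
        have e2 : p.2 = g * b := by
          rw [hb, hgdef, Nat.mul_div_cancel' (Nat.gcd_dvd_right _ _)]
        have hg0 : g ≠ 0 := fun h => by rw [h, zero_mul] at e1; omega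
        have ha0 : a ≠ 0 := fun h => by rw [h, mul_zero] at e1; omega
        have hb0 : b ≠ 0 := fun h => by rw [h, mul_zero] at e2; omega
        rw [← hgdef, ← ha, ← hb, e1, e2, sum_intervalFourier_mul_conj X hg0 ha0 hb0 hab,
          gcdSummand, if_pos hab]
        have hA : (0 : ℝ) < a := by exact_mod_cast Nat.pos_of_ne_zero ha0
        have hB : (0 : ℝ) < b := by exact_mod_cast Nat.pos_of_ne_zero hb0
        have hW := abs_sub_fractProdPartial_le ha0 hb0 H (X / (g : ℝ) ^ 2)
        rw [← hδ] at hW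
        push_cast
        rw [← mul_div_assoc, ← sub_div, ← mul_sub, norm_div, norm_mul, norm_mul, norm_pow,
          norm_mul, Complex.norm_natCast, Complex.norm_natCast, ← Complex.ofReal_sub,
          Complex.norm_real, Real.norm_eq_abs]
        calc _ ≤ 1 * 1 * (((a : ℝ) * b) ^ (1 / 2 : ℝ) * δ) / ((a : ℝ) * b) ^ 2 := by
              gcongr
              · exact hm _
              · exact hm _
          _ = F (g, a, b) := by
              simp only [hF]
              rw [← Real.mul_rpow hA.le hB.le, show (-(3 / 2) : ℝ) = 1 / 2 - (2 : ℕ) by norm_num,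
                Real.rpow_sub (by positivity), Real.rpow_natCast]
              ring
    _ = ∑ t ∈ gcdTriples N, F t := (sum_gcdTriples N F).symm
    _ ≤ ∑ t ∈ Finset.Icc 1 N ×ˢ (Finset.Icc 1 N ×ˢ Finset.Icc 1 N), F t :=
        Finset.sum_le_sum_of_subset_of_nonneg (gcdTriples_subset N) fun t _ _ => hF0 t
    _ = N * ((∑ n ∈ Finset.Icc 1 N, (n : ℝ) ^ (-(3 / 2) : ℝ)) *
          (∑ n ∈ Finset.Icc 1 N, (n : ℝ) ^ (-(3 / 2) : ℝ)) * δ) := by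
        simp only [hF]
        rw [Finset.sum_product]
        simp only [Finset.sum_const, Nat.card_Icc, Nat.add_sub_cancel, nsmul_eq_mul]
        rw [Finset.sum_product, Finset.sum_mul_sum]
        simp only [Finset.sum_mul]
    _ ≤ N * (Z * Z * δ) := by
        have : ∑ n ∈ Finset.Icc 1 N, (n : ℝ) ^ (-(3 / 2) : ℝ) ≤ Z :=
          hs.sum_le_tsum _ fun n _ => by positivity
        have h0 : 0 ≤ ∑ n ∈ Finset.Icc 1 N, (n : ℝ) ^ (-(3 / 2) : ℝ) :=
          Finset.sum_nonneg fun n _ => by positivity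
        gcongr
    _ ≤ _ := by
        have : 0 ≤ (N : ℝ) * δ := by positivity
        nlinarith

/-- The function on `ZMod q` taking the value `F r` at the residues of the integers `|r| ≤ H`. -/
noncomputable def truncResidue {q : ℕ} (H : ℕ) (F : ℤ → ℂ) (h : ZMod q) : ℂ :=
  if h.valMinAbs.natAbs ≤ H then F h.valMinAbs else 0

theorem natAbs_valMinAbs_intCast_of_two_mul_lt {q : ℕ} [NeZero q] {r : ℤ}
    (h : 2 * r.natAbs < q) : ((r : ZMod q)).valMinAbs = r := by
  rw [ZMod.valMinAbs_spec]
  exact ⟨rfl, by rw [Set.mem_Ioc]; omega⟩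

theorem sum_units_truncResidue_mul_conj {q : ℕ} [Fact q.Prime] {H : ℕ} (hH : 2 * H < q)
    (F G : ℤ → ℂ) (hF : F 0 = 0) {a b : ZMod q} (ha : a ≠ 0) :
    ∑ m : (ZMod q)ˣ, truncResidue H F ((m : ZMod q) * a) *
        (starRingEnd ℂ) (truncResidue H G ((m : ZMod q) * b)) =
      ∑ h ∈ (Finset.Icc (-(H : ℤ)) H ×ˢ Finset.Icc (-(H : ℤ)) H).filter
        (fun h => (h.1 : ZMod q) * b = (h.2 : ZMod q) * a), F h.1 * (starRingEnd ℂ) (G h.2) := by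
  have hq : q.Prime := Fact.out
  have : NeZero q := ⟨hq.ne_zero⟩
  have key : ∀ m : (ZMod q)ˣ, truncResidue H F ((m : ZMod q) * a) *
        (starRingEnd ℂ) (truncResidue H G ((m : ZMod q) * b)) ≠ 0 →
      ((m : ZMod q) * a).valMinAbs.natAbs ≤ H ∧ ((m : ZMod q) * b).valMinAbs.natAbs ≤ H := by
    intro m hm
    refine ⟨?_, ?_⟩ <;> by_contra h <;> simp [truncResidue, h] at hm
  have hmem : ∀ r : ℤ, r ∈ Finset.Icc (-(H : ℤ)) H ↔ r.natAbs ≤ H := fun r => by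
    rw [Finset.mem_Icc]; omega
  refine Finset.sum_bij_ne_zero
    (fun m _ _ => (((m : ZMod q) * a).valMinAbs, ((m : ZMod q) * b).valMinAbs)) ?_ ?_ ?_ ?_
  · intro m _ hm
    obtain ⟨h1, h2⟩ := key m hm
    rw [Finset.mem_filter, Finset.mem_product, hmem, hmem]
    refine ⟨⟨h1, h2⟩, ?_⟩
    rw [ZMod.coe_valMinAbs, ZMod.coe_valMinAbs]
    ring
  · intro m _ _ m' _ _ h
    exact Units.ext (mul_right_cancel₀ ha (ZMod.valMinAbs_inj.1 (Prod.mk.inj h).1))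
  · intro h hh h0
    rw [Finset.mem_filter, Finset.mem_product, hmem, hmem] at hh
    obtain ⟨⟨h1, h2⟩, h3⟩ := hh
    have h10 : h.1 ≠ 0 := fun e => h0 (by rw [e, hF, zero_mul])
    have hz : (h.1 : ZMod q) ≠ 0 := by
      rw [Ne, ← ZMod.valMinAbs_eq_zero, natAbs_valMinAbs_intCast_of_two_mul_lt (by omega)]
      exact h10
    have e1 : ((Units.mk0 _ (div_ne_zero hz ha) : (ZMod q)ˣ) : ZMod q) * a = (h.1 : ZMod q) := by
      rw [Units.val_mk0, div_mul_cancel₀ _ ha]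
    have e2 : ((Units.mk0 _ (div_ne_zero hz ha) : (ZMod q)ˣ) : ZMod q) * b = (h.2 : ZMod q) := by
      rw [Units.val_mk0, div_mul_eq_mul_div, h3, mul_div_cancel_right₀ _ ha]
    refine ⟨Units.mk0 _ (div_ne_zero hz ha), Finset.mem_univ _, ?_, ?_⟩
    · rw [e1, e2, truncResidue, truncResidue, natAbs_valMinAbs_intCast_of_two_mul_lt (by omega),
        natAbs_valMinAbs_intCast_of_two_mul_lt (by omega), if_pos h1, if_pos h2]
      exact h0
    · rw [e1, e2, natAbs_valMinAbs_intCast_of_two_mul_lt (by omega),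
        natAbs_valMinAbs_intCast_of_two_mul_lt (by omega)]
  · intro m _ hm
    obtain ⟨h1, h2⟩ := key m hm
    rw [truncResidue, truncResidue, if_pos h1, if_pos h2]

theorem norm_intervalFourier_le_one (t : ℝ) (r : ℤ) : ‖intervalFourier t r‖ ≤ 1 := by
  rcases eq_or_ne r 0 with rfl | hr
  · simp [intervalFourier]
  refine (norm_intervalFourier_le t hr).trans ?_
  have : (1 : ℝ) ≤ |(r : ℝ)| := by exact_mod_cast Int.one_le_abs hr
  exact (div_le_one (by linarith)).2 this

/-- The truncated model for `m ↦ ∑_d μ(d) c_d(m d²)`. -/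
noncomputable def truncModel {q : ℕ} (X : ℝ) (N H : ℕ) (m : ZMod q) : ℂ :=
  ∑ d ∈ Finset.Icc 1 N, (ArithmeticFunction.moebius d : ℂ) *
    truncResidue H (intervalFourier (X / (d : ℝ) ^ 2)) (m * (d : ZMod q) ^ 2)

theorem sum_norm_truncModel_sq {q : ℕ} [Fact q.Prime] (X : ℝ) {N H : ℕ} (hH : 2 * H < q)
    (hN : N < q) :
    ((∑ m : (ZMod q)ˣ, ‖truncModel X N H (m : ZMod q)‖ ^ 2 : ℝ) : ℂ) =
      ∑ p ∈ Finset.Icc 1 N ×ˢ Finset.Icc 1 N,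
        ((ArithmeticFunction.moebius p.1 : ℂ) * ArithmeticFunction.moebius p.2) *
        ∑ h ∈ (Finset.Icc (-(H : ℤ)) H ×ˢ Finset.Icc (-(H : ℤ)) H).filter
          (fun h => (h.1 : ZMod q) * (p.2 : ZMod q) ^ 2 = (h.2 : ZMod q) * (p.1 : ZMod q) ^ 2),
        intervalFourier (X / (p.1 : ℝ) ^ 2) h.1 *
          (starRingEnd ℂ) (intervalFourier (X / (p.2 : ℝ) ^ 2) h.2) := by
  have h1 : ∀ m : (ZMod q)ˣ, ((‖truncModel X N H (m : ZMod q)‖ ^ 2 : ℝ) : ℂ) =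
      ∑ p ∈ Finset.Icc 1 N ×ˢ Finset.Icc 1 N,
        ((ArithmeticFunction.moebius p.1 : ℂ) * ArithmeticFunction.moebius p.2) *
        (truncResidue H (intervalFourier (X / (p.1 : ℝ) ^ 2)) ((m : ZMod q) * (p.1 : ZMod q) ^ 2) *
        (starRingEnd ℂ) (truncResidue H (intervalFourier (X / (p.2 : ℝ) ^ 2))
          ((m : ZMod q) * (p.2 : ZMod q) ^ 2))) := by
    intro m
    rw [Complex.ofReal_pow, ← Complex.mul_conj', truncModel, map_sum, Finset.sum_mul_sum,
      ← Finset.sum_product']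
    refine Finset.sum_congr rfl fun p _ => ?_
    rw [map_mul, map_intCast]
    ring
  rw [Complex.ofReal_sum, Finset.sum_congr rfl fun m _ => h1 m, Finset.sum_comm]
  refine Finset.sum_congr rfl fun p hp => ?_
  rw [← Finset.mul_sum]
  congr 1
  refine sum_units_truncResidue_mul_conj hH _ _ (by simp [intervalFourier]) ?_
  rw [Finset.mem_product, Finset.mem_Icc] at hp
  refine pow_ne_zero 2 fun h => ?_
  have := Nat.le_of_dvd hp.1.1 ((ZMod.natCast_eq_zero_iff _ _).1 h)
  omega

theorem norm_sum_truncModel_sq_sub_diag_le {q : ℕ} [Fact q.Prime] (X : ℝ) {N H : ℕ}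
    (hH : 2 * H < q) (hN : N < q) :
    ‖((∑ m : (ZMod q)ˣ, ‖truncModel X N H (m : ZMod q)‖ ^ 2 : ℝ) : ℂ) -
      ∑ p ∈ Finset.Icc 1 N ×ˢ Finset.Icc 1 N,
        ((ArithmeticFunction.moebius p.1 : ℂ) * ArithmeticFunction.moebius p.2) *
        ∑ h ∈ (Finset.Icc (-(H : ℤ)) H ×ˢ Finset.Icc (-(H : ℤ)) H).filter
          (fun h => h.1 * (p.2 : ℤ) ^ 2 = h.2 * (p.1 : ℤ) ^ 2),
        intervalFourier (X / (p.1 : ℝ) ^ 2) h.1 *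
          (starRingEnd ℂ) (intervalFourier (X / (p.2 : ℝ) ^ 2) h.2)‖ ≤
      (2 * H + 1) ^ 2 * (2 * (1 + 8 * (N : ℝ) ^ 2 / q + N * √(2 * H / q))) := by
  set B : ℝ := 2 * (1 + 8 * (N : ℝ) ^ 2 / q + N * √(2 * H / q)) with hB
  set I : Finset ℤ := Finset.Icc (-(H : ℤ)) H with hI
  set P := Finset.Icc 1 N ×ˢ Finset.Icc 1 N with hP
  have hm : ∀ n : ℕ, ‖(ArithmeticFunction.moebius n : ℂ)‖ ≤ 1 := fun n => by
    rw [Complex.norm_intCast]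
    exact_mod_cast ArithmeticFunction.abs_moebius_le_one (n := n)
  set J : ℕ × ℕ → ℤ × ℤ → ℂ := fun p h => intervalFourier (X / (p.1 : ℝ) ^ 2) h.1 *
          (starRingEnd ℂ) (intervalFourier (X / (p.2 : ℝ) ^ 2) h.2) with hJ
  have hJ1 : ∀ p h, ‖J p h‖ ≤ if h.1 ≠ 0 then 1 else 0 := fun p h => by
    rw [hJ]
    split_ifs with h0
    · rw [norm_mul, RCLike.norm_conj]
      exact mul_le_one₀ (norm_intervalFourier_le_one _ _) (norm_nonneg _)
        (norm_intervalFourier_le_one _ _)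
    · rw [not_not] at h0
      simp [h0, intervalFourier]
  rw [sum_norm_truncModel_sq X hH hN, ← Finset.sum_sub_distrib]
  have hterm : ∀ p ∈ P, ‖((ArithmeticFunction.moebius p.1 : ℂ) * ArithmeticFunction.moebius p.2) *
        ∑ h ∈ (I ×ˢ I).filter
          (fun h => (h.1 : ZMod q) * (p.2 : ZMod q) ^ 2 = (h.2 : ZMod q) * (p.1 : ZMod q) ^ 2),
        J p h - ((ArithmeticFunction.moebius p.1 : ℂ) * ArithmeticFunction.moebius p.2) *
        ∑ h ∈ (I ×ˢ I).filter
          (fun h => h.1 * (p.2 : ℤ) ^ 2 = h.2 * (p.1 : ℤ) ^ 2), J p h‖ ≤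
      ∑ h ∈ I ×ˢ I, if h.1 ≠ 0 ∧ ((h.1 : ZMod q) * (p.2 : ZMod q) ^ 2 =
        (h.2 : ZMod q) * (p.1 : ZMod q) ^ 2 ∧ h.1 * (p.2 : ℤ) ^ 2 ≠ h.2 * (p.1 : ℤ) ^ 2)
        then (1 : ℝ) else 0 := by
    intro p _
    rw [← mul_sub, norm_mul, norm_mul, Finset.sum_filter, Finset.sum_filter,
      ← Finset.sum_sub_distrib]
    refine (mul_le_of_le_one_left (norm_nonneg _) (mul_le_one₀ (hm _) (norm_nonneg _) (hm _))).trans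
      (norm_sum_le_of_le _ fun h _ => ?_)
    have hJ2 := hJ1 p h
    by_cases h1 : h.1 * (p.2 : ℤ) ^ 2 = h.2 * (p.1 : ℤ) ^ 2
    · have h2 : (h.1 : ZMod q) * (p.2 : ZMod q) ^ 2 = (h.2 : ZMod q) * (p.1 : ZMod q) ^ 2 := by
        exact_mod_cast congrArg (Int.cast : ℤ → ZMod q) h1
      rw [if_pos h1, if_pos h2, sub_self, norm_zero]
      split_ifs <;> norm_num
    · rw [if_neg h1, sub_zero]
      by_cases h2 : (h.1 : ZMod q) * (p.2 : ZMod q) ^ 2 = (h.2 : ZMod q) * (p.1 : ZMod q) ^ 2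
      · rw [if_pos h2]
        simpa only [h1, h2, ne_eq, not_false_eq_true, and_true] using hJ2
      · rw [if_neg h2, norm_zero]
        split_ifs <;> norm_num
  refine (norm_sum_le_of_le _ hterm).trans ?_
  rw [Finset.sum_comm]
  have hcard : ((I ×ˢ I).card : ℝ) = (2 * H + 1) ^ 2 := by
    rw [Finset.card_product, hI, Int.card_Icc]
    have : ((H : ℤ) + 1 - -(H : ℤ)).toNat = 2 * H + 1 := by omega
    rw [this]
    push_cast
    ring
  rw [← hcard, ← nsmul_eq_mul]
  refine Finset.sum_le_card_nsmul _ _ _ fun h hh => ?_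
  rw [Finset.mem_product, hI, Finset.mem_Icc, Finset.mem_Icc] at hh
  by_cases h0 : h.1 ≠ 0
  · have := card_offDiag_le (q := q) (D := N) (H := H) (h₂ := h.2) h0 (by omega) (by omega)
      (by omega) hN
    rw [Finset.card_filter] at this
    push_cast at this
    simpa only [h0, ne_eq, not_false_eq_true, true_and] using this
  · have hB0 : 0 ≤ B := by positivity
    simpa [h0] using hB0

/-- The sum `∑_{d ∈ S} μ(d) c_d(m d²)` of normalised exponential sums of length `⌊q X / d²⌋`. -/
noncomputable def moebiusExpSum {q : ℕ} [NeZero q] (X : ℝ) (S : Finset ℕ) (m : ZMod q) : ℂ :=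
  ∑ d ∈ S, (ArithmeticFunction.moebius d : ℂ) *
    expSumCoeff q ⌊q * (X / (d : ℝ) ^ 2)⌋₊ (m * (d : ZMod q) ^ 2)

theorem norm_moebius_mul_le (n : ℕ) (w : ℂ) : ‖(ArithmeticFunction.moebius n : ℂ) * w‖ ≤ ‖w‖ := by
  rw [norm_mul, Complex.norm_intCast]
  exact mul_le_of_le_one_left (norm_nonneg _)
    (by exact_mod_cast ArithmeticFunction.abs_moebius_le_one (n := n))

theorem exists_sum_norm_moebiusExpSum_sub_sq_le (η : ℝ) (hη : 0 < η) : ∃ C : ℝ, 0 < C ∧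
    ∀ (q : ℕ) [Fact q.Prime] [NeZero q] (X : ℝ) (D N H : ℕ) (R : ℝ), 0 ≤ X → 1 ≤ D → 0 ≤ R →
      ∀ S : Finset ℕ, (∀ d ∈ S, 1 ≤ d ∧ d ≤ D ∧ d < q) → Finset.Icc 1 N ⊆ S →
      (∀ d ∈ S, N < d → X / (d : ℝ) ≤ R) → (N : ℝ) ≤ R * (H + 1) →
      ∑ m : (ZMod q)ˣ, ‖moebiusExpSum X S (m : ZMod q) - truncModel X N H (m : ZMod q)‖ ^ 2 ≤
        C * (q : ℝ) ^ η * ((D : ℝ) ^ 2 / q + R) + 128 * (N : ℝ) ^ 2 / q := by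
  obtain ⟨C, hC0, hC⟩ := exists_sum_sq_norm_sum_le η hη
  refine ⟨2 * C, by positivity, fun q _ _ X D N H R hX hD hR S hS hNS hR1 hR2 => ?_⟩
  have hq : q.Prime := Fact.out
  have hq0 : (0 : ℝ) < q := by exact_mod_cast hq.pos
  obtain ⟨c, hc⟩ : ∃ c : ℕ → ZMod q → ℂ,
    c = fun (d : ℕ) h => expSumCoeff q ⌊q * (X / (d : ℝ) ^ 2)⌋₊ h := ⟨_, rfl⟩
  obtain ⟨J, hJ⟩ : ∃ J : ℕ → ℤ → ℂ, J = fun (d : ℕ) => intervalFourier (X / (d : ℝ) ^ 2) := ⟨_, rfl⟩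
  set g₁ : ℕ → ZMod q → ℂ := fun d h => if d ≤ N ∧ h.valMinAbs.natAbs ≤ H then 0 else
    (ArithmeticFunction.moebius d : ℂ) * c d h with hg₁
  set g₂ : ℕ → ZMod q → ℂ := fun d h => if h.valMinAbs.natAbs ≤ H then
    (ArithmeticFunction.moebius d : ℂ) * (c d h - J d h.valMinAbs) else 0 with hg₂
  have hb₁ : ∀ d ∈ S, ∀ h : ZMod q, h ≠ 0 →
      ‖g₁ d h‖ ≤ 1 / h.valMinAbs.natAbs ∧ ‖g₁ d h‖ ≤ R / d := by
    intro d hd h hh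
    have hd1 : (0 : ℝ) < d := by exact_mod_cast (hS d hd).1
    have h1 : ‖c d h‖ ≤ 1 / h.valMinAbs.natAbs := by
      rw [hc]
      exact norm_expSumCoeff_le_inv q _ hh
    have h2 : ‖c d h‖ ≤ X / (d : ℝ) / d := by
      rw [hc]
      refine (norm_expSumCoeff_le q _ h).trans ?_
      rw [div_div, ← sq, div_le_iff₀ hq0, mul_comm _ (q : ℝ)]
      exact Nat.floor_le (by positivity)
    simp only [hg₁]
    split_ifs with hcond
    · rw [norm_zero]
      exact ⟨by positivity, by positivity⟩
    · refine ⟨(norm_moebius_mul_le _ _).trans h1, (norm_moebius_mul_le _ _).trans ?_⟩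
      by_cases hdN : d ≤ N
      · have hH : H + 1 ≤ h.valMinAbs.natAbs := by
          by_contra hlt
          exact hcond ⟨hdN, by omega⟩
        have hH' : (H : ℝ) + 1 ≤ (h.valMinAbs.natAbs : ℝ) := by exact_mod_cast hH
        refine h1.trans ?_
        rw [div_le_div_iff₀ (by linarith [(Nat.cast_nonneg H : (0 : ℝ) ≤ H)]) hd1, one_mul]
        calc (d : ℝ) ≤ N := by exact_mod_cast hdN
          _ ≤ R * (H + 1) := hR2
          _ ≤ _ := by gcongr
      · exact h2.trans (by gcongr; exact hR1 d hd (not_le.1 hdN))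
  have hb₂ : ∀ d, ∀ h : ZMod q, h ≠ 0 → ‖g₂ d h‖ ≤ 8 / q := by
    intro d h hh
    simp only [hg₂]
    split_ifs
    · refine (norm_moebius_mul_le _ _).trans ?_
      rw [hc, hJ]
      exact norm_expSumCoeff_sub_le q (by positivity) hh
    · rw [norm_zero]; positivity
  have hdecomp : ∀ m : ZMod q, moebiusExpSum X S m - truncModel X N H m =
      ∑ d ∈ S, g₁ d (m * (d : ZMod q) ^ 2) +
        ∑ d ∈ Finset.Icc 1 N, g₂ d (m * (d : ZMod q) ^ 2) := by
    intro m
    rw [sub_eq_iff_eq_add, add_assoc, moebiusExpSum, truncModel, ← Finset.sum_add_distrib,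
      ← Finset.sum_sdiff hNS, ← Finset.sum_sdiff hNS (f := fun d => g₁ d (m * (d : ZMod q) ^ 2)),
      add_assoc, ← Finset.sum_add_distrib]
    congr 1
    · refine Finset.sum_congr rfl fun d hd => ?_
      rw [Finset.mem_sdiff, Finset.mem_Icc, not_and] at hd
      have := hd.2 (hS d hd.1).1
      simp only [hg₁, hc]
      rw [if_neg fun h => this h.1]
    · refine Finset.sum_congr rfl fun d hd => ?_
      have hdN := (Finset.mem_Icc.1 hd).2
      simp only [hg₁, hg₂, truncResidue, hc, hJ, hdN, true_and]
      split_ifs <;> ring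
  have hA := hC q D R hD hR S hS g₁ hb₁
  have hB : ∀ m : (ZMod q)ˣ,
      ‖∑ d ∈ Finset.Icc 1 N, g₂ d ((m : ZMod q) * (d : ZMod q) ^ 2)‖ ≤ N * (8 / q) := by
    intro m
    refine (norm_sum_le_of_le _ fun d hd => hb₂ d _ ?_).trans (le_of_eq ?_)
    · refine mul_ne_zero m.ne_zero (pow_ne_zero 2 fun h => ?_)
      have h1 := hS d (hNS hd)
      have := Nat.le_of_dvd h1.1 ((ZMod.natCast_eq_zero_iff _ _).1 h)
      omega
    · rw [Finset.sum_const, Nat.card_Icc, Nat.add_sub_cancel, nsmul_eq_mul]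
  have hcard : (Fintype.card (ZMod q)ˣ : ℝ) ≤ q := by
    rw [ZMod.card_units_eq_totient]
    exact_mod_cast Nat.totient_le q
  calc _ ≤ ∑ m : (ZMod q)ˣ, (2 * ‖∑ d ∈ S, g₁ d ((m : ZMod q) * (d : ZMod q) ^ 2)‖ ^ 2 +
        2 * (N * (8 / q)) ^ 2) := by
        refine Finset.sum_le_sum fun m _ => ?_
        rw [hdecomp]
        have h1 := norm_add_le (∑ d ∈ S, g₁ d ((m : ZMod q) * (d : ZMod q) ^ 2))
          (∑ d ∈ Finset.Icc 1 N, g₂ d ((m : ZMod q) * (d : ZMod q) ^ 2))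
        have h2 := pow_le_pow_left₀ (norm_nonneg _) (h1.trans (add_le_add_right (hB m) _)) 2
        refine h2.trans ?_
        nlinarith [sq_nonneg (‖∑ d ∈ S, g₁ d ((m : ZMod q) * (d : ZMod q) ^ 2)‖ - N * (8 / q))]
    _ = 2 * (∑ m : (ZMod q)ˣ, ‖∑ d ∈ S, g₁ d ((m : ZMod q) * (d : ZMod q) ^ 2)‖ ^ 2) +
        Fintype.card (ZMod q)ˣ * (2 * (N * (8 / q)) ^ 2) := by
        rw [Finset.sum_add_distrib, ← Finset.mul_sum, Finset.sum_const, Finset.card_univ,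
          nsmul_eq_mul]
    _ ≤ 2 * (C * (q : ℝ) ^ η * ((D : ℝ) ^ 2 / q + R)) + q * (2 * (N * (8 / q)) ^ 2) := by
        gcongr
    _ = _ := by
        field_simp
        ring

theorem abs_sum_norm_sq_sub_le {ι : Type*} (s : Finset ι) (v u : ι → ℂ) :
    |∑ i ∈ s, ‖v i‖ ^ 2 - ∑ i ∈ s, ‖u i‖ ^ 2| ≤
      2 * √(∑ i ∈ s, ‖u i‖ ^ 2) * √(∑ i ∈ s, ‖v i - u i‖ ^ 2) + ∑ i ∈ s, ‖v i - u i‖ ^ 2 := by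
  rw [← Finset.sum_sub_distrib]
  calc _ ≤ ∑ i ∈ s, (2 * (‖u i‖ * ‖v i - u i‖) + ‖v i - u i‖ ^ 2) := by
        refine (Finset.abs_sum_le_sum_abs _ _).trans (Finset.sum_le_sum fun i _ => ?_)
        rw [sq_sub_sq, abs_mul, abs_of_nonneg (by positivity : 0 ≤ ‖v i‖ + ‖u i‖)]
        have h1 := abs_norm_sub_norm_le (v i) (u i)
        have h2 := norm_sub_norm_le (v i) (u i)
        have h3 := norm_nonneg (v i)
        have h4 := norm_nonneg (u i)
        calc _ ≤ (‖v i - u i‖ + 2 * ‖u i‖) * ‖v i - u i‖ :=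
              mul_le_mul (by linarith) h1 (abs_nonneg _) (by positivity)
          _ = _ := by ring
    _ = 2 * ∑ i ∈ s, ‖u i‖ * ‖v i - u i‖ + ∑ i ∈ s, ‖v i - u i‖ ^ 2 := by
        rw [Finset.sum_add_distrib, Finset.mul_sum]
    _ ≤ _ := by
        have := Real.sum_mul_le_sqrt_mul_sqrt s (fun i => ‖u i‖) fun i => ‖v i - u i‖
        linarith

theorem natCast_sq_div_le_rpow {X ε : ℝ} {q N : ℕ} (hX : 1 ≤ X)
    (hq : X ^ (1 / 2 + 45 * ε) ≤ q) (hN : (N : ℝ) ≤ X ^ (1 / 2 + ε / 2)) :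
    (N : ℝ) ^ 2 / q ≤ X ^ (1 / 2 - 44 * ε) := by
  have hX0 : 0 < X := by linarith
  have hq0 : (0 : ℝ) < q := (Real.rpow_pos_of_pos hX0 _).trans_le hq
  rw [div_le_iff₀ hq0]
  calc (N : ℝ) ^ 2 ≤ (X ^ (1 / 2 + ε / 2)) ^ 2 := by gcongr
    _ = X ^ (1 / 2 - 44 * ε) * X ^ (1 / 2 + 45 * ε) := by
        rw [← Real.rpow_mul_natCast hX0.le, ← Real.rpow_add hX0]
        congr 1
        push_cast
        ring
    _ ≤ _ := by gcongr

theorem offDiag_error_le_rpow {X ε : ℝ} {q N H : ℕ} (hε0 : 0 < ε) (hε1 : ε < 1 / 100)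
    (hX : 1 ≤ X) (hq : X ^ (1 / 2 + 45 * ε) ≤ q) (hN : (N : ℝ) ≤ X ^ (1 / 2 + ε / 2))
    (hH : (H : ℝ) ≤ X ^ (4 * ε) / 4) :
    (2 * (H : ℝ) + 1) ^ 2 * (2 * (1 + 8 * (N : ℝ) ^ 2 / q + N * √(2 * H / q))) ≤
      80 * X ^ (1 / 2 - 3 * ε / 16) := by
  have hX0 : 0 < X := by linarith
  have hq0 : (0 : ℝ) < q := (Real.rpow_pos_of_pos hX0 _).trans_le hq
  have h1 : (1 : ℝ) ≤ X ^ (1 / 2 - 44 * ε) := Real.one_le_rpow hX (by linarith)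
  have h2 := natCast_sq_div_le_rpow hX hq hN
  have h3 : 2 * (H : ℝ) + 1 ≤ 2 * X ^ (4 * ε) := by
    have := Real.one_le_rpow hX (by linarith : 0 ≤ 4 * ε)
    linarith
  have h4 : √(2 * H / q) ≤ X ^ (-(1 / 4) - 41 / 2 * ε) := by
    refine Real.sqrt_le_iff.2 ⟨by positivity, ?_⟩
    rw [div_le_iff₀ hq0]
    calc 2 * (H : ℝ) ≤ X ^ (4 * ε) := by
          have : 0 ≤ X ^ (4 * ε) := by positivity
          linarith
      _ = (X ^ (-(1 / 4) - 41 / 2 * ε)) ^ 2 * X ^ (1 / 2 + 45 * ε) := by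
          rw [← Real.rpow_mul_natCast hX0.le, ← Real.rpow_add hX0]
          congr 1
          push_cast
          ring
      _ ≤ _ := by gcongr
  have h5 : N * √(2 * H / q) ≤ X ^ (1 / 2 - 44 * ε) := by
    calc N * √(2 * H / q) ≤ X ^ (1 / 2 + ε / 2) * X ^ (-(1 / 4) - 41 / 2 * ε) := by gcongr
      _ = X ^ (1 / 4 - 20 * ε) := by
          rw [← Real.rpow_add hX0]
          congr 1
          ring
      _ ≤ _ := Real.rpow_le_rpow_of_exponent_le hX (by linarith)
  calc _ ≤ (2 * X ^ (4 * ε)) ^ 2 * (2 * (X ^ (1 / 2 - 44 * ε) + 8 * X ^ (1 / 2 - 44 * ε) +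
        X ^ (1 / 2 - 44 * ε))) := by
        rw [mul_div_assoc]
        gcongr
    _ = 80 * ((X ^ (4 * ε)) ^ 2 * X ^ (1 / 2 - 44 * ε)) := by ring
    _ = 80 * X ^ (1 / 2 - 36 * ε) := by
        rw [← Real.rpow_mul_natCast hX0.le, ← Real.rpow_add hX0]
        congr 2
        push_cast
        ring
    _ ≤ _ := mul_le_mul_of_nonneg_left
        (Real.rpow_le_rpow_of_exponent_le hX (by linarith)) (by norm_num)

theorem exists_abs_sum_truncModel_sq_sub_le {ε : ℝ} (hε0 : 0 < ε) (hε1 : ε < 1 / 100) :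
    ∃ C : ℝ, 0 < C ∧ ∀ (q : ℕ) [Fact q.Prime] (X : ℝ) (N H : ℕ), 1 ≤ X →
      X ^ (1 / 2 + 45 * ε) ≤ q → (N : ℝ) < X ^ (1 / 2 + ε / 2) → X ^ (1 / 2 + ε / 2) ≤ N + 1 →
      (H : ℝ) ≤ X ^ (4 * ε) / 4 → X ^ (4 * ε) / 4 ≤ H + 1 →
      |∑ m : (ZMod q)ˣ, ‖truncModel X N H (m : ZMod q)‖ ^ 2 - sqfConst * √X| ≤
        C * X ^ (1 / 2 - 3 * ε / 16) := by
  obtain ⟨C₁, hC₁, h₁⟩ := exists_norm_diag_sub_le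
  obtain ⟨C₂, hC₂, h₂⟩ := exists_abs_sum_gcdSummand_sub_le (θ := 3 / 4 + ε / 16)
    (by linarith) (by linarith)
  refine ⟨80 + C₁ * 4 + C₂ * 2, by positivity, fun q _ X N H hX hq hN hN' hH hH' => ?_⟩
  have hX0 : 0 < X := by linarith
  have hqN : N < q := by
    have : (N : ℝ) < q :=
      hN.trans_le ((Real.rpow_le_rpow_of_exponent_le hX (by linarith)).trans hq)
    exact_mod_cast this
  have hqH : 2 * H < q := by
    have : 2 * (H : ℝ) < q := by
      calc 2 * (H : ℝ) ≤ X ^ (4 * ε) / 2 := by linarith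
        _ < X ^ (4 * ε) := half_lt_self (by positivity)
        _ ≤ X ^ (1 / 2 + 45 * ε) := Real.rpow_le_rpow_of_exponent_le hX (by linarith)
        _ ≤ q := hq
    exact_mod_cast this
  have h₃ := norm_sum_truncModel_sq_sub_diag_le X hqH hqN
  have h₄ := h₁ X N H
  have h₅ := h₂ X N hX0.le
  have h₆ := offDiag_error_le_rpow hε0 hε1 hX hq hN.le hH
  have h₇ : N * ((H + 1 : ℕ) : ℝ) ^ (-(1 / 4) : ℝ) ≤ 4 * X ^ (1 / 2 - 3 * ε / 16) := by
    have h4 : ((4 : ℝ)⁻¹) ^ (-(1 / 4) : ℝ) ≤ 4 := by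
      rw [Real.inv_rpow (by norm_num), ← Real.rpow_neg (by norm_num), neg_neg]
      calc (4 : ℝ) ^ (1 / 4 : ℝ) ≤ 4 ^ (1 : ℝ) :=
            Real.rpow_le_rpow_of_exponent_le (by norm_num) (by norm_num)
        _ = 4 := Real.rpow_one 4
    calc N * ((H + 1 : ℕ) : ℝ) ^ (-(1 / 4) : ℝ)
        ≤ X ^ (1 / 2 + ε / 2) * (X ^ (4 * ε) * 4⁻¹) ^ (-(1 / 4) : ℝ) := by
          refine mul_le_mul hN.le ?_ (by positivity) (by positivity)
          refine Real.rpow_le_rpow_of_nonpos (by positivity) ?_ (by norm_num)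
          push_cast
          linarith
      _ ≤ X ^ (1 / 2 + ε / 2) * (X ^ (-ε) * 4) := by
          rw [Real.mul_rpow (by positivity) (by norm_num), ← Real.rpow_mul hX0.le]
          gcongr
          exact le_of_eq (by ring_nf)
      _ = 4 * X ^ (1 / 2 - ε / 2) := by
          rw [← mul_assoc, ← Real.rpow_add hX0, mul_comm]
          congr 2
          ring
      _ ≤ _ := mul_le_mul_of_nonneg_left
          (Real.rpow_le_rpow_of_exponent_le hX (by linarith)) (by norm_num)
  have h₈ : X ^ (2 / 5 : ℝ) + X ^ (3 / 4 + ε / 16) * ((N + 1 : ℕ) : ℝ) ^ (-(1 / 2) : ℝ) ≤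
      2 * X ^ (1 / 2 - 3 * ε / 16) := by
    have ha : X ^ (2 / 5 : ℝ) ≤ X ^ (1 / 2 - 3 * ε / 16) :=
      Real.rpow_le_rpow_of_exponent_le hX (by linarith)
    have hb : X ^ (3 / 4 + ε / 16) * ((N + 1 : ℕ) : ℝ) ^ (-(1 / 2) : ℝ) ≤
        X ^ (1 / 2 - 3 * ε / 16) := by
      calc _ ≤ X ^ (3 / 4 + ε / 16) * (X ^ (1 / 2 + ε / 2)) ^ (-(1 / 2) : ℝ) := by
            refine mul_le_mul_of_nonneg_left ?_ (by positivity)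
            refine Real.rpow_le_rpow_of_nonpos (by positivity) ?_ (by norm_num)
            exact_mod_cast hN'
        _ = _ := by
            rw [← Real.rpow_mul hX0.le, ← Real.rpow_add hX0]
            congr 1
            ring
    linarith
  set G : ℝ := ∑ t ∈ gcdTriples N, gcdSummand X t
  set A : ℝ := ∑ m : (ZMod q)ˣ, ‖truncModel X N H (m : ZMod q)‖ ^ 2
  have h₉ : |A - G| ≤ 80 * X ^ (1 / 2 - 3 * ε / 16) + C₁ * (4 * X ^ (1 / 2 - 3 * ε / 16)) := by
    rw [← Real.norm_eq_abs, ← Complex.norm_real, Complex.ofReal_sub]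
    refine (norm_sub_le_norm_sub_add_norm_sub _ _ _).trans
      (add_le_add (h₃.trans h₆) (h₄.trans ?_))
    gcongr
  calc _ ≤ |A - G| + |G - sqfConst * √X| := abs_sub_le _ _ _
    _ ≤ (80 * X ^ (1 / 2 - 3 * ε / 16) + C₁ * (4 * X ^ (1 / 2 - 3 * ε / 16))) +
        C₂ * (2 * X ^ (1 / 2 - 3 * ε / 16)) := by
        refine add_le_add h₉ (h₅.trans ?_)
        gcongr
    _ = _ := by ring

theorem exists_abs_sum_norm_moebiusExpSum_sq_sub_le {ε : ℝ} (hε0 : 0 < ε) (hε1 : ε < 1 / 100) :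
    ∃ K : ℝ, 0 < K ∧ ∀ (q : ℕ) [Fact q.Prime] [NeZero q] (X z : ℝ) (S : Finset ℕ), 1 ≤ X →
      X ^ (1 / 2 + 45 * ε) ≤ q → (q : ℝ) ≤ X ^ (1 / ε) → X ^ (1 + ε) ≤ z →
      z ≤ q * X ^ (1 / 2 - ε) → (∀ d : ℕ, d ∈ S ↔ 1 ≤ d ∧ (d : ℝ) ^ 2 < z) →
      |∑ m : (ZMod q)ˣ, ‖moebiusExpSum X S (m : ZMod q)‖ ^ 2 - sqfConst * √X| ≤
        K * X ^ (1 / 2 - 3 * ε / 16) := by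
  obtain ⟨C₁, hC₁, h₁⟩ := exists_abs_sum_truncModel_sq_sub_le hε0 hε1
  obtain ⟨C₂, hC₂, h₂⟩ := exists_sum_norm_moebiusExpSum_sub_sq_le (ε ^ 2 / 8) (by positivity)
  refine ⟨2 * √(C₁ + |sqfConst|) * √(5 * C₂ + 128) + (5 * C₂ + 128) + C₁, by positivity,
    fun q _ _ X z S hX hq hqX hz hzq hS => ?_⟩
  have hX0 : 0 < X := by linarith
  have hq0 : (0 : ℝ) < q := (Real.rpow_pos_of_pos hX0 _).trans_le hq
  obtain ⟨N, hN, hN'⟩ : ∃ N : ℕ, (N : ℝ) < X ^ (1 / 2 + ε / 2) ∧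
      X ^ (1 / 2 + ε / 2) ≤ N + 1 := by
    have hpos : 0 < ⌈X ^ (1 / 2 + ε / 2)⌉₊ := Nat.ceil_pos.2 (by positivity)
    refine ⟨⌈X ^ (1 / 2 + ε / 2)⌉₊ - 1, Nat.lt_ceil.1 (by omega), (Nat.le_ceil _).trans ?_⟩
    exact_mod_cast (by omega : ⌈X ^ (1 / 2 + ε / 2)⌉₊ ≤ ⌈X ^ (1 / 2 + ε / 2)⌉₊ - 1 + 1)
  obtain ⟨H, hH, hH'⟩ : ∃ H : ℕ, (H : ℝ) ≤ X ^ (4 * ε) / 4 ∧ X ^ (4 * ε) / 4 ≤ H + 1 :=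
    ⟨_, Nat.floor_le (by positivity), (Nat.lt_floor_add_one _).le⟩
  have hD0 : (X ^ (1 / 2 + ε / 2)) ^ 2 = X ^ (1 + ε) := by
    rw [← Real.rpow_mul_natCast hX0.le]
    congr 1
    push_cast
    ring
  have hz1 : 1 ≤ z := (Real.one_le_rpow hX (by linarith)).trans hz
  have hmodel := h₁ q X N H hX hq hN hN' hH hH'
  have herr := h₂ q X ⌊√z⌋₊ N H (4 * X ^ (1 / 2 - ε / 2)) hX0.le
    (Nat.le_floor (by simpa using hz1)) (by positivity) S ?_ ?_ ?_ ?_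
  rotate_left
  · intro d hd
    obtain ⟨hd1, hdz⟩ := (hS d).1 hd
    refine ⟨hd1, Nat.le_floor (Real.le_sqrt_of_sq_le hdz.le), ?_⟩
    have h1 : X ^ (1 / 2 - ε) ≤ q :=
      (Real.rpow_le_rpow_of_exponent_le hX (by linarith)).trans hq
    have h2 : (d : ℝ) ^ 2 < (q : ℝ) ^ 2 := by
      calc (d : ℝ) ^ 2 < z := hdz
        _ ≤ q * X ^ (1 / 2 - ε) := hzq
        _ ≤ q * q := by gcongr
        _ = _ := by ring
    exact_mod_cast lt_of_pow_lt_pow_left₀ 2 hq0.le h2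
  · intro d hd
    obtain ⟨hd1, hdN⟩ := Finset.mem_Icc.1 hd
    refine (hS d).2 ⟨hd1, lt_of_lt_of_le ?_ (hD0.le.trans hz)⟩
    have : (d : ℝ) < X ^ (1 / 2 + ε / 2) := lt_of_le_of_lt (by exact_mod_cast hdN) hN
    gcongr
  · intro d hd hdN
    have hd1 : X ^ (1 / 2 + ε / 2) ≤ d := hN'.trans (by exact_mod_cast hdN)
    have hd0 : (0 : ℝ) < d := (Real.rpow_pos_of_pos hX0 _).trans_le hd1
    rw [div_le_iff₀ hd0]
    calc X = X ^ (1 / 2 - ε / 2) * X ^ (1 / 2 + ε / 2) := by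
          rw [← Real.rpow_add hX0]
          ring_nf
          rw [Real.rpow_one]
      _ ≤ 4 * X ^ (1 / 2 - ε / 2) * d := by
          have : 0 ≤ X ^ (1 / 2 - ε / 2) := by positivity
          gcongr
          linarith
  · calc (N : ℝ) ≤ X ^ (1 / 2 + ε / 2) := hN.le
      _ ≤ X ^ (1 / 2 - ε / 2 + 4 * ε) := Real.rpow_le_rpow_of_exponent_le hX (by linarith)
      _ = 4 * X ^ (1 / 2 - ε / 2) * (X ^ (4 * ε) / 4) := by
          rw [Real.rpow_add hX0]
          ring
      _ ≤ _ := by gcongr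
  have herr' : ∑ m : (ZMod q)ˣ,
      ‖moebiusExpSum X S (m : ZMod q) - truncModel X N H (m : ZMod q)‖ ^ 2 ≤
      (5 * C₂ + 128) * X ^ (1 / 2 - 3 * ε / 8) := by
    refine herr.trans ?_
    have hqη : (q : ℝ) ^ (ε ^ 2 / 8) ≤ X ^ (ε / 8) := by
      calc (q : ℝ) ^ (ε ^ 2 / 8) ≤ (X ^ (1 / ε)) ^ (ε ^ 2 / 8) := by gcongr
        _ = _ := by
            rw [← Real.rpow_mul hX0.le]
            congr 1
            field_simp
    have hD : ((⌊√z⌋₊ : ℕ) : ℝ) ^ 2 / q ≤ X ^ (1 / 2 - ε / 2) := by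
      rw [div_le_iff₀ hq0]
      calc ((⌊√z⌋₊ : ℕ) : ℝ) ^ 2 ≤ √z ^ 2 := by
            gcongr
            exact Nat.floor_le (Real.sqrt_nonneg z)
        _ = z := Real.sq_sqrt (by linarith)
        _ ≤ q * X ^ (1 / 2 - ε) := hzq
        _ ≤ q * X ^ (1 / 2 - ε / 2) := by
            refine mul_le_mul_of_nonneg_left ?_ hq0.le
            exact Real.rpow_le_rpow_of_exponent_le hX (by linarith)
        _ = _ := mul_comm _ _
    have hN2 := natCast_sq_div_le_rpow hX hq hN.le
    calc _ ≤ C₂ * X ^ (ε / 8) * (X ^ (1 / 2 - ε / 2) + 4 * X ^ (1 / 2 - ε / 2)) +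
          128 * X ^ (1 / 2 - 44 * ε) := by
          rw [mul_div_assoc]
          gcongr
      _ = 5 * C₂ * (X ^ (ε / 8) * X ^ (1 / 2 - ε / 2)) + 128 * X ^ (1 / 2 - 44 * ε) := by ring
      _ ≤ 5 * C₂ * X ^ (1 / 2 - 3 * ε / 8) + 128 * X ^ (1 / 2 - 3 * ε / 8) := by
          rw [← Real.rpow_add hX0]
          gcongr <;> first | exact hX | linarith
      _ = _ := by ring
  have hP : X ^ (1 / 2 - 3 * ε / 16) ≤ √X := by
    rw [Real.sqrt_eq_rpow]
    exact Real.rpow_le_rpow_of_exponent_le hX (by linarith)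
  have hmodel' : ∑ m : (ZMod q)ˣ, ‖truncModel X N H (m : ZMod q)‖ ^ 2 ≤
      (C₁ + |sqfConst|) * √X := by
    have h1 := (abs_le.1 hmodel).2
    have h2 : sqfConst * √X ≤ |sqfConst| * √X := by
      gcongr
      exact le_abs_self _
    have h3 : C₁ * X ^ (1 / 2 - 3 * ε / 16) ≤ C₁ * √X := by gcongr
    linarith
  have hdiff := abs_sum_norm_sq_sub_le Finset.univ
    (fun m : (ZMod q)ˣ => moebiusExpSum X S (m : ZMod q))
    fun m : (ZMod q)ˣ => truncModel X N H (m : ZMod q)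
  have hroot : √((C₁ + |sqfConst|) * √X) * √((5 * C₂ + 128) * X ^ (1 / 2 - 3 * ε / 8)) =
      √(C₁ + |sqfConst|) * √(5 * C₂ + 128) * X ^ (1 / 2 - 3 * ε / 16) := by
    rw [Real.sqrt_mul (by positivity), Real.sqrt_mul (by positivity), mul_mul_mul_comm]
    congr 1
    simp only [Real.sqrt_eq_rpow]
    rw [← Real.rpow_mul hX0.le, ← Real.rpow_mul hX0.le, ← Real.rpow_add hX0]
    congr 1
    ring
  have hexp : X ^ (1 / 2 - 3 * ε / 8) ≤ X ^ (1 / 2 - 3 * ε / 16) :=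
    Real.rpow_le_rpow_of_exponent_le hX (by linarith)
  refine (abs_sub_le _ (∑ m : (ZMod q)ˣ, ‖truncModel X N H (m : ZMod q)‖ ^ 2) _).trans ?_
  refine (add_le_add hdiff hmodel).trans ?_
  calc _ ≤ 2 * √((C₁ + |sqfConst|) * √X) * √((5 * C₂ + 128) * X ^ (1 / 2 - 3 * ε / 8)) +
        (5 * C₂ + 128) * X ^ (1 / 2 - 3 * ε / 16) + C₁ * X ^ (1 / 2 - 3 * ε / 16) := by
        gcongr
        exact herr'.trans (by gcongr)
    _ = _ := by
        rw [mul_assoc 2, hroot]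
        ring

theorem sum_norm_sum_mul_stdAddChar_sq {q : ℕ} [NeZero q] (f : ZMod q → ℝ) :
    ∑ m : ZMod q, ‖∑ a, (f a : ℂ) * ZMod.stdAddChar (-(m * a))‖ ^ 2 = q * ∑ a, f a ^ 2 := by
  apply Complex.ofReal_injective
  have h1 : ∀ m : ZMod q, ((‖∑ a, (f a : ℂ) * ZMod.stdAddChar (-(m * a))‖ ^ 2 : ℝ) : ℂ) =
      ∑ a, ∑ b, (f a : ℂ) * f b * ZMod.stdAddChar (m * (b - a)) := by
    intro m
    rw [Complex.ofReal_pow, ← Complex.mul_conj', map_sum, Finset.sum_mul_sum]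
    refine Finset.sum_congr rfl fun a _ => Finset.sum_congr rfl fun b _ => ?_
    rw [map_mul, Complex.conj_ofReal, ← AddChar.map_neg_eq_conj, neg_neg,
      show m * (b - a) = -(m * a) + m * b by ring, AddChar.map_add_eq_mul]
    ring
  rw [Complex.ofReal_sum]
  simp_rw [h1]
  rw [Finset.sum_comm]
  rw [Complex.ofReal_mul, Complex.ofReal_sum, Finset.mul_sum]
  refine Finset.sum_congr rfl fun a _ => ?_
  rw [Finset.sum_comm]
  simp_rw [← Finset.mul_sum, AddChar.sum_mulShift _ (ZMod.isPrimitive_stdAddChar q), sub_eq_zero,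
    ZMod.card]
  rw [Finset.sum_eq_single a (fun b _ hb => by simp [hb]) (by simp), if_pos rfl]
  push_cast
  ring

/-- The variance over the units in terms of the non-trivial Fourier coefficients. -/
theorem sum_units_sub_mean_sq {q : ℕ} [Fact q.Prime] [NeZero q] (f : ZMod q → ℝ) :
    ∑ u : (ZMod q)ˣ, (f u - (∑ v : (ZMod q)ˣ, f v) / (q - 1)) ^ 2 =
      (∑ m : (ZMod q)ˣ, ‖∑ a, (f a : ℂ) * ZMod.stdAddChar (-((m : ZMod q) * a))‖ ^ 2) / q -
        (f 0 - (∑ a, f a) / q) ^ 2 * (q / (q - 1)) := by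
  have hq : (1 : ℝ) < q := by exact_mod_cast (Fact.out : q.Prime).one_lt
  have hq1 : (q : ℝ) - 1 ≠ 0 := by linarith
  have hq0 : (q : ℝ) ≠ 0 := by linarith
  have h1 : ∑ m : (ZMod q)ˣ, ‖∑ a, (f a : ℂ) * ZMod.stdAddChar (-((m : ZMod q) * a))‖ ^ 2 =
      q * ∑ a, f a ^ 2 - (∑ a, f a) ^ 2 := by
    rw [sum_units_eq_sub fun m : ZMod q => ‖∑ a, (f a : ℂ) * ZMod.stdAddChar (-(m * a))‖ ^ 2,
      sum_norm_sum_mul_stdAddChar_sq]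
    simp only [zero_mul, neg_zero, AddChar.map_zero_eq_one, mul_one]
    rw [← Complex.ofReal_sum, Complex.norm_real, Real.norm_eq_abs, sq_abs]
  have hcard : ((Fintype.card (ZMod q)ˣ : ℕ) : ℝ) = q - 1 := by
    rw [ZMod.card_units, Nat.cast_sub (by exact_mod_cast hq.le), Nat.cast_one]
  have h2 : ∀ c : ℝ, ∑ u : (ZMod q)ˣ, (f u - c) ^ 2 =
      ∑ u : (ZMod q)ˣ, f u ^ 2 - 2 * c * ∑ u : (ZMod q)ˣ, f u + (q - 1) * c ^ 2 := by
    intro c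
    simp_rw [sub_sq, Finset.sum_add_distrib, Finset.sum_sub_distrib, Finset.sum_const,
      Finset.card_univ, nsmul_eq_mul, hcard, Finset.mul_sum]
    congr 2
    exact Finset.sum_congr rfl fun _ _ => by ring
  rw [h1, h2, sum_units_eq_sub f, sum_units_eq_sub fun a => f a ^ 2]
  field_simp
  ring

/-- The sum of `μ(d)` over `d ∈ S` and `n ≤ q X / d²` with `d² n` in the residue class `a`. -/
noncomputable def moebiusResidueSum {q : ℕ} (X : ℝ) (S : Finset ℕ) (a : ZMod q) : ℝ :=
  ∑ d ∈ S, ∑ n ∈ Finset.Icc 1 ⌊q * (X / (d : ℝ) ^ 2)⌋₊,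
    if ((d ^ 2 * n : ℕ) : ZMod q) = a then (ArithmeticFunction.moebius d : ℝ) else 0

theorem sum_moebiusResidueSum_mul_stdAddChar {q : ℕ} [NeZero q] (X : ℝ) (S : Finset ℕ)
    (m : ZMod q) :
    ∑ a, (moebiusResidueSum X S a : ℂ) * ZMod.stdAddChar (-(m * a)) = q * moebiusExpSum X S m := by
  have hq0 : (q : ℂ) ≠ 0 := by exact_mod_cast NeZero.ne q
  simp_rw [moebiusResidueSum, Complex.ofReal_sum, Finset.sum_mul]
  rw [Finset.sum_comm, moebiusExpSum, Finset.mul_sum]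
  refine Finset.sum_congr rfl fun d _ => ?_
  rw [Finset.sum_comm, expSumCoeff, mul_left_comm, mul_div_cancel₀ _ hq0, Finset.mul_sum]
  refine Finset.sum_congr rfl fun n _ => ?_
  rw [Finset.sum_eq_single ((d ^ 2 * n : ℕ) : ZMod q)
    (fun b _ hb => by rw [if_neg hb.symm, Complex.ofReal_zero, zero_mul]) (by simp), if_pos rfl]
  push_cast
  rw [mul_assoc]

theorem moebiusResidueSum_zero_sub {q : ℕ} [Fact q.Prime] [NeZero q] (X : ℝ) {S : Finset ℕ}
    (hS : ∀ d ∈ S, 1 ≤ d ∧ d < q) :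
    moebiusResidueSum X S (0 : ZMod q) - (∑ a : ZMod q, moebiusResidueSum X S a) / q =
      ∑ d ∈ S, (ArithmeticFunction.moebius d : ℝ) *
        (((⌊q * (X / (d : ℝ) ^ 2)⌋₊ / q : ℕ) : ℝ) - (⌊q * (X / (d : ℝ) ^ 2)⌋₊ : ℝ) / q) := by
  have hq : q.Prime := Fact.out
  simp_rw [moebiusResidueSum]
  rw [Finset.sum_comm, Finset.sum_div, ← Finset.sum_sub_distrib]
  refine Finset.sum_congr rfl fun d hd => ?_
  have hdq : ¬ q ∣ d := fun h => by
    have := Nat.le_of_dvd (hS d hd).1 h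
    have := (hS d hd).2
    omega
  have h0 : ∀ n : ℕ, ((d ^ 2 * n : ℕ) : ZMod q) = 0 ↔ q ∣ n := fun n => by
    rw [ZMod.natCast_eq_zero_iff, hq.dvd_mul]
    exact ⟨fun h => h.resolve_left fun h => hdq (hq.dvd_of_dvd_pow h), Or.inr⟩
  rw [Finset.sum_comm]
  simp_rw [h0, Finset.sum_ite_eq, Finset.mem_univ, if_true, ← Finset.sum_filter]
  rw [Finset.sum_const, Finset.sum_const, Nat.card_Icc, Nat.add_sub_cancel, nsmul_eq_mul,
    nsmul_eq_mul]
  have h1 : ∀ M : ℕ, ((Finset.Icc 1 M).filter fun n => q ∣ n).card = M / q := fun M => by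
    rw [← Nat.Ioc_filter_dvd_card_eq_div]
    rfl
  rw [h1]
  ring

theorem abs_natDiv_sub_div_le (M q : ℕ) : |((M / q : ℕ) : ℝ) - (M : ℝ) / q| ≤ 1 ∧
    |((M / q : ℕ) : ℝ) - (M : ℝ) / q| ≤ (M : ℝ) / q := by
  have h1 : ((M / q : ℕ) : ℝ) ≤ (M : ℝ) / q := Nat.cast_div_le
  have h2 : (M : ℝ) / q ≤ ((M / q : ℕ) : ℝ) + 1 := by
    rcases Nat.eq_zero_or_pos q with rfl | hq
    · simp
    · rw [div_le_iff₀ (by exact_mod_cast hq)]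
      have := (Nat.lt_mul_div_succ M hq).le
      rw [mul_comm] at this
      exact_mod_cast this
  have h3 : (0 : ℝ) ≤ ((M / q : ℕ) : ℝ) := Nat.cast_nonneg _
  rw [abs_sub_comm, abs_of_nonneg (by linarith)]
  constructor <;> linarith

theorem exists_abs_moebiusResidueSum_zero_sub_le {θ : ℝ} (hθ : 1 / 2 < θ) (hθ1 : θ ≤ 1) :
    ∃ C : ℝ, 0 < C ∧ ∀ (q : ℕ) [Fact q.Prime] [NeZero q] (X : ℝ), 0 ≤ X →
      ∀ S : Finset ℕ, (∀ d ∈ S, 1 ≤ d ∧ d < q) →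
      |moebiusResidueSum X S (0 : ZMod q) - (∑ a : ZMod q, moebiusResidueSum X S a) / q| ≤
        C * X ^ θ := by
  have hs : Summable fun d : ℕ => (d : ℝ) ^ (-(2 * θ)) :=
    Real.summable_nat_rpow.2 (by linarith)
  have hs0 : 0 ≤ ∑' d : ℕ, (d : ℝ) ^ (-(2 * θ)) := tsum_nonneg fun d => by positivity
  refine ⟨∑' d : ℕ, (d : ℝ) ^ (-(2 * θ)) + 1, by linarith, fun q _ _ X hX S hS => ?_⟩
  have hq0 : (0 : ℝ) < q := by exact_mod_cast (Fact.out : q.Prime).pos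
  rw [moebiusResidueSum_zero_sub X hS]
  calc _ ≤ ∑ d ∈ S, (d : ℝ) ^ (-(2 * θ)) * X ^ θ := by
        refine (Finset.abs_sum_le_sum_abs _ _).trans (Finset.sum_le_sum fun d hd => ?_)
        obtain ⟨h1, h2⟩ := abs_natDiv_sub_div_le ⌊q * (X / (d : ℝ) ^ 2)⌋₊ q
        have h3 : (⌊q * (X / (d : ℝ) ^ 2)⌋₊ : ℝ) / q ≤ X / (d : ℝ) ^ 2 := by
          rw [div_le_iff₀ hq0, mul_comm _ (q : ℝ)]
          exact Nat.floor_le (by positivity)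
        have h4 := le_rpow_of_le_one_of_le (abs_nonneg _) h1 (h2.trans h3)
          (by linarith : 0 ≤ θ) hθ1
        have h5 : |(ArithmeticFunction.moebius d : ℝ)| ≤ 1 := by
          exact_mod_cast ArithmeticFunction.abs_moebius_le_one (n := d)
        rw [abs_mul]
        refine (mul_le_of_le_one_left (abs_nonneg _) h5).trans (h4.trans (le_of_eq ?_))
        rw [Real.div_rpow hX (by positivity), ← Real.rpow_natCast_mul (by positivity),
          Real.rpow_neg (by positivity), div_eq_inv_mul]
        norm_num
    _ = (∑ d ∈ S, (d : ℝ) ^ (-(2 * θ))) * X ^ θ := by rw [Finset.sum_mul]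
    _ ≤ _ := by
        gcongr
        exact (hs.sum_le_tsum S fun d _ => by positivity).trans (by linarith)

theorem sum_range_coprime_eq_sum_units {q : ℕ} [Fact q.Prime] [NeZero q] (g : ZMod q → ℝ) :
    ∑ a ∈ Finset.range q, (if Nat.Coprime a q then g (a : ZMod q) else 0) =
      ∑ u : (ZMod q)ˣ, g u := by
  rw [← Finset.sum_filter]
  refine Finset.sum_bij (fun a ha => ZMod.unitOfCoprime a (Finset.mem_filter.1 ha).2)
    (fun _ _ => Finset.mem_univ _) (fun a ha b hb h => ?_) (fun u _ => ?_) (fun a ha => ?_)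
  · have h' := congrArg (fun u : (ZMod q)ˣ => (u : ZMod q)) h
    simp only [ZMod.coe_unitOfCoprime] at h'
    exact natCast_inj_of_lt (Finset.mem_range.1 (Finset.mem_filter.1 ha).1)
      (Finset.mem_range.1 (Finset.mem_filter.1 hb).1) h'
  · refine ⟨(u : ZMod q).val, Finset.mem_filter.2 ⟨Finset.mem_range.2 (ZMod.val_lt _),
      ZMod.val_coe_unit_coprime u⟩, Units.ext ?_⟩
    rw [ZMod.coe_unitOfCoprime, ZMod.natCast_zmod_val]
  · rw [ZMod.coe_unitOfCoprime]

theorem apPairSmallA_eq_moebiusResidueSum (x z : ℝ) {q a : ℕ} (ha : a < q) :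
    apPairSmallA x z q a = moebiusResidueSum (x / q)
      ((Finset.Icc 1 ⌊√x⌋₊).filter fun d : ℕ => (d : ℝ) ^ 2 < z) (a : ZMod q) := by
  have hq0 : (q : ℝ) ≠ 0 := by exact_mod_cast (Nat.zero_lt_of_lt ha).ne'
  refine Finset.sum_congr rfl fun d _ => ?_
  rw [div_right_comm, mul_div_cancel₀ _ hq0]
  refine Finset.sum_congr rfl fun n _ => ?_
  have h : (d ^ 2 * n) % q = a ↔ ((d ^ 2 * n : ℕ) : ZMod q) = (a : ZMod q) := by
    rw [ZMod.natCast_eq_natCast_iff, Nat.ModEq, Nat.mod_eq_of_lt ha]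
  simp only [h]

theorem apPairSmallB_eq_sum_moebiusResidueSum (x z : ℝ) {q : ℕ} [Fact q.Prime] [NeZero q] :
    apPairSmallB x z q = ∑ u : (ZMod q)ˣ, moebiusResidueSum (x / q)
      ((Finset.Icc 1 ⌊√x⌋₊).filter fun d : ℕ => (d : ℝ) ^ 2 < z) (u : ZMod q) := by
  have hq0 : (q : ℝ) ≠ 0 := by exact_mod_cast NeZero.ne q
  simp_rw [moebiusResidueSum]
  rw [Finset.sum_comm, apPairSmallB]
  refine Finset.sum_congr rfl fun d _ => ?_
  rw [Finset.sum_comm, div_right_comm, mul_div_cancel₀ _ hq0]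
  refine Finset.sum_congr rfl fun n _ => ?_
  rw [sum_units_eq_sub fun a : ZMod q =>
    if ((d ^ 2 * n : ℕ) : ZMod q) = a then (ArithmeticFunction.moebius d : ℝ) else 0,
    Finset.sum_ite_eq, if_pos (Finset.mem_univ _)]
  have h : Nat.Coprime (d ^ 2 * n) q ↔ ¬ ((d ^ 2 * n : ℕ) : ZMod q) = 0 := by
    rw [← ZMod.isUnit_iff_coprime, isUnit_iff_ne_zero]
  simp only [h]
  split_ifs <;> simp

theorem exists_abs_variance_sub_le {ε : ℝ} (hε0 : 0 < ε) (hε1 : ε < 1 / 100) :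
    ∃ K : ℝ, 0 < K ∧ ∀ (q : ℕ) [Fact q.Prime] [NeZero q] (X z : ℝ) (S : Finset ℕ), 1 ≤ X →
      X ^ (1 / 2 + 45 * ε) ≤ q → (q : ℝ) ≤ X ^ (1 / ε) → X ^ (1 + ε) ≤ z →
      z ≤ q * X ^ (1 / 2 - ε) → (∀ d : ℕ, d ∈ S ↔ 1 ≤ d ∧ (d : ℝ) ^ 2 < z) →
      |1 / ((q : ℝ) - 1) * ∑ u : (ZMod q)ˣ, (moebiusResidueSum X S (u : ZMod q) -
        (∑ v : (ZMod q)ˣ, moebiusResidueSum X S (v : ZMod q)) / (q - 1)) ^ 2 - sqfConst * √X| ≤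
        K * X ^ (1 / 2 - ε / 16) := by
  obtain ⟨C₁, hC₁, h₁⟩ := exists_abs_sum_norm_moebiusExpSum_sq_sub_le hε0 hε1
  obtain ⟨C₂, hC₂, h₂⟩ := exists_abs_moebiusResidueSum_zero_sub_le (θ := 1 / 2 + ε)
    (by linarith) (by linarith)
  refine ⟨C₁ + 2 * (C₁ + |sqfConst|) + 4 * C₂ ^ 2, by positivity,
    fun q _ _ X z S hX hq hqX hz hzq hS => ?_⟩
  have hX0 : 0 < X := by linarith
  have hq2 : (2 : ℝ) ≤ q := by exact_mod_cast (Fact.out : q.Prime).two_le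
  have hq0 : (0 : ℝ) < q := by linarith
  have hq1 : (0 : ℝ) < q - 1 := by linarith
  have hV := h₁ q X z S hX hq hqX hz hzq hS
  have hΔ := h₂ q X hX0.le S fun d hd => by
    obtain ⟨hd1, hdz⟩ := (hS d).1 hd
    have h1 : X ^ (1 / 2 - ε) ≤ q :=
      (Real.rpow_le_rpow_of_exponent_le hX (by linarith)).trans hq
    have h2 : (d : ℝ) ^ 2 < (q : ℝ) ^ 2 := by
      calc (d : ℝ) ^ 2 < z := hdz
        _ ≤ q * X ^ (1 / 2 - ε) := hzq
        _ ≤ q * q := by gcongr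
        _ = _ := by ring
    exact ⟨hd1, by exact_mod_cast lt_of_pow_lt_pow_left₀ 2 hq0.le h2⟩
  rw [sum_units_sub_mean_sq fun a : ZMod q => moebiusResidueSum X S a]
  simp_rw [sum_moebiusResidueSum_mul_stdAddChar, norm_mul, mul_pow, Complex.norm_natCast,
    ← Finset.mul_sum]
  set V : ℝ := ∑ m : (ZMod q)ˣ, ‖moebiusExpSum X S (m : ZMod q)‖ ^ 2
  set Δ : ℝ := moebiusResidueSum X S (0 : ZMod q) - (∑ a : ZMod q, moebiusResidueSum X S a) / q
  have hV0 : 0 ≤ V := Finset.sum_nonneg fun _ _ => by positivity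
  have hexp : X ^ (1 / 2 - 3 * ε / 16) ≤ X ^ (1 / 2 - ε / 16) :=
    Real.rpow_le_rpow_of_exponent_le hX (by linarith)
  have hsqrt : X ^ (1 / 2 - 3 * ε / 16) ≤ √X := by
    rw [Real.sqrt_eq_rpow]
    exact Real.rpow_le_rpow_of_exponent_le hX (by linarith)
  have hVX : V ≤ (C₁ + |sqfConst|) * √X := by
    have h1 := (abs_le.1 hV).2
    have h2 : sqfConst * √X ≤ |sqfConst| * √X := by
      gcongr
      exact le_abs_self _
    have h3 : C₁ * X ^ (1 / 2 - 3 * ε / 16) ≤ C₁ * √X := by gcongr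
    linarith
  have hVq : V / (q - 1) ≤ 2 * (C₁ + |sqfConst|) * X ^ (1 / 2 - ε / 16) := by
    rw [div_le_iff₀ hq1]
    have h1 : √X ≤ q := by
      rw [Real.sqrt_eq_rpow]
      exact (Real.rpow_le_rpow_of_exponent_le hX (by linarith)).trans hq
    have h2 : 1 ≤ X ^ (1 / 2 - ε / 16) := Real.one_le_rpow hX (by linarith)
    calc V ≤ (C₁ + |sqfConst|) * √X := hVX
      _ ≤ (C₁ + |sqfConst|) * (2 * (q - 1)) := by
          gcongr
          linarith
      _ = 2 * (C₁ + |sqfConst|) * 1 * (q - 1) := by ring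
      _ ≤ _ := by gcongr
  have hΔq : Δ ^ 2 * (q / (q - 1) ^ 2) ≤ 4 * C₂ ^ 2 * X ^ (1 / 2 - ε / 16) := by
    have h1 : (q : ℝ) / (q - 1) ^ 2 ≤ 4 / q := by
      rw [div_le_div_iff₀ (by positivity) hq0]
      nlinarith
    have h2 : Δ ^ 2 ≤ (C₂ * X ^ (1 / 2 + ε)) ^ 2 := by
      rw [← sq_abs]
      gcongr
    have h3 : 4 / (q : ℝ) ≤ 4 / X ^ (1 / 2 + 45 * ε) := by gcongr
    calc _ ≤ (C₂ * X ^ (1 / 2 + ε)) ^ 2 * (4 / X ^ (1 / 2 + 45 * ε)) :=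
          mul_le_mul h2 (h1.trans h3) (by positivity) (by positivity)
      _ = 4 * C₂ ^ 2 * ((X ^ (1 / 2 + ε)) ^ 2 / X ^ (1 / 2 + 45 * ε)) := by ring
      _ = 4 * C₂ ^ 2 * X ^ (1 / 2 - 43 * ε) := by
          rw [← Real.rpow_mul_natCast hX0.le, ← Real.rpow_sub hX0]
          congr 2
          push_cast
          ring
      _ ≤ _ := mul_le_mul_of_nonneg_left
          (Real.rpow_le_rpow_of_exponent_le hX (by linarith)) (by positivity)
  have hdecomp : 1 / ((q : ℝ) - 1) * ((q : ℝ) ^ 2 * V / q - Δ ^ 2 * (q / (q - 1))) -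
      sqfConst * √X = (V - sqfConst * √X) + (V / (q - 1) - Δ ^ 2 * (q / (q - 1) ^ 2)) := by
    field_simp
    ring
  rw [hdecomp]
  have h1 : 0 ≤ V / (q - 1) := by positivity
  have h2 : 0 ≤ Δ ^ 2 * (q / (q - 1) ^ 2) := by positivity
  have h3 : |V / (q - 1) - Δ ^ 2 * (q / (q - 1) ^ 2)| ≤
      V / (q - 1) + Δ ^ 2 * (q / (q - 1) ^ 2) := abs_le.2 ⟨by linarith, by linarith⟩
  have h4 : C₁ * X ^ (1 / 2 - 3 * ε / 16) ≤ C₁ * X ^ (1 / 2 - ε / 16) := by gcongr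
  have h5 := abs_add_le (V - sqfConst * √X) (V / (q - 1) - Δ ^ 2 * (q / (q - 1) ^ 2))
  linarith

theorem small_divisors_variance_q_aspect :
    ∀ ε : ℝ, ε ∈ Set.Ioo (0 : ℝ) (1 / 100) →
      ∃ K : ℝ, 0 < K ∧
        ∀ (x : ℝ) (q : ℕ), 1 ≤ x → q.Prime →
          x ^ ((1 : ℝ) / 3 + 30 * ε) ≤ (q : ℝ) → (q : ℝ) ≤ x ^ (1 - ε : ℝ) →
          ∀ z : ℝ, (x / q) ^ (1 + ε) ≤ z → z ≤ x ^ (-ε) * Real.sqrt (q * x) →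
            |(1 / (q.totient : ℝ)) *
                (∑ a ∈ Finset.range q, if Nat.Coprime a q then
                  |apPairSmallA x z q a - (1 / (q.totient : ℝ)) * apPairSmallB x z q| ^ 2 else 0)
              - sqfConst * Real.sqrt (x / q)|
            ≤ K * (x / q) ^ ((1 : ℝ) / 2 - ε / 16) := by
  intro ε hε
  obtain ⟨hε0, hε1⟩ := hε
  obtain ⟨K, hK, h⟩ := exists_abs_variance_sub_le hε0 hε1
  refine ⟨K, hK, fun x q hx hq hqx hxq z hz hzx => ?_⟩
  have : Fact q.Prime := ⟨hq⟩
  have : NeZero q := ⟨hq.ne_zero⟩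
  have hx0 : 0 < x := by linarith
  have hq1 : (1 : ℝ) ≤ q := by exact_mod_cast hq.one_le
  have hq0 : (0 : ℝ) < q := by linarith
  have hqx' : (q : ℝ) ≤ x :=
    hxq.trans ((Real.rpow_le_rpow_of_exponent_le hx (by linarith)).trans_eq (Real.rpow_one x))
  have hlow : x ^ ε ≤ x / q := by
    rw [le_div_iff₀ hq0]
    calc x ^ ε * q ≤ x ^ ε * x ^ (1 - ε) := by gcongr
      _ = x := by rw [← Real.rpow_add hx0, add_sub_cancel, Real.rpow_one]
  have hX : 1 ≤ x / q := (Real.one_le_rpow hx hε0.le).trans hlow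
  have hXq : (x / q) ^ (1 / 2 + 45 * ε) ≤ q := by
    have h1 : x / q ≤ x ^ (2 / 3 - 30 * ε) := by
      rw [div_le_iff₀ hq0]
      calc x = x ^ (2 / 3 - 30 * ε) * x ^ (1 / 3 + 30 * ε) := by
            rw [← Real.rpow_add hx0]
            ring_nf
            rw [Real.rpow_one]
        _ ≤ _ := by gcongr
    calc (x / q) ^ (1 / 2 + 45 * ε) ≤ (x ^ (2 / 3 - 30 * ε)) ^ (1 / 2 + 45 * ε) := by gcongr
      _ = x ^ ((2 / 3 - 30 * ε) * (1 / 2 + 45 * ε)) := by rw [← Real.rpow_mul hx0.le]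
      _ ≤ x ^ (1 / 3 + 30 * ε) := Real.rpow_le_rpow_of_exponent_le hx (by nlinarith)
      _ ≤ q := hqx
  have hqX : (q : ℝ) ≤ (x / q) ^ (1 / ε) := by
    calc (q : ℝ) ≤ x := hqx'
      _ = (x ^ ε) ^ (1 / ε) := by
          rw [← Real.rpow_mul hx0.le, mul_one_div_cancel hε0.ne', Real.rpow_one]
      _ ≤ _ := by gcongr
  have hzq : z ≤ q * (x / q) ^ (1 / 2 - ε) := by
    have h1 : √(q * x) = q * √(x / q) := by
      rw [show (q : ℝ) * x = (q : ℝ) ^ 2 * (x / q) by field_simp,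
        Real.sqrt_mul (by positivity), Real.sqrt_sq hq0.le]
    have h2 : x ^ (-ε) ≤ (x / q) ^ (-ε) :=
      Real.rpow_le_rpow_of_nonpos (by linarith) (div_le_self hx0.le hq1) (by linarith)
    calc z ≤ x ^ (-ε) * (q * √(x / q)) := h1 ▸ hzx
      _ ≤ (x / q) ^ (-ε) * (q * √(x / q)) := by gcongr
      _ = q * ((x / q) ^ (1 / 2 : ℝ) * (x / q) ^ (-ε)) := by
          rw [Real.sqrt_eq_rpow]
          ring
      _ = _ := by rw [← Real.rpow_add (by linarith), ← sub_eq_add_neg]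
  have hzx' : z ≤ x := by
    calc z ≤ x ^ (-ε) * √(q * x) := hzx
      _ ≤ 1 * √(x * x) := by
          gcongr
          exact Real.rpow_le_one_of_one_le_of_nonpos hx (by linarith)
      _ = x := by rw [one_mul, Real.sqrt_mul_self hx0.le]
  have hmain := h q (x / q) z ((Finset.Icc 1 ⌊√x⌋₊).filter fun d : ℕ => (d : ℝ) ^ 2 < z) hX hXq
    hqX hz hzq fun d => by
      rw [Finset.mem_filter, Finset.mem_Icc]
      exact ⟨fun hd => ⟨hd.1.1, hd.2⟩, fun hd => ⟨⟨hd.1,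
        Nat.le_floor (Real.le_sqrt_of_sq_le (hd.2.le.trans hzx'))⟩, hd.2⟩⟩
  have hφ : (q.totient : ℝ) = q - 1 := by
    rw [Nat.totient_prime hq, Nat.cast_sub hq.one_le, Nat.cast_one]
  rw [← sum_range_coprime_eq_sum_units (fun a : ZMod q => (moebiusResidueSum (x / q)
    ((Finset.Icc 1 ⌊√x⌋₊).filter fun d : ℕ => (d : ℝ) ^ 2 < z) a - _) ^ 2),
    ← apPairSmallB_eq_sum_moebiusResidueSum] at hmain
  rw [hφ]
  convert! hmain using 6 with a ha
  rw [sq_abs, apPairSmallA_eq_moebiusResidueSum x z (Finset.mem_range.1 ha)]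
  ring
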